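/- Let g be a root-reductive Lie algebra with Dynkin Borel subalgebra b, and let K ⊂ h* be an upper finite ideal. Then: (i) ^K O is extension full in O; (ii) ^K O is extension full in the category C of all h-semisimple g-modules; (iii) for the inclusion ι : ^K Ō → ^K O, the induced maps Ext^i_{^K Ō}(M,N) → Ext^i_{^K O}(M,N) are isomorphisms for all i ≥ 0 whenever M ∈ F^Δ or N ∈ F^∇. -/

import Mathlib

set_option linter.unusedSectionVars false

open UniversalEnvelopingAlgebra

noncomputable section

universe u

variable (K : Type) [Field K] [IsAlgClosed K] [CharZero K]
variable (g : Type) [LieRing g] [LieAlgebra K g]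

/-- The weight space of a Lie module for a weight `χ` of a subalgebra `h`. -/
def wtSpace (h : LieSubalgebra K g) (M : Type) [AddCommGroup M] [Module K M]
    [LieRingModule g M] [LieModule K g M] (χ : Module.Dual K h) : Submodule K M where
  carrier := {m | ∀ H : h, ⁅(H : g), m⁆ = χ H • m}
  add_mem' := by intro a b ha hb H; rw [lie_add, ha H, hb H, smul_add]
  zero_mem' := by intro H; rw [lie_zero, smul_zero]
  smul_mem' := by intro c m hm H; rw [lie_smul, hm H, smul_comm]

/-- The root space of `g` relative to `h` for the functional `α`. -/
abbrev rootSp (h : LieSubalgebra K g) (α : Module.Dual K h) : Submodule K g :=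
  wtSpace K g h g α

/-- Notation for the universal enveloping algebra. -/
abbrev UEA (L : Type) [LieRing L] [LieAlgebra K L] : Type :=
  UniversalEnvelopingAlgebra K L

variable {K} in
/-- The Lie module structure on a quotient of the universal enveloping algebra
by a left ideal. -/
instance uqLRM (L : Type) [LieRing L] [LieAlgebra K L]
    (I : Submodule (UEA K L) (UEA K L)) : LieRingModule L ((UEA K L) ⧸ I) where
  bracket x m := ι K x • m
  add_lie x y m := by
    show (ι K (x + y)) • m = (ι K x) • m + (ι K y) • m
    rw [map_add, add_smul]
  lie_add x m n := by
    show (ι K x) • (m + n) = (ι K x) • m + (ι K x) • n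
    rw [smul_add]
  leibniz_lie x y m := by
    show (ι K x) • ((ι K y) • m) = (ι K ⁅x, y⁆) • m + (ι K y) • ((ι K x) • m)
    letI : LieRing (UniversalEnvelopingAlgebra K L) := LieRing.ofAssociativeRing
    rw [LieHom.map_lie, LieRing.of_associative_ring_bracket, sub_smul, mul_smul, mul_smul,
      sub_add_cancel]

variable {K} in
instance uqLM (L : Type) [LieRing L] [LieAlgebra K L]
    (I : Submodule (UEA K L) (UEA K L)) : LieModule K L ((UEA K L) ⧸ I) where
  smul_lie c x m := by
    show (ι K (c • x)) • m = c • ((ι K x) • m)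
    rw [map_smul]
    exact smul_assoc c (ι K x) m
  lie_smul c x m := by
    show (ι K x) • (c • m) = c • ((ι K x) • m)
    exact smul_comm _ _ _

/-- A root-reductive Lie algebra together with a splitting Borel subalgebra `b ⊇ h`
containing a fixed splitting maximal toral (Cartan) subalgebra `h`.  The fields record:
an exhausting chain `gc n` of nested finite-dimensional reductive subalgebras, each
reductive in the next, with compatible Cartan subalgebras and root vectors; the root
decomposition of `g` with respect to `h` with one-dimensional root spaces; a positive
system `Φp` closed under addition and the corresponding Borel subalgebra `b = h ⊕ n⁺`;
the anti-involution `τ`; coroots and the weight `ρ`. -/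
structure RootReductive where
  h : LieSubalgebra K g
  gc : ℕ → LieSubalgebra K g
  gc_mono : Monotone gc
  gc_findim : ∀ n, FiniteDimensional K (gc n)
  gc_exhausts : ∀ x : g, ∃ n, x ∈ gc n
  gc_reductive : ∀ n, LieAlgebra.radical K (gc n) = LieAlgebra.center K (gc n)
  gc_red_in : ∀ n, ∀ N : Submodule K g, N ≤ (gc (n+1)).toSubmodule →
      (∀ x ∈ gc n, ∀ v ∈ N, ⁅x, v⁆ ∈ N) →
      ∃ N' : Submodule K g, N' ≤ (gc (n+1)).toSubmodule ∧
        (∀ x ∈ gc n, ∀ v ∈ N', ⁅x, v⁆ ∈ N') ∧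
        N ⊓ N' = ⊥ ∧ N ⊔ N' = (gc (n+1)).toSubmodule
  gc_cartan : ∀ n, ∃ hc : LieSubalgebra K (gc n),
      ((hc : Set (gc n)) = ((↑) : (gc n) → g) ⁻¹' (h : Set g)) ∧ hc.IsCartanSubalgebra
  h_exhaust : ∀ x ∈ h, ∃ n, x ∈ gc n
  Φ : Set (Module.Dual K h)
  root_iff : ∀ α, α ∈ Φ ↔ α ≠ 0 ∧ rootSp K g h α ≠ ⊥
  root_dim : ∀ α ∈ Φ, Module.rank K (rootSp K g h α) = 1
  gc_rootdec : ∀ n, (gc n).toSubmodule =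
      ((gc n).toSubmodule ⊓ h.toSubmodule) ⊔
        (⨆ α ∈ Φ, ((gc n).toSubmodule ⊓ rootSp K g h α))
  rootdec : h.toSubmodule ⊔ (⨆ α ∈ Φ, rootSp K g h α) = ⊤
  Φp : Set (Module.Dual K h)
  pos_subset : Φp ⊆ Φ
  pos_union : Φ = Φp ∪ (-Φp)
  pos_disjoint : Disjoint Φp (-Φp)
  pos_add : ∀ α ∈ Φp, ∀ β ∈ Φp, α + β ∈ Φ → α + β ∈ Φp
  b : LieSubalgebra K g
  h_le_b : h ≤ b
  b_def : b.toSubmodule = h.toSubmodule ⊔ (⨆ α ∈ Φp, rootSp K g h α)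
  np : LieSubalgebra K g
  np_def : np.toSubmodule = ⨆ α ∈ Φp, rootSp K g h α
  nm : LieSubalgebra K g
  nm_def : nm.toSubmodule = ⨆ α ∈ Φp, rootSp K g h (-α)
  τ : g →ₗ[K] g
  τ_invol : ∀ x, τ (τ x) = x
  τ_anti : ∀ x y, τ ⁅x, y⁆ = ⁅τ y, τ x⁆
  τ_h : ∀ x ∈ h, τ x = x
  τ_root : ∀ (α : Module.Dual K h), ∀ x ∈ rootSp K g h α, τ x ∈ rootSp K g h (-α)
  coroot : Module.Dual K h → h
  coroot_two : ∀ α ∈ Φ, α (coroot α) = 2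
  coroot_neg : ∀ α ∈ Φ, coroot (-α) = - coroot α
  ρ : Module.Dual K h
  ρ_simple : ∀ α ∈ Φp, (¬ ∃ β ∈ Φp, ∃ γ ∈ Φp, β + γ = α) → ρ (coroot α) = 1

namespace RootReductive

variable {K g} (S : RootReductive K g)

/-- The nilradical `n⁺` of the Borel subalgebra, as a submodule. -/
def nplus : Submodule K g := ⨆ α ∈ S.Φp, rootSp K g S.h α

/-- `Γ⁺`: the additive monoid of sums of positive roots. -/
def Γp : AddSubmonoid (Module.Dual K S.h) := AddSubmonoid.closure S.Φp

/-- The order `μ ≤ λ` iff `λ - μ ∈ Γ⁺`. -/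
def wle (μ lam : Module.Dual K S.h) : Prop := lam - μ ∈ S.Γp

/-- The set of simple (positive) roots. -/
def simples : Set (Module.Dual K S.h) :=
  {α ∈ S.Φp | ¬ ∃ β ∈ S.Φp, ∃ γ ∈ S.Φp, β + γ = α}

/-- `b` is a Dynkin Borel subalgebra: every element of `Γ⁺` is a sum of simple roots. -/
def IsDynkin : Prop := ∀ α ∈ S.Φp, α ∈ AddSubmonoid.closure S.simples

/-- The finite-rank subalgebra `g_n = g̃_n + h`. -/
def gfull (n : ℕ) : LieSubalgebra K g := S.gc n ⊔ S.h

/-- The roots `Φ_n` of `g_n`. -/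
def levelRoots (n : ℕ) : Set (Module.Dual K S.h) :=
  {α ∈ S.Φ | rootSp K g S.h α ≤ (S.gfull n).toSubmodule}

/-- The root lattice `ℤΦ_n`. -/
def zrootsLevel (n : ℕ) : AddSubgroup (Module.Dual K S.h) :=
  AddSubgroup.closure (S.levelRoots n)

/-- The root lattice `ℤΦ`. -/
def zroots : AddSubgroup (Module.Dual K S.h) := AddSubgroup.closure S.Φ

/-- The partial order `≤_n` relative to the positive roots of `g_n`. -/
def wleLevel (n : ℕ) (μ lam : Module.Dual K S.h) : Prop :=
  lam - μ ∈ AddSubmonoid.closure (S.Φp ∩ S.levelRoots n)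

/-- The defining left ideal of the Verma module `Δ(λ) = U(g)/I_λ`, where
`I_λ` is generated by `n⁺` and the elements `H - λ(H)`, `H ∈ h`. -/
def vIdeal (lam : Module.Dual K S.h) : Submodule (UEA K g) (UEA K g) :=
  Submodule.span (UEA K g)
    ({u | ∃ x ∈ S.nplus, u = ι K x} ∪
     {u | ∃ H : S.h, u = ι K (H : g) - algebraMap K (UEA K g) (lam H)})

/-- The Verma module `Δ(λ)`. -/
abbrev Verma (lam : Module.Dual K S.h) : Type := (UEA K g) ⧸ S.vIdeal lam

/-- The left ideal corresponding to the maximal submodule of `Δ(λ)`. -/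
def radIdeal (lam : Module.Dual K S.h) : Submodule (UEA K g) (UEA K g) :=
  sSup {J | S.vIdeal lam ≤ J ∧ J ≠ ⊤}

/-- The simple highest weight module `L(λ)`, the unique simple quotient of `Δ(λ)`. -/
abbrev SimpleHW (lam : Module.Dual K S.h) : Type := (UEA K g) ⧸ S.radIdeal lam

/-- The defining left ideal of the Verma module of a subalgebra `h ≤ a`, relative to the
Borel subalgebra `a ∩ b`. -/
def vIdealSub (a : LieSubalgebra K g) (ha : S.h ≤ a) (lam : Module.Dual K S.h) :
    Submodule (UEA K a) (UEA K a) :=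
  Submodule.span (UEA K a)
    ({u | ∃ x : a, (x : g) ∈ S.nplus ∧ u = ι K x} ∪
     {u | ∃ H : S.h, u = ι K (⟨(H : g), ha H.2⟩ : a) - algebraMap K (UEA K a) (lam H)})

/-- The Verma module `Δ_a(λ)` of a subalgebra `h ≤ a ≤ g`. -/
abbrev VermaSub (a : LieSubalgebra K g) (ha : S.h ≤ a) (lam : Module.Dual K S.h) : Type :=
  (UEA K a) ⧸ S.vIdealSub a ha lam

def radIdealSub (a : LieSubalgebra K g) (ha : S.h ≤ a) (lam : Module.Dual K S.h) :
    Submodule (UEA K a) (UEA K a) :=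
  sSup {J | S.vIdealSub a ha lam ≤ J ∧ J ≠ ⊤}

/-- The simple highest weight module `L_a(λ)` of a subalgebra `h ≤ a ≤ g`. -/
abbrev SimpleHWSub (a : LieSubalgebra K g) (ha : S.h ≤ a) (lam : Module.Dual K S.h) : Type :=
  (UEA K a) ⧸ S.radIdealSub a ha lam

end RootReductive

/-- The subquotient `B/(A ∩ B)` of a module attached to two submodules `A ≤ B`. -/
abbrev subquot {R M : Type} [Ring R] [AddCommGroup M] [Module R M]
    (A B : Submodule R M) : Type :=
  B ⧸ (A.comap B.subtype)

/-- The multiplicity `[M : N]` of a module `N` in a module `M`: the supremum, over all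
finite filtrations of `M`, of the number of subquotients isomorphic to `N`. -/
noncomputable def jhMult (R M N : Type) [Ring R] [AddCommGroup M] [Module R M]
    [AddCommGroup N] [Module R N] : Cardinal.{0} :=
  ⨆ (n : ℕ), ⨆ (F : Fin (n+1) →o Submodule R M),
    ⨆ (_ : F 0 = ⊥ ∧ F (Fin.last n) = ⊤),
      (Nat.card {i : Fin n //
        Nonempty ((subquot (F i.castSucc) (F i.succ)) ≃ₗ[R] N)} : Cardinal)

/-- The `K`-vector space structure on the space of `U(L)`-module homomorphisms,
via the central embedding `K → U(L)`. -/
def homKModule (L : Type) [LieRing L] [LieAlgebra K L] (M N : Type)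
    [AddCommGroup M] [Module (UEA K L) M] [AddCommGroup N] [Module (UEA K L) N] :
    Module K (M →ₗ[UEA K L] N) :=
  letI : Module K N := Module.compHom N (algebraMap K (UEA K L))
  letI : SMulCommClass (UEA K L) K N :=
    ⟨fun u c n => by
      show u • ((algebraMap K (UEA K L) c) • n) = (algebraMap K (UEA K L) c) • (u • n)
      rw [smul_smul, smul_smul, Algebra.commutes]⟩
  inferInstance

/-- The dimension over `K` of the space of `U(L)`-module homomorphisms. -/
noncomputable def homDim (L : Type) [LieRing L] [LieAlgebra K L] (M N : Type)
    [AddCommGroup M] [Module (UEA K L) M] [AddCommGroup N] [Module (UEA K L) N] :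
    Cardinal :=
  letI := homKModule K L M N
  Module.rank K (M →ₗ[UEA K L] N)

namespace RootReductive

variable {K g} (S : RootReductive K g)

/-- The weight set of weight `χ` of a `U(g)`-module. -/
def wtSet (M : Type) [AddCommGroup M] [Module (UEA K g) M]
    (χ : Module.Dual K S.h) : Set M :=
  {m | ∀ H : S.h, (ι K (H : g)) • m = (algebraMap K (UEA K g) (χ H)) • m}

/-- A `U(g)`-module is a weight module (i.e. semisimple as an `h`-module) if it is the
sum of its weight spaces. -/
def IsWeightMod (M : Type) [AddCommGroup M] [Module (UEA K g) M] : Prop :=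
  ∀ m : M, m ∈ AddSubgroup.closure (⋃ χ : Module.Dual K S.h, S.wtSet M χ)

/-- The support of a module: the set of weights whose weight space is non-zero. -/
def suppSet (M : Type) [AddCommGroup M] [Module (UEA K g) M] :
    Set (Module.Dual K S.h) :=
  {χ | ∃ m ∈ S.wtSet M χ, m ≠ 0}

/-- Local finiteness of the action of the Borel subalgebra `b`:
every vector lies in a finite-dimensional `b`-stable subspace. -/
def IsLocFin (M : Type) [AddCommGroup M] [Module (UEA K g) M] : Prop :=
  letI : Module K M := Module.compHom M (algebraMap K (UEA K g))
  ∀ m : M, ∃ N : Submodule K M, m ∈ N ∧ FiniteDimensional K N ∧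
    ∀ x ∈ S.b, ∀ v ∈ N, (ι K x) • v ∈ N

/-- The module has finite-dimensional weight spaces. -/
def HasFinDimWt (M : Type) [AddCommGroup M] [Module (UEA K g) M] : Prop :=
  letI : Module K M := Module.compHom M (algebraMap K (UEA K g))
  ∀ χ : Module.Dual K S.h, ∃ s : Finset M,
    ↑s ⊆ S.wtSet M χ ∧ S.wtSet M χ ⊆ (Submodule.span K (s : Set M) : Set M)

/-- Membership in category `O`: a weight module with locally finite `b`-action. -/
def InO (M : Type) [AddCommGroup M] [Module (UEA K g) M] : Prop :=
  S.IsWeightMod M ∧ S.IsLocFin M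

/-- A subset of `h^*` is an ideal for the order `≤`. -/
def IsIdeal (A : Set (Module.Dual K S.h)) : Prop :=
  ∀ lam ∈ A, ∀ μ, S.wle μ lam → μ ∈ A

/-- A subset of `h^*` is upper finite. -/
def UpperFinite (A : Set (Module.Dual K S.h)) : Prop :=
  ∀ μ ∈ A, {lam ∈ A | S.wle μ lam}.Finite

/-- The dot action of a linear automorphism of `h^*`: `w · λ = w(λ+ρ) - ρ`. -/
def dot (w : Module.Dual K S.h ≃ₗ[K] Module.Dual K S.h)
    (lam : Module.Dual K S.h) : Module.Dual K S.h :=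
  w (lam + S.ρ) - S.ρ

/-- The dot action of the reflection `r_α`: `r_α · λ = λ - (λ+ρ)(Hα) α`. -/
def rdot (α lam : Module.Dual K S.h) : Module.Dual K S.h :=
  lam - ((lam + S.ρ) (S.coroot α)) • α

/-- One step of the Bruhat order: `μ = r_α · λ ≤ λ` for a positive root `α`. -/
def bruhatStep (μ lam : Module.Dual K S.h) : Prop :=
  ∃ α ∈ S.Φp, μ = S.rdot α lam ∧ S.wle μ lam

/-- The Bruhat order on `h^*`. -/
def bruhat : Module.Dual K S.h → Module.Dual K S.h → Prop :=
  Relation.ReflTransGen (fun μ lam => S.bruhatStep μ lam)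

/-- The set of reflections `r_α`, `α ∈ Φ`, as linear automorphisms of `h^*`. -/
def reflSet : Set (Module.Dual K S.h ≃ₗ[K] Module.Dual K S.h) :=
  {w | ∃ α ∈ S.Φ, ∀ lam, w lam = lam - (lam (S.coroot α)) • α}

/-- The Weyl group `W`, generated by all reflections. -/
def weylGroup : Subgroup (Module.Dual K S.h ≃ₗ[K] Module.Dual K S.h) :=
  Subgroup.closure S.reflSet

/-- The integral Weyl group `W[λ]` of a weight. -/
def intWeyl (lam : Module.Dual K S.h) :
    Set (Module.Dual K S.h ≃ₗ[K] Module.Dual K S.h) :=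
  {w | w ∈ S.weylGroup ∧ S.dot w lam - lam ∈ S.zroots}

/-- The orbit `[[λ]] = W[λ] · λ`. -/
def orbit (lam : Module.Dual K S.h) : Set (Module.Dual K S.h) :=
  {μ | ∃ w ∈ S.intWeyl lam, μ = S.dot w lam}

/-- An integral weight. -/
def IsIntegral (lam : Module.Dual K S.h) : Prop :=
  ∀ w ∈ S.weylGroup, S.dot w lam - lam ∈ S.zroots

/-- A dominant weight. -/
def IsDominant (lam : Module.Dual K S.h) : Prop :=
  ∀ w ∈ S.intWeyl lam, S.wle (S.dot w lam) lam

/-- An antidominant weight. -/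
def IsAntidominant (lam : Module.Dual K S.h) : Prop :=
  ∀ w ∈ S.intWeyl lam, S.wle lam (S.dot w lam)

/-- A regular weight. -/
def IsRegular (lam : Module.Dual K S.h) : Prop :=
  ∀ w ∈ S.intWeyl lam, S.dot w lam = lam → w = 1

/-- A Verma flag with highest weights in a prescribed set. -/
def HasVermaFlagIn (A : Set (Module.Dual K S.h)) (M : Type) [AddCommGroup M]
    [Module (UEA K g) M] : Prop :=
  ∃ (n : ℕ) (F : Fin (n+1) →o Submodule (UEA K g) M), F 0 = ⊥ ∧ F (Fin.last n) = ⊤ ∧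
    ∀ i : Fin n, ∃ lam ∈ A,
      Nonempty ((subquot (F i.castSucc) (F i.succ)) ≃ₗ[UEA K g] S.Verma lam)

/-- A (finite) Verma flag. -/
def HasVermaFlag (M : Type) [AddCommGroup M] [Module (UEA K g) M] : Prop :=
  S.HasVermaFlagIn Set.univ M

end RootReductive
variable {K} {g}

/-- Data exhibiting a `U(g)`-module as the dual Verma module `∇(μ) = Δ(μ)^∨`: an
embedding into the full `K`-linear dual of `Δ(μ)`, which intertwines the `g`-action with
the `τ`-twisted action, and whose image is exactly the `h`-finite dual of `Δ(μ)`. -/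
structure DualVermaData (S : RootReductive K g) (μ : Module.Dual K S.h) where
  M : Type
  [acg : AddCommGroup M]
  [mod : Module (UEA K g) M]
  pair : M →+ ((S.Verma μ) →ₗ[K] K)
  inj : Function.Injective pair
  equivar : ∀ (x : g) (f : M) (v : S.Verma μ),
    pair ((ι K x) • f) v = pair f ((ι K (S.τ x)) • v)
  finsupp : ∀ f : M,
    {χ : Module.Dual K S.h | ∃ v ∈ S.wtSet (S.Verma μ) χ, pair f v ≠ 0}.Finite
  surj : ∀ φ : (S.Verma μ) →ₗ[K] K,
    {χ : Module.Dual K S.h | ∃ v ∈ S.wtSet (S.Verma μ) χ, φ v ≠ 0}.Finite →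
      ∃ f : M, pair f = φ

attribute [instance] DualVermaData.acg DualVermaData.mod

/-- A finite dual Verma flag, relative to a family of dual Verma modules. -/
def HasDualVermaFlag (S : RootReductive K g)
    (Nb : ∀ μ : Module.Dual K S.h, DualVermaData S μ)
    (M : Type) [AddCommGroup M] [Module (UEA K g) M] : Prop :=
  ∃ (n : ℕ) (F : Fin (n+1) →o Submodule (UEA K g) M), F 0 = ⊥ ∧ F (Fin.last n) = ⊤ ∧
    ∀ i : Fin n, ∃ lam,
      Nonempty ((subquot (F i.castSucc) (F i.succ)) ≃ₗ[UEA K g] (Nb lam).M)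
open CategoryTheory

section YExt

variable (A : Type) [Ring A]

/-- An `n`-fold Yoneda extension (`n ≥ 1`) of `X` by `Y` inside the full subcategory of
`A`-modules cut out by the predicate `P` (a Serre subcategory of `A`-Mod, so that
exactness is computed in `A`-Mod): an exact sequence `0 → Y → M_n → ⋯ → M_1 → X → 0`
whose objects all satisfy `P`. -/
structure NExtn (P : ModuleCat.{0} A → Prop) (n : ℕ) (X Y : ModuleCat.{0} A) where
  ob : Fin (n+2) → ModuleCat.{0} A
  ob_first : ob 0 = Y
  ob_last : ob (Fin.last (n+1)) = X
  prop : ∀ i, P (ob i)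
  map : ∀ i : Fin (n+1), ob i.castSucc ⟶ ob i.succ
  inj : Function.Injective (map 0)
  surj : Function.Surjective (map (Fin.last n))
  isexact : ∀ i : Fin n, Function.Exact (map i.castSucc) (map i.succ)

/-- A morphism of `n`-extensions fixing `X` and `Y`. -/
def NExtn.Dominates {P : ModuleCat.{0} A → Prop} {n : ℕ} {X Y : ModuleCat.{0} A}
    (E F : NExtn A P n X Y) : Prop :=
  ∃ φ : ∀ i, E.ob i ⟶ F.ob i,
    (φ 0 = eqToHom (E.ob_first.trans F.ob_first.symm)) ∧
    (φ (Fin.last (n+1)) = eqToHom (E.ob_last.trans F.ob_last.symm)) ∧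
    ∀ i : Fin (n+1), E.map i ≫ φ i.succ = φ i.castSucc ≫ F.map i

/-- The Yoneda extension group `Ext^n` (as a set of equivalence classes), `n ≥ 1`. -/
def YExt (P : ModuleCat.{0} A → Prop) (n : ℕ) (X Y : ModuleCat.{0} A) : Type 1 :=
  Quot (NExtn.Dominates A (P := P) (n := n) (X := X) (Y := Y))

/-- Relaxing the predicate of an `n`-extension. -/
def NExtn.relax {P Q : ModuleCat.{0} A → Prop} (hPQ : ∀ M, P M → Q M) {n : ℕ}
    {X Y : ModuleCat.{0} A} (E : NExtn A P n X Y) : NExtn A Q n X Y :=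
  { E with prop := fun i => hPQ _ (E.prop i) }

/-- The canonical map `Ext^n_B(X,Y) → Ext^n_C(X,Y)` induced by the inclusion of the
subcategory cut out by `P` into the one cut out by `Q`. -/
def yextMap {P Q : ModuleCat.{0} A → Prop} (hPQ : ∀ M, P M → Q M) {n : ℕ}
    {X Y : ModuleCat.{0} A} : YExt A P n X Y → YExt A Q n X Y :=
  Quot.map (NExtn.relax A hPQ) (by
    rintro E F ⟨φ, h1, h2, h3⟩
    exact ⟨φ, h1, h2, h3⟩)

/-- The Yoneda extension groups in all degrees (`Ext⁰ = Hom`). -/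
def YExtFam (P : ModuleCat.{0} A → Prop) : ℕ → (X Y : ModuleCat.{0} A) → Type 1
  | 0, X, Y => ULift.{1} (X ⟶ Y)
  | (n+1), X, Y => YExt A P (n+1) X Y

/-- The canonical maps on Yoneda extension groups in all degrees. -/
def yextFamMap {P Q : ModuleCat.{0} A → Prop} (hPQ : ∀ M, P M → Q M) {X Y : ModuleCat.{0} A} :
    (i : ℕ) → YExtFam A P i X Y → YExtFam A Q i X Y
  | 0 => fun f => f
  | (n+1) => yextMap A hPQ

/-- Extension fullness of the subcategory cut out by `P` in the one cut out by `Q`: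
all induced maps on Yoneda extension groups are bijective. -/
def ExtFullPair (P Q : ModuleCat.{0} A → Prop) (hPQ : ∀ M, P M → Q M) : Prop :=
  ∀ X Y : ModuleCat.{0} A, P X → P Y →
    ∀ i : ℕ, Function.Bijective (yextFamMap A hPQ (X := X) (Y := Y) i)

end YExt


section Yoneda

variable {A : Type} [Ring A]

/-- A three-term complex `Z → M → X` of modules. -/
structure SES (Z X : ModuleCat.{0} A) where
  M : ModuleCat.{0} A
  i : Z →ₗ[A] M
  p : M →ₗ[A] X
  zero : ∀ z, p (i z) = 0

/-- The complex is a short exact sequence. -/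
structure SES.IsEx {Z X : ModuleCat.{0} A} (E : SES Z X) : Prop where
  inj : Function.Injective E.i
  surj : Function.Surjective E.p
  ex : ∀ m, E.p m = 0 → ∃ z, E.i z = m

/-- Spliced complexes `Y → M_{n+1} → ⋯ → M_1 → X`. -/
def YE (Y : ModuleCat.{0} A) : ℕ → ModuleCat.{0} A → Type 1
  | 0, X => SES Y X
  | n + 1, X => Σ Z : ModuleCat.{0} A, SES Z X × YE Y n Z

namespace YE

/-- All splices are exact, and the middle terms satisfy `P`. -/
def Ok (P : ModuleCat.{0} A → Prop) {Y : ModuleCat.{0} A} :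
    ∀ {n : ℕ} {X : ModuleCat.{0} A}, YE Y n X → Prop
  | 0, _, E => SES.IsEx E ∧ P (SES.M E)
  | _ + 1, _, E => E.2.1.IsEx ∧ P E.2.1.M ∧ Ok P E.2.2

/-- There is a morphism of spliced complexes with prescribed ends. -/
def Mor {Y Y' : ModuleCat.{0} A} (ψ : Y →ₗ[A] Y') :
    ∀ {n : ℕ} {X X' : ModuleCat.{0} A}, YE Y n X → YE Y' n X' → (X →ₗ[A] X') → Prop
  | 0, _, _, E, F, φ => ∃ m : SES.M E →ₗ[A] SES.M F,
      (∀ y, m (SES.i E y) = SES.i F (ψ y)) ∧ ∀ x, SES.p F (m x) = φ (SES.p E x)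
  | _ + 1, _, _, E, F, φ => ∃ (m : E.2.1.M →ₗ[A] F.2.1.M) (z : E.1 →ₗ[A] F.1),
      (∀ y, m (E.2.1.i y) = F.2.1.i (z y)) ∧ (∀ x, F.2.1.p (m x) = φ (E.2.1.p x)) ∧
        Mor ψ E.2.2 F.2.2 z

theorem Mor.comp {Y Y' Y'' : ModuleCat.{0} A} {ψ : Y →ₗ[A] Y'} {ψ' : Y' →ₗ[A] Y''} :
    ∀ {n : ℕ} {X X' X'' : ModuleCat.{0} A} {E : YE Y n X} {F : YE Y' n X'} {G : YE Y'' n X''}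
      {φ : X →ₗ[A] X'} {φ' : X' →ₗ[A] X''}, Mor ψ E F φ → Mor ψ' F G φ' →
      Mor (ψ' ∘ₗ ψ) E G (φ' ∘ₗ φ)
  | 0, _, _, _, _, _, _, _, _, ⟨m, h1, h2⟩, ⟨m', h1', h2'⟩ =>
    ⟨m' ∘ₗ m, fun y => by simp [h1, h1'], fun x => by simp [h2, h2']⟩
  | _ + 1, _, _, _, _, _, _, _, _, ⟨m, z, h1, h2, h3⟩, ⟨m', z', h1', h2', h3'⟩ =>
    ⟨m' ∘ₗ m, z' ∘ₗ z, fun y => by simp [h1, h1'], fun x => by simp [h2, h2'], h3.comp h3'⟩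

theorem Mor.refl {Y : ModuleCat.{0} A} :
    ∀ {n : ℕ} {X : ModuleCat.{0} A} (E : YE Y n X), Mor LinearMap.id E E LinearMap.id
  | 0, _, _ => ⟨LinearMap.id, fun _ => rfl, fun _ => rfl⟩
  | _ + 1, _, E => ⟨LinearMap.id, LinearMap.id, fun _ => rfl, fun _ => rfl, refl E.2.2⟩

theorem Ok.mono {P Q : ModuleCat.{0} A → Prop} (h : ∀ M, P M → Q M) {Y : ModuleCat.{0} A} :
    ∀ {n : ℕ} {X : ModuleCat.{0} A} {E : YE Y n X}, E.Ok P → E.Ok Q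
  | 0, _, _, hE => ⟨hE.1, h _ hE.2⟩
  | _ + 1, _, _, hE => ⟨hE.1, h _ hE.2.1, hE.2.2.mono h⟩

/-- Equivalence of exact spliced complexes with middle terms in `P`. -/
def Eqv (P : ModuleCat.{0} A → Prop) {Y X : ModuleCat.{0} A} {n : ℕ} (E F : YE Y n X) : Prop :=
  Relation.EqvGen
    (fun E F : YE Y n X => E.Ok P ∧ F.Ok P ∧ Mor LinearMap.id E F LinearMap.id) E F

theorem Eqv.of_mor {P : ModuleCat.{0} A → Prop} {Y X : ModuleCat.{0} A} {n : ℕ} {E F : YE Y n X}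
    (hE : E.Ok P) (hF : F.Ok P) (h : Mor LinearMap.id E F LinearMap.id) : Eqv P E F :=
  Relation.EqvGen.rel _ _ ⟨hE, hF, h⟩

/-- A relation lemma: functions respecting morphisms respect equivalence. -/
theorem Eqv.map {P Q : ModuleCat.{0} A → Prop} {Y X Y' X' : ModuleCat.{0} A} {n n' : ℕ}
    (f : YE Y n X → YE Y' n' X')
    (h : ∀ E F : YE Y n X, E.Ok P → F.Ok P → Mor LinearMap.id E F LinearMap.id →
      Eqv Q (f E) (f F)) {E F : YE Y n X} (hEF : Eqv P E F) : Eqv Q (f E) (f F) := by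
  induction hEF with
  | rel E F hh => exact h E F hh.1 hh.2.1 hh.2.2
  | refl => exact Relation.EqvGen.refl _
  | symm _ _ _ ih => exact ih.symm
  | trans _ _ _ _ _ ih1 ih2 => exact ih1.trans _ _ _ ih2

end YE

/-- Complexes `Y → ob 0 → ⋯ → ob (n+1) → X` with indexed terms. -/
structure Pre (n : ℕ) (Y X : ModuleCat.{0} A) where
  ob : Fin (n + 2) → ModuleCat.{0} A
  map : ∀ i : Fin (n + 1), ob i.castSucc →ₗ[A] ob i.succ
  ψ : Y →ₗ[A] ob 0
  p : ob (Fin.last (n + 1)) →ₗ[A] X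
  hd : ∀ (i : Fin n) (x : ob i.castSucc.castSucc), map i.succ (map i.castSucc x) = 0
  hp : ∀ x, p (map (Fin.last n) x) = 0

namespace Pre

/-- Replace the last term by the kernel of its augmentation. -/
def tail {n : ℕ} {Y X : ModuleCat.{0} A} (N : Pre (n + 1) Y X) :
    Pre n Y (ModuleCat.of A (LinearMap.ker N.p)) where
  ob i := N.ob i.castSucc
  map i := N.map i.castSucc
  ψ := N.ψ
  p := (N.map (Fin.last (n + 1))).codRestrict (LinearMap.ker N.p) N.hp
  hd i x := N.hd i.castSucc x
  hp x := Subtype.ext (N.hd (Fin.last n) x)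

/-- The spliced complex of an indexed complex. -/
def toY {Y : ModuleCat.{0} A} : ∀ {n : ℕ} {X : ModuleCat.{0} A}, Pre n Y X → YE Y n X
  | 0, _, N => (⟨N.ob 1, N.map 0 ∘ₗ N.ψ, N.p, fun z => N.hp (N.ψ z)⟩ : SES _ _)
  | _ + 1, _, N => ⟨ModuleCat.of A (LinearMap.ker N.p),
      ⟨N.ob (Fin.last _), (LinearMap.ker N.p).subtype, N.p, fun z => z.2⟩, toY N.tail⟩

/-- Exactness of an indexed complex. -/
structure IsEx {n : ℕ} {Y X : ModuleCat.{0} A} (N : Pre n Y X) : Prop where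
  bij : Function.Bijective N.ψ
  inj : Function.Injective (N.map 0)
  ex : ∀ (i : Fin n) y, N.map i.succ y = 0 → ∃ x, N.map i.castSucc x = y
  exl : ∀ y, N.p y = 0 → ∃ x, N.map (Fin.last n) x = y
  surj : Function.Surjective N.p

theorem IsEx.tail {n : ℕ} {Y X : ModuleCat.{0} A} {N : Pre (n + 1) Y X} (h : N.IsEx) :
    N.tail.IsEx where
  bij := h.bij
  inj := h.inj
  ex i y hy := h.ex i.castSucc y hy
  exl y hy := h.ex (Fin.last n) y (congrArg Subtype.val hy)
  surj := by
    rintro ⟨y, hy⟩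
    obtain ⟨x, rfl⟩ := h.exl y hy
    exact ⟨x, rfl⟩

theorem toY_ok {P : ModuleCat.{0} A → Prop} {Y : ModuleCat.{0} A} :
    ∀ {n : ℕ} {X : ModuleCat.{0} A} (N : Pre n Y X), N.IsEx → (∀ i, P (N.ob i)) → (toY N).Ok P
  | 0, _, N, h, hP => ⟨⟨h.inj.comp h.bij.1, h.surj, fun m hm => by
      obtain ⟨x, rfl⟩ := h.exl m hm
      obtain ⟨y, rfl⟩ := h.bij.2 x
      exact ⟨y, rfl⟩⟩, hP 1⟩
  | _ + 1, _, N, h, hP => ⟨⟨Subtype.val_injective, h.surj, fun m hm => ⟨⟨m, hm⟩, rfl⟩⟩, hP _,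
      toY_ok N.tail h.tail fun i => hP i.castSucc⟩

theorem mor_toY {Y Y' : ModuleCat.{0} A} {ψ : Y →ₗ[A] Y'} :
    ∀ {n : ℕ} {X X' : ModuleCat.{0} A} (N : Pre n Y X) (N' : Pre n Y' X') (φ : X →ₗ[A] X')
      (f : ∀ i, N.ob i →ₗ[A] N'.ob i), (∀ y, f 0 (N.ψ y) = N'.ψ (ψ y)) →
      (∀ i x, f _ (N.map i x) = N'.map i (f _ x)) →
      (∀ x, N'.p (f _ x) = φ (N.p x)) → YE.Mor ψ (toY N) (toY N') φ
  | 0, _, _, N, N', φ, f, h0, h1, h2 => ⟨f 1, fun y => by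
      refine (h1 0 (N.ψ y)).trans ?_
      exact congrArg (N'.map 0) (h0 y), h2⟩
  | n + 1, _, _, N, N', φ, f, h0, h1, h2 => ⟨f _,
      (f (Fin.last _)).restrict (p := LinearMap.ker N.p) (q := LinearMap.ker N'.p) fun x hx => by
        rw [LinearMap.mem_ker] at hx ⊢; rw [h2, hx, map_zero],
      fun y => rfl, h2, mor_toY N.tail N'.tail _ (fun i => f i.castSucc) h0
        (fun i x => h1 i.castSucc x) fun x => Subtype.ext (h1 (Fin.last _) x).symm⟩

theorem exists_of_mor_toY {Y Y' : ModuleCat.{0} A} {ψ : Y →ₗ[A] Y'} :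
    ∀ {n : ℕ} {X X' : ModuleCat.{0} A} (N : Pre n Y X) (N' : Pre n Y' X') (φ : X →ₗ[A] X'),
      Function.Bijective N.ψ → YE.Mor ψ (toY N) (toY N') φ →
      ∃ f : ∀ i, N.ob i →ₗ[A] N'.ob i, (∀ y, f 0 (N.ψ y) = N'.ψ (ψ y)) ∧
      (∀ i x, f _ (N.map i x) = N'.map i (f _ x)) ∧ (∀ x, N'.p (f _ x) = φ (N.p x))
  | 0, _, _, N, N', φ, hb, ⟨m, h1, h2⟩ => by
    let e := LinearEquiv.ofBijective N.ψ hb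
    let f : ∀ i, N.ob i →ₗ[A] N'.ob i := Fin.lastCases (motive := fun i => N.ob i →ₗ[A] N'.ob i)
      m (fun i => Fin.cases (motive := fun i : Fin 1 => N.ob i.castSucc →ₗ[A] N'.ob i.castSucc)
        (N'.ψ ∘ₗ ψ ∘ₗ e.symm.toLinearMap) (fun i => i.elim0) i)
    have f0 : ∀ y, f 0 (N.ψ y) = N'.ψ (ψ y) := fun y => by
      have : f 0 = N'.ψ ∘ₗ ψ ∘ₗ e.symm.toLinearMap := rfl
      rw [this]
      have : e.symm (N.ψ y) = y := e.symm_apply_apply y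
      simp [this]
    refine ⟨f, f0, fun i x => ?_, h2⟩
    obtain rfl : i = 0 := Fin.fin_one_eq_zero i
    obtain ⟨y, rfl⟩ := hb.2 x
    refine (h1 y).trans ?_
    exact congrArg (N'.map 0) (f0 y).symm
  | n + 1, _, _, N, N', φ, hb, ⟨m, z, h1, h2, h3⟩ => by
    obtain ⟨f, g0, g1, g2⟩ := exists_of_mor_toY N.tail N'.tail z hb h3
    let F : ∀ i, N.ob i →ₗ[A] N'.ob i := Fin.lastCases (motive := fun i => N.ob i →ₗ[A] N'.ob i)
      m f
    have Fl : F (Fin.last _) = m := Fin.lastCases_last ..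
    have Fc : ∀ i, F (Fin.castSucc i) = f i := fun i => Fin.lastCases_castSucc ..
    refine ⟨F, fun y => ?_, fun i x => ?_, fun x => ?_⟩
    · have : F 0 = f 0 := Fc 0
      rw [this]; exact g0 y
    · induction i using Fin.lastCases with
      | last =>
        have e1 : F (Fin.last (n + 1)).castSucc = f (Fin.last (n + 1)) := Fc _
        have e2 : F (Fin.last (n + 1)).succ = m := Fl
        rw [e1, e2]
        have := h1 (N.tail.p x)
        refine this.trans ?_
        exact congrArg Subtype.val (g2 x).symm
      | cast i =>
        have e1 : F i.castSucc.castSucc = f i.castSucc := Fc _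
        have e2 : F i.castSucc.succ = f i.succ := Fc i.succ
        rw [e1, e2]
        exact g1 i x
    · rw [Fl]; exact h2 x

theorem exists_snoc {α : Type*} {n : ℕ} (f : Fin n → α) (a : α) :
    ∃ F : Fin (n + 1) → α, (fun i => F i.castSucc) = f ∧ F (Fin.last n) = a :=
  ⟨Fin.snoc (α := fun _ => α) f a, by simp, by simp⟩

theorem exists_toY {P : ModuleCat.{0} A → Prop} {Y : ModuleCat.{0} A} (hY : P Y) :
    ∀ {n : ℕ} {X : ModuleCat.{0} A} (E : YE Y n X), E.Ok P →
      ∃ N : Pre n Y X, N.IsEx ∧ (∀ i, P (N.ob i)) ∧ (∃ h : Y = N.ob 0, N.ψ = (eqToHom h).hom) ∧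
        YE.Mor LinearMap.id (toY N) E LinearMap.id ∧ YE.Mor LinearMap.id E (toY N) LinearMap.id
  | 0, X, E, h => by
    obtain ⟨M, i, p, hz⟩ := E
    let m : ∀ j : Fin 1, ![Y, M] j.castSucc →ₗ[A] ![Y, M] j.succ :=
      Fin.cases (motive := fun j : Fin 1 => ![Y, M] j.castSucc →ₗ[A] ![Y, M] j.succ) i
        fun j => j.elim0
    refine ⟨⟨![Y, M], m, LinearMap.id, p, fun i => i.elim0, hz⟩,
      ⟨Function.bijective_id, h.1.inj, fun i => i.elim0, h.1.ex, h.1.surj⟩, ?_, ⟨rfl, rfl⟩, ?_⟩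
    · intro i
      fin_cases i
      · exact hY
      · exact h.2
    · exact ⟨⟨LinearMap.id, fun _ => rfl, fun _ => rfl⟩, ⟨LinearMap.id, fun _ => rfl, fun _ => rfl⟩⟩
  | n + 1, X, ⟨Z, ⟨M, i, p, hz⟩, E⟩, h => by
    obtain ⟨N, hN, hP, hY, hM, hM'⟩ := exists_toY hY E h.2.2
    obtain ⟨ob, map, ψ, q, hd, hp⟩ := N
    obtain ⟨F, rfl, rfl⟩ := exists_snoc ob M
    let m : ∀ j : Fin (n + 2), F j.castSucc →ₗ[A] F j.succ := Fin.lastCases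
      (motive := fun j : Fin (n + 2) => F j.castSucc →ₗ[A] F j.succ) (i ∘ₗ q) map
    have e1 : ∀ j, m (Fin.castSucc j) = map j := fun j =>
      Fin.lastCases_castSucc (motive := fun j : Fin (n + 2) => F j.castSucc →ₗ[A] F j.succ) j
    have e2 : m (Fin.last _) = i ∘ₗ q :=
      Fin.lastCases_last (motive := fun j : Fin (n + 2) => F j.castSucc →ₗ[A] F j.succ)
    let N' : Pre (n + 1) Y X := ⟨F, m, ψ, p, fun j x => by
        rw [e1]
        induction j using Fin.lastCases with
        | last =>
          refine (LinearMap.congr_fun e2 _).trans ?_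
          exact (congrArg i (hp x)).trans (map_zero i)
        | cast j => exact (LinearMap.congr_fun (e1 j.succ) _).trans (hd j x), fun x => by
        rw [e2]
        exact hz _⟩
    have hi : ∀ y, N'.p y = 0 → ∃ x, N'.map (Fin.last _) x = y := fun y hy => by
      obtain ⟨z, rfl⟩ := h.1.ex y hy
      obtain ⟨x, rfl⟩ := hN.surj z
      exact ⟨x, LinearMap.congr_fun e2 x⟩
    refine ⟨N', ⟨hN.bij, ?_, fun j y hy => ?_, hi, h.1.surj⟩, fun j => ?_, hY, ?_⟩
    · have : N'.map 0 = map 0 := e1 0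
      rw [this]; exact hN.inj
    · induction j using Fin.lastCases with
      | last =>
        have e2' : N'.map (Fin.last n).succ = i ∘ₗ q := e2
        rw [e2'] at hy
        have : q y = 0 := h.1.inj (hy.trans (map_zero _).symm)
        obtain ⟨x, rfl⟩ := hN.exl y this
        exact ⟨x, LinearMap.congr_fun (e1 _) x⟩
      | cast j =>
        have e3 : N'.map j.castSucc.succ = map j.succ := e1 j.succ
        rw [e3] at hy
        obtain ⟨x, rfl⟩ := hN.ex j y hy
        exact ⟨x, LinearMap.congr_fun (e1 _) x⟩
    · induction j using Fin.lastCases with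
      | last => exact h.2.1
      | cast j => exact hP j
    · let e : Z ≃ₗ[A] LinearMap.ker p := LinearEquiv.ofBijective (i.codRestrict _ hz)
        ⟨fun a b hab => h.1.inj (congrArg Subtype.val hab), fun ⟨y, hy⟩ => by
          obtain ⟨z, rfl⟩ := h.1.ex y hy
          exact ⟨z, rfl⟩⟩
      have he : ∀ z, (e z : F (Fin.last _)) = i z := fun z => rfl
      refine ⟨⟨LinearMap.id, e.symm.toLinearMap, fun y => ?_, fun x => rfl, ?_⟩,
        ⟨LinearMap.id, e.toLinearMap, fun y => rfl, fun x => rfl, ?_⟩⟩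
      · exact ((he _).symm.trans (congrArg Subtype.val (e.apply_symm_apply y))).symm
      · have : YE.Mor LinearMap.id (toY N'.tail)
            (toY (⟨fun j => F j.castSucc, map, ψ, q, hd, hp⟩ : Pre n Y Z))
            e.symm.toLinearMap := by
          refine mor_toY _ _ _ (fun j => LinearMap.id) (fun y => rfl) (fun j x => ?_) fun x => ?_
          · exact LinearMap.congr_fun (e1 j) x
          · change q x = e.symm _
            rw [LinearEquiv.eq_symm_apply]
            exact Subtype.ext (by rw [he]; exact (LinearMap.congr_fun e2 x).symm)
        exact this.comp hM
      · have : YE.Mor LinearMap.id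
            (toY (⟨fun j => F j.castSucc, map, ψ, q, hd, hp⟩ : Pre n Y Z))
            (toY N'.tail) e.toLinearMap := by
          refine mor_toY _ _ _ (fun j => LinearMap.id) (fun y => rfl) (fun j x => ?_) fun x => ?_
          · exact (LinearMap.congr_fun (e1 j) x).symm
          · exact Subtype.ext (LinearMap.congr_fun e2 x)
        exact hM'.comp this

end Pre

namespace NExtn

variable {P : ModuleCat.{0} A → Prop} {X Y : ModuleCat.{0} A} {n : ℕ}

/-- The indexed complex of a Yoneda extension. -/
def toPre (N : NExtn A P (n + 1) X Y) : Pre n Y X where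
  ob i := N.ob i.castSucc
  map i := (N.map i.castSucc).hom
  ψ := (eqToHom N.ob_first.symm).hom
  p := (N.map (Fin.last _) ≫ eqToHom N.ob_last).hom
  hd i x := (N.isexact i.castSucc).apply_apply_eq_zero x
  hp x := by
    change (eqToHom N.ob_last).hom ((N.map (Fin.last _)).hom _) = 0
    rw [show (N.map (Fin.last (n + 1))).hom ((N.map (Fin.last n).castSucc).hom x) = 0 from
      (N.isexact (Fin.last n)).apply_apply_eq_zero x, map_zero]

theorem eqToHom_bij {M N : ModuleCat.{0} A} (h : M = N) :
    Function.Bijective (eqToHom h).hom := by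
  subst h; exact Function.bijective_id

theorem toPre_isEx (N : NExtn A P (n + 1) X Y) : N.toPre.IsEx where
  bij := eqToHom_bij _
  inj := N.inj
  ex i y hy := (N.isexact i.castSucc y).1 hy
  exl y hy := by
    have : (N.map (Fin.last _)).hom y = 0 :=
      (eqToHom_bij N.ob_last).1 (hy.trans (map_zero _).symm)
    exact (N.isexact (Fin.last n) y).1 this
  surj := (eqToHom_bij N.ob_last).2.comp N.surj

/-- The spliced complex of a Yoneda extension. -/
def toY (N : NExtn A P (n + 1) X Y) : YE Y n X := Pre.toY N.toPre

theorem toY_ok (N : NExtn A P (n + 1) X Y) : N.toY.Ok P :=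
  Pre.toY_ok _ N.toPre_isEx fun _ => N.prop _

theorem Dominates.mor {N N' : NExtn A P (n + 1) X Y} (h : N.Dominates A N') :
    YE.Mor LinearMap.id N.toY N'.toY LinearMap.id := by
  obtain ⟨φ, h0, h1, h2⟩ := h
  refine Pre.mor_toY N.toPre N'.toPre _ (fun i => (φ i.castSucc).hom) (fun y => ?_)
    (fun i x => ?_) fun x => ?_
  · change ((eqToHom N.ob_first.symm) ≫ φ 0).hom y = _
    rw [h0, eqToHom_trans]; rfl
  · exact LinearMap.congr_fun (congrArg ModuleCat.Hom.hom (h2 i.castSucc)) x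
  · have := h2 (Fin.last _)
    change (φ (Fin.last (n + 1)).castSucc ≫ (N'.map (Fin.last _) ≫ eqToHom N'.ob_last)).hom x = _
    rw [← Category.assoc, ← this, Category.assoc]
    change (_ ≫ φ (Fin.last _) ≫ _).hom x = _
    rw [h1, eqToHom_trans]; rfl

theorem Dominates.of_mor {N N' : NExtn A P (n + 1) X Y}
    (h : YE.Mor LinearMap.id N.toY N'.toY LinearMap.id) : N.Dominates A N' := by
  obtain ⟨f, h0, h1, h2⟩ := Pre.exists_of_mor_toY _ _ _ (eqToHom_bij _) h
  let f' : ∀ i : Fin (n + 2), N.ob i.castSucc ⟶ N'.ob i.castSucc := fun i => ModuleCat.ofHom (f i)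
  let φ : ∀ i, N.ob i ⟶ N'.ob i := Fin.lastCases (motive := fun i => N.ob i ⟶ N'.ob i)
    (eqToHom (N.ob_last.trans N'.ob_last.symm)) f'
  have φc : ∀ i, φ (Fin.castSucc i) = f' i := fun i =>
    Fin.lastCases_castSucc (motive := fun i => N.ob i ⟶ N'.ob i) i
  have φl : φ (Fin.last _) = eqToHom (N.ob_last.trans N'.ob_last.symm) :=
    Fin.lastCases_last (motive := fun i => N.ob i ⟶ N'.ob i)
  refine ⟨φ, ?_, φl, fun i => ?_⟩
  · refine (φc 0).trans ?_
    have h3 : eqToHom N.ob_first.symm ≫ f' 0 = eqToHom N'.ob_first.symm := by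
      ext y; exact h0 y
    refine (cancel_epi (eqToHom N.ob_first.symm)).1 (h3.trans ?_)
    exact (eqToHom_trans _ _).symm
  · induction i using Fin.lastCases with
    | last =>
      have e1 : φ (Fin.last (n + 1)).succ = eqToHom (N.ob_last.trans N'.ob_last.symm) := φl
      rw [e1, φc]
      refine (cancel_mono (eqToHom N'.ob_last)).1 ?_
      refine (Category.assoc _ _ _).trans ?_
      refine (congrArg (N.map _ ≫ ·) (eqToHom_trans _ _)).trans ?_
      ext x
      exact (h2 x).symm
    | cast i =>
      have e1 : φ i.castSucc.succ = f' i.succ := φc i.succ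
      rw [e1, φc]
      ext x
      exact h1 i x

theorem exists_toY (hX : P X) (hY : P Y) (E : YE Y n X) (h : E.Ok P) :
    ∃ N : NExtn A P (n + 1) X Y, YE.Mor LinearMap.id N.toY E LinearMap.id ∧
      YE.Mor LinearMap.id E N.toY LinearMap.id := by
  obtain ⟨N, hN, hP, ⟨hY', hψ⟩, hM, hM'⟩ := Pre.exists_toY hY E h
  obtain ⟨ob, map, ψ, q, hd, hp⟩ := N
  obtain ⟨F, rfl, rfl⟩ := Pre.exists_snoc ob X
  let m : ∀ i : Fin (n + 2), F i.castSucc ⟶ F i.succ := Fin.lastCases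
    (motive := fun i : Fin (n + 2) => F i.castSucc ⟶ F i.succ) (ModuleCat.ofHom q)
      fun i => ModuleCat.ofHom (map i)
  have mc : ∀ i, m (Fin.castSucc i) = ModuleCat.ofHom (map i) := fun i =>
    Fin.lastCases_castSucc ..
  have ml : m (Fin.last _) = ModuleCat.ofHom q := Fin.lastCases_last ..
  let N : NExtn A P (n + 1) (F (Fin.last _)) Y := ⟨F, hY'.symm, rfl, fun i => by
      induction i using Fin.lastCases with
      | last => exact hX
      | cast i => exact hP i, m, by
      have : m 0 = ModuleCat.ofHom (map 0) := mc 0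
      rw [this]; exact hN.inj, by rw [ml]; exact hN.surj, fun i => by
      induction i using Fin.lastCases with
      | last =>
        have e1 : m (Fin.last n).succ = ModuleCat.ofHom q := ml
        rw [e1, mc]
        exact fun y => ⟨hN.exl y, by rintro ⟨x, rfl⟩; exact hp x⟩
      | cast i =>
        have e1 : m i.castSucc.succ = ModuleCat.ofHom (map i.succ) := mc i.succ
        rw [e1, mc]
        exact fun y => ⟨hN.ex i y, by rintro ⟨x, rfl⟩; exact hd i x⟩⟩
  refine ⟨N, YE.Mor.comp (ψ := LinearMap.id) (ψ' := LinearMap.id) (φ := LinearMap.id)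
    (φ' := LinearMap.id) ?_ hM, YE.Mor.comp (ψ := LinearMap.id) (ψ' := LinearMap.id)
    (φ := LinearMap.id) (φ' := LinearMap.id) hM' ?_⟩
  · refine Pre.mor_toY _ _ _ (fun i => LinearMap.id) (fun y => ?_) (fun i x => ?_) fun x => ?_
    · exact (LinearMap.congr_fun hψ y).symm
    · exact LinearMap.congr_fun (congrArg ModuleCat.Hom.hom (mc i)) x
    · exact (LinearMap.congr_fun (congrArg ModuleCat.Hom.hom ml) x).symm
  · refine Pre.mor_toY _ _ _ (fun i => LinearMap.id) (fun y => ?_) (fun i x => ?_) fun x => ?_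
    · exact LinearMap.congr_fun hψ y
    · exact (LinearMap.congr_fun (congrArg ModuleCat.Hom.hom (mc i)) x).symm
    · exact LinearMap.congr_fun (congrArg ModuleCat.Hom.hom ml) x

open Classical in
/-- The Yoneda class of an exact spliced complex. -/
def cls (P : ModuleCat.{0} A → Prop) (hX : P X) (hY : P Y) (E : YE Y n X) :
    Option (YExt A P (n + 1) X Y) :=
  if h : E.Ok P then some (Quot.mk _ (exists_toY hX hY E h).choose) else none

theorem cls_toY (hX : P X) (hY : P Y) (N : NExtn A P (n + 1) X Y) {E : YE Y n X} (hE : E.Ok P)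
    (h : YE.Mor LinearMap.id N.toY E LinearMap.id) : cls P hX hY E = some (Quot.mk _ N) := by
  rw [cls, dif_pos hE]
  exact congrArg some (Quot.sound (Dominates.of_mor
    (h.comp (exists_toY hX hY E hE).choose_spec.2))).symm

theorem quot_eq_of_eqv {E F : NExtn A P (n + 1) X Y} (hX : P X) (hY : P Y)
    (h : YE.Eqv P E.toY F.toY) :
    Quot.mk (NExtn.Dominates A) E = Quot.mk (NExtn.Dominates A) F := by
  have key : ∀ a b : YE Y n X, YE.Eqv P a b → cls P hX hY a = cls P hX hY b := by
    intro a b hab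
    induction hab with
    | rel a b hh =>
      obtain ⟨N, hN, -⟩ := exists_toY hX hY a hh.1
      rw [cls_toY hX hY N hh.1 hN, cls_toY hX hY N hh.2.1 (hN.comp hh.2.2)]
    | refl => rfl
    | symm _ _ _ ih => exact ih.symm
    | trans _ _ _ _ _ ih1 ih2 => exact ih1.trans ih2
  have := key _ _ h
  rw [cls_toY hX hY E E.toY_ok (YE.Mor.refl _), cls_toY hX hY F F.toY_ok (YE.Mor.refl _)] at this
  exact Option.some.inj this

theorem eqv_of_quot_eq {E F : NExtn A P (n + 1) X Y}
    (h : Quot.mk (NExtn.Dominates A) E = Quot.mk (NExtn.Dominates A) F) :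
    YE.Eqv P E.toY F.toY := by
  have := Quot.eqvGen_exact h
  clear h
  induction this with
  | rel a b hh => exact YE.Eqv.of_mor a.toY_ok b.toY_ok hh.mor
  | refl => exact Relation.EqvGen.refl _
  | symm _ _ _ ih => exact ih.symm
  | trans _ _ _ _ _ ih1 ih2 => exact ih1.trans _ _ _ ih2

end NExtn

/-- A criterion for bijectivity of the comparison maps in terms of spliced complexes. -/
theorem bijective_yextFamMap {P Q : ModuleCat.{0} A → Prop} (hPQ : ∀ M, P M → Q M)
    {X Y : ModuleCat.{0} A} (hX : P X) (hY : P Y)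
    (hs : ∀ (n : ℕ) (E : YE Y n X), E.Ok Q → ∃ F : YE Y n X, F.Ok P ∧ YE.Eqv Q E F)
    (hi : ∀ (n : ℕ) (E F : YE Y n X), E.Ok P → F.Ok P → YE.Eqv Q E F → YE.Eqv P E F) (i : ℕ) :
    Function.Bijective (yextFamMap A hPQ (X := X) (Y := Y) i) := by
  cases i with
  | zero => exact Function.bijective_id
  | succ n =>
    constructor
    · rintro ⟨E⟩ ⟨F⟩ h
      have h1 : YE.Eqv Q (E.relax A hPQ).toY (F.relax A hPQ).toY := NExtn.eqv_of_quot_eq h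
      exact NExtn.quot_eq_of_eqv hX hY (hi n E.toY F.toY E.toY_ok F.toY_ok h1)
    · rintro ⟨E⟩
      obtain ⟨F, hF, hEF⟩ := hs n E.toY E.toY_ok
      obtain ⟨N, hN, -⟩ := NExtn.exists_toY hX hY F hF
      refine ⟨Quot.mk _ N, NExtn.quot_eq_of_eqv (hPQ _ hX) (hPQ _ hY) ?_⟩
      refine Relation.EqvGen.trans _ _ _ ?_ hEF.symm
      exact YE.Eqv.of_mor (N.toY_ok.mono hPQ) (hF.mono hPQ) hN

end Yoneda


section Yoneda

variable {A : Type} [Ring A]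

/-- The pullback of a short complex. -/
def SES.pull {Z X X' : ModuleCat.{0} A} (E : SES Z X) (φ : X' →ₗ[A] X) : SES Z X' where
  M := ModuleCat.of A (LinearMap.eqLocus (E.p ∘ₗ LinearMap.fst A E.M X')
    (φ ∘ₗ LinearMap.snd A E.M X'))
  i := (LinearMap.inl A E.M X' ∘ₗ E.i).codRestrict _ fun z => by
    rw [LinearMap.mem_eqLocus]; simp [E.zero]
  p := LinearMap.snd A E.M X' ∘ₗ Submodule.subtype _
  zero _ := rfl

theorem SES.IsEx.pull {Z X X' : ModuleCat.{0} A} {E : SES Z X} (h : E.IsEx) (φ : X' →ₗ[A] X) :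
    (E.pull φ).IsEx where
  inj a b hab := h.inj (congrArg (fun x => x.1.1) hab)
  surj x := by
    obtain ⟨m, hm⟩ := h.surj (φ x)
    exact ⟨⟨(m, x), hm⟩, rfl⟩
  ex := by
    rintro ⟨⟨m, x⟩, hm⟩ (rfl : x = 0)
    obtain ⟨z, rfl⟩ := h.ex m (hm.trans (map_zero φ))
    exact ⟨z, rfl⟩

/-- Closure of a class of modules under submodules, quotients and finite products. -/
structure SubQuot (P : ModuleCat.{0} A → Prop) : Prop where
  sub : ∀ {M N : ModuleCat.{0} A} (f : N →ₗ[A] M), Function.Injective f → P M → P N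
  quot : ∀ {M N : ModuleCat.{0} A} (f : M →ₗ[A] N), Function.Surjective f → P M → P N
  prod : ∀ {M N : ModuleCat.{0} A}, P M → P N → P (ModuleCat.of A (M × N))

theorem SubQuot.sub_sub {P : ModuleCat.{0} A → Prop} (hP : SubQuot P) {M : ModuleCat.{0} A}
    (N : Submodule A M) (hM : P M) : P (ModuleCat.of A N) :=
  hP.sub (N := ModuleCat.of A N) N.subtype Subtype.val_injective hM

namespace YE

/-- The pullback of a spliced complex. -/
def pull {Y : ModuleCat.{0} A} : ∀ {n : ℕ} {X X' : ModuleCat.{0} A}, YE Y n X → (X' →ₗ[A] X) →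
    YE Y n X'
  | 0, _, _, E, φ => SES.pull E φ
  | _ + 1, _, _, E, φ => ⟨E.1, E.2.1.pull φ, E.2.2⟩

theorem Ok.pull {P : ModuleCat.{0} A → Prop} (hP : SubQuot P) {Y : ModuleCat.{0} A} :
    ∀ {n : ℕ} {X X' : ModuleCat.{0} A} {E : YE Y n X}, E.Ok P → ∀ φ : X' →ₗ[A] X, P X' →
      (E.pull φ).Ok P
  | 0, _, _, _, h, φ, hX => ⟨h.1.pull φ, hP.sub_sub _ (hP.prod h.2 hX)⟩
  | _ + 1, _, _, _, h, φ, hX => ⟨h.1.pull φ,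
      hP.sub_sub _ (hP.prod h.2.1 hX), h.2.2⟩

theorem mor_pull {Y : ModuleCat.{0} A} :
    ∀ {n : ℕ} {X X' : ModuleCat.{0} A} (E : YE Y n X) (φ : X' →ₗ[A] X),
      Mor LinearMap.id (E.pull φ) E φ
  | 0, _, _, _, _ => ⟨LinearMap.fst A _ _ ∘ₗ Submodule.subtype _, fun _ => rfl, fun x => x.2⟩
  | _ + 1, _, _, _, _ => ⟨LinearMap.fst A _ _ ∘ₗ Submodule.subtype _, LinearMap.id,
      fun _ => rfl, fun x => x.2, Mor.refl _⟩

/-- The universal map into a pullback. -/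
def _root_.SES.lift {Z X X' X'' : ModuleCat.{0} A} {M : ModuleCat.{0} A} (F : SES Z X'')
    (b : X' →ₗ[A] X'') (φ : X →ₗ[A] X') (p : M →ₗ[A] X) (m : M →ₗ[A] F.M)
    (h : ∀ x, F.p (m x) = b (φ (p x))) : M →ₗ[A] (F.pull b).M :=
  (m.prod (φ ∘ₗ p)).codRestrict _ h

theorem Mor.lift {Y Y' : ModuleCat.{0} A} {ψ : Y →ₗ[A] Y'} :
    ∀ {n : ℕ} {X X' X'' : ModuleCat.{0} A} {E : YE Y n X} {F : YE Y' n X''} (b : X' →ₗ[A] X'')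
      (φ : X →ₗ[A] X'), Mor ψ E F (b ∘ₗ φ) → Mor ψ E (F.pull b) φ
  | 0, _, _, _, E, F, b, φ, ⟨m, h1, h2⟩ => by
    refine ⟨SES.lift (F : SES _ _) b φ _ m h2, fun y => Subtype.ext (Prod.ext (h1 y) ?_), fun x => rfl⟩
    change φ (SES.p E (SES.i E y)) = 0
    exact (congrArg φ (SES.zero E y)).trans (map_zero φ)
  | _ + 1, _, _, _, E, F, b, φ, ⟨m, z, h1, h2, h3⟩ => by
    refine ⟨SES.lift F.2.1 b φ _ m h2, z, fun y => Subtype.ext (Prod.ext (h1 y) ?_), fun x => rfl, h3⟩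
    change φ (SES.p E.2.1 (SES.i E.2.1 y)) = 0
    rw [SES.zero, map_zero]

theorem Mor.pull {Y Y' : ModuleCat.{0} A} {ψ : Y →ₗ[A] Y'} {n : ℕ}
    {X X' W W' : ModuleCat.{0} A} {E : YE Y n X} {F : YE Y' n X'} {φ : X →ₗ[A] X'}
    (h : Mor ψ E F φ) {a : W →ₗ[A] X} {b : W' →ₗ[A] X'} {φ' : W →ₗ[A] W'}
    (hc : φ ∘ₗ a = b ∘ₗ φ') : Mor ψ (E.pull a) (F.pull b) φ' := by
  apply Mor.lift
  rw [← hc]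
  exact (mor_pull E a).comp h

end YE

/-- The data of a truncation functor from the class `C` to the class `P`, given by
dividing out a functorial submodule. -/
structure TruncData (P C : ModuleCat.{0} A → Prop) where
  R : ∀ M : ModuleCat.{0} A, Submodule A M
  R_map : ∀ {M N : ModuleCat.{0} A} (f : M →ₗ[A] N), R M ≤ (R N).comap f
  R_surj : ∀ {M N : ModuleCat.{0} A} (f : M →ₗ[A] N), C M → Function.Surjective f →
    R N ≤ (R M).map f
  quot : ∀ {M : ModuleCat.{0} A}, C M → P (ModuleCat.of A (M ⧸ R M))
  R_bot : ∀ {M : ModuleCat.{0} A}, P M → R M = ⊥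
  T : ModuleCat.{0} A → ModuleCat.{0} A
  π : ∀ M, T M →ₗ[A] M
  π_surj : ∀ M, Function.Surjective (π M)
  T_map : ∀ {M N : ModuleCat.{0} A} (f : M →ₗ[A] N), ∃ Tf : T M →ₗ[A] T N,
    ∀ x, π N (Tf x) = f (π M x)
  Good : ModuleCat.{0} A → Prop
  good_T : ∀ {M}, C M → Good (T M)
  good_P : ∀ {M}, P M → Good M
  good_ker : ∀ {Z X} (E : SES Z X), E.IsEx → C E.M → Good E.M → Good X → Good Z
  good_inj : ∀ {Z X} (E : SES Z X), E.IsEx → C E.M → Good X → (R E.M).comap E.i ≤ R Z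

namespace TruncData

variable {P C : ModuleCat.{0} A → Prop} (D : TruncData P C)

/-- The truncation of a module. -/
abbrev tr (M : ModuleCat.{0} A) : ModuleCat.{0} A := ModuleCat.of A (M ⧸ D.R M)

/-- The truncation of a morphism. -/
abbrev trMap {M N : ModuleCat.{0} A} (f : M →ₗ[A] N) : D.tr M →ₗ[A] D.tr N :=
  (D.R M).mapQ (D.R N) f (D.R_map f)

/-- The kernel of `T M → X`, as a fibre product. -/
abbrev Zr {Z X : ModuleCat.{0} A} (E : SES Z X) : ModuleCat.{0} A :=
  ModuleCat.of A (LinearMap.eqLocus (D.π E.M ∘ₗ LinearMap.fst A (D.T E.M) Z)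
    (E.i ∘ₗ LinearMap.snd A (D.T E.M) Z))

/-- The projection to the kernel of the original complex. -/
abbrev Zmap {Z X : ModuleCat.{0} A} (E : SES Z X) : D.Zr E →ₗ[A] Z :=
  LinearMap.snd A _ _ ∘ₗ Submodule.subtype _

/-- The resolved short complex. -/
abbrev res {Z X : ModuleCat.{0} A} (E : SES Z X) : SES (D.Zr E) X where
  M := D.T E.M
  i := LinearMap.fst A _ _ ∘ₗ Submodule.subtype _
  p := E.p ∘ₗ D.π E.M
  zero z := by
    have : D.π E.M z.1.1 = E.i z.1.2 := z.2
    change E.p (D.π E.M z.1.1) = 0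
    rw [this, E.zero]

/-- The truncated short complex. -/
abbrev trS {Z X : ModuleCat.{0} A} (E : SES Z X) : SES (D.tr Z) (D.tr X) where
  M := D.tr E.M
  i := D.trMap E.i
  p := D.trMap E.p
  zero z := by
    obtain ⟨z, rfl⟩ := Submodule.Quotient.mk_surjective _ z
    change Submodule.Quotient.mk (E.p (E.i z)) = _
    rw [E.zero]; rfl

theorem res_isEx {Z X : ModuleCat.{0} A} {E : SES Z X} (h : E.IsEx) : (D.res E).IsEx where
  inj := by
    rintro ⟨⟨a, b⟩, hab⟩ ⟨⟨a', b'⟩, hab'⟩ (rfl : a = a')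
    have : E.i b = E.i b' := hab.symm.trans hab'
    obtain rfl := h.inj this
    rfl
  surj := h.surj.comp (D.π_surj _)
  ex m hm := by
    obtain ⟨z, hz⟩ := h.ex _ hm
    exact ⟨⟨(m, z), hz.symm⟩, rfl⟩

theorem trS_isEx {Z X : ModuleCat.{0} A} {E : SES Z X} (h : E.IsEx) (hC : C E.M)
    (hX : D.Good X) : (D.trS E).IsEx where
  inj := by
    rw [injective_iff_map_eq_zero]
    intro z hz
    obtain ⟨z, rfl⟩ := Submodule.Quotient.mk_surjective _ z
    exact (Submodule.Quotient.mk_eq_zero _).2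
      (D.good_inj E h hC hX ((Submodule.Quotient.mk_eq_zero (D.R E.M)).1 hz))
  surj x := by
    obtain ⟨x, rfl⟩ := Submodule.Quotient.mk_surjective _ x
    obtain ⟨m, rfl⟩ := h.surj x
    exact ⟨Submodule.Quotient.mk m, rfl⟩
  ex m hm := by
    obtain ⟨m, rfl⟩ := Submodule.Quotient.mk_surjective _ m
    obtain ⟨r, hr, hrm⟩ := D.R_surj E.p hC h.surj ((Submodule.Quotient.mk_eq_zero _).1 hm)
    obtain ⟨z, hz⟩ := h.ex (m - r) (by rw [map_sub, hrm, sub_self])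
    refine ⟨Submodule.Quotient.mk z, ?_⟩
    refine (Submodule.Quotient.eq _).2 ?_
    rw [hz, sub_sub_cancel_left]
    exact neg_mem hr

/-- The resolution of a spliced complex. -/
def Φ {Y : ModuleCat.{0} A} : ∀ {n : ℕ} {X : ModuleCat.{0} A}, YE Y n X → YE Y n X
  | 0, _, E => E
  | _ + 1, _, E => ⟨D.Zr E.2.1, D.res E.2.1, Φ (E.2.2.pull (D.Zmap E.2.1))⟩

/-- The truncated resolution of a spliced complex. -/
def Ψ {Y : ModuleCat.{0} A} : ∀ {n : ℕ} {X : ModuleCat.{0} A}, YE Y n X → YE Y n (D.tr X)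
  | 0, _, E => (⟨D.tr (SES.M E), (D.R _).mkQ ∘ₗ SES.i E, D.trMap (SES.p E), fun z =>
      (congrArg (Submodule.Quotient.mk (p := D.R _)) (SES.zero E z)).trans rfl⟩ : SES _ _)
  | _ + 1, _, E => ⟨D.tr (D.Zr E.2.1), D.trS (D.res E.2.1), Ψ (E.2.2.pull (D.Zmap E.2.1))⟩

variable {D}

theorem Φ_mor {Y : ModuleCat.{0} A} : ∀ {n : ℕ} {X : ModuleCat.{0} A} (E : YE Y n X),
    YE.Mor LinearMap.id (D.Φ E) E LinearMap.id
  | 0, _, E => YE.Mor.refl (n := 0) E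
  | _ + 1, _, E => ⟨D.π _, D.Zmap E.2.1, fun z => z.2, fun _ => rfl,
      (Φ_mor _).comp (YE.mor_pull E.2.2 (D.Zmap E.2.1))⟩

theorem Φ_mor_Ψ {Y : ModuleCat.{0} A} : ∀ {n : ℕ} {X : ModuleCat.{0} A} (E : YE Y n X),
    YE.Mor LinearMap.id (D.Φ E) (D.Ψ E) (D.R X).mkQ
  | 0, _, _ => ⟨(D.R _).mkQ, fun _ => rfl, fun _ => rfl⟩
  | _ + 1, _, _ => ⟨(D.R _).mkQ, (D.R _).mkQ, fun _ => rfl, fun _ => rfl, Φ_mor_Ψ _⟩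

theorem Ψ_mor {Y Y' : ModuleCat.{0} A} {ψ : Y →ₗ[A] Y'} :
    ∀ {n : ℕ} {X X' : ModuleCat.{0} A} {E : YE Y n X} {F : YE Y' n X'} {φ : X →ₗ[A] X'},
      YE.Mor ψ E F φ → YE.Mor ψ (D.Ψ E) (D.Ψ F) (D.trMap φ)
  | 0, _, _, _, _, _, ⟨m, h1, h2⟩ => ⟨D.trMap m, fun y =>
      congrArg (Submodule.Quotient.mk (p := D.R _)) (h1 y), fun x => by
        obtain ⟨x, rfl⟩ := Submodule.Quotient.mk_surjective _ x
        exact congrArg (Submodule.Quotient.mk (p := D.R _)) (h2 x)⟩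
  | _ + 1, _, _, E, F, φ, ⟨m, z, h1, h2, h3⟩ => by
    obtain ⟨t, ht⟩ := D.T_map m
    let w : D.Zr E.2.1 →ₗ[A] D.Zr F.2.1 :=
      (LinearMap.prodMap t z).restrict (p := LinearMap.eqLocus _ _) (q := LinearMap.eqLocus _ _)
        fun x hx => by
          change D.π _ (t x.1) = F.2.1.i (z x.2)
          rw [ht, ← h1]
          exact congrArg m hx
    refine ⟨D.trMap t, D.trMap w, fun y => ?_, fun x => ?_, Ψ_mor (h3.pull rfl)⟩
    · obtain ⟨y, rfl⟩ := Submodule.Quotient.mk_surjective _ y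
      rfl
    · obtain ⟨x, rfl⟩ := Submodule.Quotient.mk_surjective _ x
      refine congrArg (Submodule.Quotient.mk (p := D.R _)) ?_
      change F.2.1.p (D.π _ (t x)) = φ (E.2.1.p (D.π _ x))
      rw [ht, h2]

theorem Φ_ok {Q : ModuleCat.{0} A → Prop} (hQ : SubQuot Q) (hT : ∀ M, Q M → Q (D.T M))
    {Y : ModuleCat.{0} A} : ∀ {n : ℕ} {X : ModuleCat.{0} A} {E : YE Y n X}, E.Ok Q →
      (D.Φ E).Ok Q
  | 0, _, _, h => h
  | _ + 1, _, _, h => ⟨D.res_isEx h.1, hT _ h.2.1, Φ_ok hQ hT (h.2.2.pull hQ _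
      (hQ.sub _ (D.res_isEx h.1).inj (hT _ h.2.1)))⟩

theorem Ψ_ok (hC : SubQuot C) (hT : ∀ M, C M → C (D.T M)) {Y : ModuleCat.{0} A}
    (hY : P Y) : ∀ {n : ℕ} {X : ModuleCat.{0} A} {E : YE Y n X}, D.Good X → E.Ok C →
      (D.Ψ E).Ok P
  | 0, _, E, hX, h => by
    have h' := D.trS_isEx h.1 h.2 hX
    have hinj : Function.Injective ((D.R Y).mkQ) := by
      rw [← LinearMap.ker_eq_bot, Submodule.ker_mkQ, D.R_bot hY]
    refine ⟨⟨h'.inj.comp hinj, h'.surj, fun m hm => ?_⟩, D.quot h.2⟩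
    obtain ⟨y, rfl⟩ := h'.ex m hm
    obtain ⟨y, rfl⟩ := Submodule.Quotient.mk_surjective _ y
    exact ⟨y, rfl⟩
  | _ + 1, _, E, hX, h => by
    have h1 := D.res_isEx h.1
    have h2 := hT _ h.2.1
    exact ⟨D.trS_isEx h1 h2 hX, D.quot h2, Ψ_ok hC hT hY
      (D.good_ker _ h1 h2 (D.good_T h.2.1) hX) (h.2.2.pull hC _ (hC.sub _ h1.inj h2))⟩

theorem bijective {Q : ModuleCat.{0} A → Prop} (D : TruncData P C) (hPQ : ∀ M, P M → Q M)
    (hQC : ∀ M, Q M → C M) (hP : SubQuot P) (hQ : SubQuot Q) (hC : SubQuot C)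
    (hTP : ∀ M, P M → P (D.T M)) (hTQ : ∀ M, Q M → Q (D.T M)) (hTC : ∀ M, C M → C (D.T M)) :
    ExtFullPair A P Q hPQ := by
  intro X Y hX hY i
  have hok : ∀ {n : ℕ} {E : YE Y n X}, E.Ok Q → ((D.Ψ E).pull (D.R X).mkQ).Ok P :=
    fun hE => (Ψ_ok hC hTC hY (D.good_P hX) (hE.mono hQC)).pull hP _ hX
  have hmor : ∀ {n : ℕ} (E : YE Y n X),
      YE.Mor LinearMap.id (D.Φ E) ((D.Ψ E).pull (D.R X).mkQ) LinearMap.id :=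
    fun E => YE.Mor.lift _ _ (Φ_mor_Ψ E)
  refine bijective_yextFamMap hPQ hX hY (fun n E hE => ⟨_, hok hE, ?_⟩) (fun n E F hE hF h => ?_) i
  · have h1 := YE.Eqv.of_mor (Φ_ok hQ hTQ hE) hE (Φ_mor E)
    have h2 := YE.Eqv.of_mor (Φ_ok hQ hTQ hE) ((hok hE).mono hPQ) (hmor E)
    exact h1.symm.trans _ _ _ h2
  · have key : ∀ E : YE Y n X, E.Ok P → YE.Eqv P E ((D.Ψ E).pull (D.R X).mkQ) := fun E hE =>
      (YE.Eqv.of_mor (Φ_ok hP hTP hE) hE (Φ_mor E)).symm.trans _ _ _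
        (YE.Eqv.of_mor (Φ_ok hP hTP hE) (hok (hE.mono hPQ)) (hmor E))
    have h' : YE.Eqv P ((D.Ψ E).pull (D.R X).mkQ) ((D.Ψ F).pull (D.R X).mkQ) :=
      h.map (fun E => (D.Ψ E).pull (D.R X).mkQ) fun E F hE hF hm =>
        YE.Eqv.of_mor (hok hE) (hok hF) ((Ψ_mor hm).pull (by ext; rfl))
    exact (key E hE).trans _ _ _ (h'.trans _ _ _ (key F hF).symm)

end TruncData

end Yoneda


section Enveloping

variable {L : Type} [LieRing L] [LieAlgebra K L]

theorem uea_adjoin : Algebra.adjoin K (Set.range (ι K : L → UEA K L)) = ⊤ := by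
  let B := Algebra.adjoin K (Set.range (ι K : L → UEA K L))
  letI : LieRing (UniversalEnvelopingAlgebra K L) := LieRing.ofAssociativeRing
  letI : LieRing B := LieRing.ofAssociativeRing
  let f : L →ₗ⁅K⁆ B :=
    { toFun := fun x => ⟨ι K x, Algebra.subset_adjoin ⟨x, rfl⟩⟩
      map_add' := fun x y => Subtype.ext (map_add (ι K) x y)
      map_smul' := fun c x => Subtype.ext (map_smul (ι K) c x)
      map_lie' := fun {x y} => Subtype.ext (LieHom.map_lie (ι K) x y) }
  have h : B.val.comp (UniversalEnvelopingAlgebra.lift K f) = AlgHom.id K _ := by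
    apply UniversalEnvelopingAlgebra.hom_ext
    apply LieHom.ext
    intro x
    simp only [LieHom.comp_apply, AlgHom.coe_toLieHom, AlgHom.comp_apply,
      UniversalEnvelopingAlgebra.lift_ι_apply, AlgHom.id_apply]
    rfl
  rw [eq_top_iff]
  intro u _
  have := AlgHom.congr_fun h u
  rw [AlgHom.id_apply] at this
  rw [← this]
  exact (UniversalEnvelopingAlgebra.lift K f u).2

theorem uea_induction {p : UEA K L → Prop} (hc : ∀ c, p (algebraMap K _ c)) (hι : ∀ x, p (ι K x))
    (ha : ∀ u v, p u → p v → p (u + v)) (hm : ∀ u v, p u → p v → p (u * v)) (u : UEA K L) :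
    p u := by
  have hu : u ∈ Algebra.adjoin K (Set.range (ι K : L → UEA K L)) := by
    rw [uea_adjoin]; trivial
  induction hu using Algebra.adjoin_induction with
  | mem x hx => obtain ⟨x, rfl⟩ := hx; exact hι x
  | algebraMap c => exact hc c
  | add u v _ _ h1 h2 => exact ha u v h1 h2
  | mul u v _ _ h1 h2 => exact hm u v h1 h2

variable {M N : Type} [AddCommGroup M] [Module (UEA K L) M] [AddCommGroup N] [Module (UEA K L) N]

/-- A subgroup stable under scalars and the Lie algebra is a submodule. -/
def ueaSub (p : AddSubgroup M) (hc : ∀ (c : K), ∀ m ∈ p, algebraMap K (UEA K L) c • m ∈ p)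
    (hx : ∀ (x : L), ∀ m ∈ p, ι K x • m ∈ p) : Submodule (UEA K L) M where
  __ := p
  smul_mem' u m' hm' := by
    refine uea_induction (p := fun u => ∀ m ∈ p, u • m ∈ p) hc hx (fun u v hu hv m hm => ?_)
      (fun u v hu hv m hm => ?_) u m' hm'
    · rw [add_smul]; exact p.add_mem (hu m hm) (hv m hm)
    · rw [mul_smul]; exact hu _ (hv m hm)

/-- An additive map commuting with scalars and the Lie algebra is linear. -/
def ueaHom (f : M →+ N)
    (hc : ∀ (c : K) m, f (algebraMap K (UEA K L) c • m) = algebraMap K (UEA K L) c • f m)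
    (hx : ∀ (x : L) m, f (ι K x • m) = ι K x • f m) : M →ₗ[UEA K L] N where
  __ := f
  map_smul' u := by
    refine uea_induction (p := fun u => ∀ m, f (u • m) = u • f m) hc hx (fun u v hu hv m => ?_)
      (fun u v hu hv m => ?_) u
    · rw [add_smul, add_smul, map_add, hu, hv]
    · rw [mul_smul, mul_smul, hu, hv]

theorem ι_lie_smul (x y : L) (m : M) :
    (ι K ⁅x, y⁆ : UEA K L) • m = ι K x • ι K y • m - ι K y • ι K x • m := by
  letI : LieRing (UniversalEnvelopingAlgebra K L) := LieRing.ofAssociativeRing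
  rw [LieHom.map_lie, LieRing.of_associative_ring_bracket, sub_smul, mul_smul, mul_smul]

/-- A module over the enveloping algebra, as a Lie module. -/
def Res (K L : Type) [Field K] [LieRing L] [LieAlgebra K L] (M : Type) [AddCommGroup M]
    [Module (UEA K L) M] : Type := M

instance : AddCommGroup (Res K L M) := inferInstanceAs (AddCommGroup M)
instance : Module K (Res K L M) := Module.compHom M (algebraMap K (UEA K L))
instance : LieRingModule L (Res K L M) where
  bracket x m := (ι K x • (show M from m) : M)
  add_lie x y m := by
    change (ι K (x + y)) • (show M from m) = (ι K x) • (show M from m) + (ι K y) • (show M from m)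
    rw [map_add, add_smul]
  lie_add x m n := smul_add (ι K x : UEA K L) (show M from m) (show M from n)
  leibniz_lie x y m := by
    change (ι K x) • ((ι K y) • (show M from m)) =
      (ι K ⁅x, y⁆) • (show M from m) + (ι K y) • ((ι K x) • (show M from m))
    rw [ι_lie_smul, sub_add_cancel]
instance : LieModule K L (Res K L M) where
  smul_lie c x m := by
    change (ι K (c • x)) • (show M from m) = algebraMap K (UEA K L) c • ((ι K x) • (show M from m))
    rw [map_smul, Algebra.smul_def, mul_smul]
  lie_smul c x m := by
    change (ι K x) • (algebraMap K (UEA K L) c • (show M from m)) =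
      algebraMap K (UEA K L) c • ((ι K x) • (show M from m))
    rw [← mul_smul, ← mul_smul, Algebra.commutes]

/-- Linear maps as maps of Lie modules. -/
def resMap (f : M →ₗ[UEA K L] N) : Res K L M →ₗ⁅K, L⁆ Res K L N where
  toFun := f
  map_add' := f.map_add
  map_smul' c m := f.map_smul (algebraMap K (UEA K L) c) m
  map_lie' {x m} := f.map_smul (ι K x) m

/-- A Lie module as a module over the enveloping algebra. -/
@[reducible] def lieUEA (K L : Type) [Field K] [LieRing L] [LieAlgebra K L] (V : Type)
    [AddCommGroup V] [Module K V] [LieRingModule L V] [LieModule K L V] : Module (UEA K L) V :=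
  Module.compHom V (UniversalEnvelopingAlgebra.lift K (LieModule.toEnd K L V)).toRingHom

theorem lieUEA_ι {V : Type} [AddCommGroup V] [Module K V] [LieRingModule L V] [LieModule K L V]
    (x : L) (v : V) : letI := lieUEA K L V; (ι K x : UEA K L) • v = ⁅x, v⁆ := by
  change UniversalEnvelopingAlgebra.lift K (LieModule.toEnd K L V) (ι K x) v = _
  rw [UniversalEnvelopingAlgebra.lift_ι_apply]; rfl

theorem lieUEA_algebraMap {V : Type} [AddCommGroup V] [Module K V] [LieRingModule L V]
    [LieModule K L V] (c : K) (v : V) :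
    letI := lieUEA K L V; (algebraMap K (UEA K L) c) • v = c • v := by
  change UniversalEnvelopingAlgebra.lift K (LieModule.toEnd K L V) (algebraMap K _ c) v = _
  rw [AlgHom.commutes]; rfl

end Enveloping


section Weights

variable {h : Type} [AddCommGroup h] [Module K h] {V W : Type} [AddCommGroup V] [Module K V]
  [AddCommGroup W] [Module K W]

/-- The simultaneous eigenspace of a family of endomorphisms. -/
def wt (ρ : h → Module.End K V) (χ : Module.Dual K h) : Submodule K V :=
  ⨅ H, LinearMap.ker (ρ H - χ H • LinearMap.id)

theorem mem_wt {ρ : h → Module.End K V} {χ : Module.Dual K h} {v : V} :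
    v ∈ wt ρ χ ↔ ∀ H, ρ H v = χ H • v := by
  simp [wt, sub_eq_zero]

theorem mem_of_sum_wt_mem {ρ : h → Module.End K V} {N : Submodule K V}
    (hN : ∀ H, ∀ v ∈ N, ρ H v ∈ N) (s : Finset (Module.Dual K h)) :
    ∀ v : Module.Dual K h → V, (∀ χ ∈ s, v χ ∈ wt ρ χ) → ∑ χ ∈ s, v χ ∈ N → ∀ χ ∈ s, v χ ∈ N := by
  classical
  induction s using Finset.induction_on with
  | empty => simp
  | insert χ₀ s h0 ih =>
    intro v hv hs
    rw [Finset.sum_insert h0] at hs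
    have key : ∀ χ ∈ s, v χ ∈ N := by
      intro χ hχ
      obtain ⟨H, hH⟩ : ∃ H, χ H ≠ χ₀ H := by
        by_contra! hcon
        exact h0 ((LinearMap.ext hcon : χ = χ₀) ▸ hχ)
      have h1 : ∑ χ ∈ s, (χ H - χ₀ H) • v χ ∈ N := by
        have h2 := N.sub_mem (hN H _ hs) (N.smul_mem (χ₀ H) hs)
        rw [map_add, map_sum, mem_wt.1 (hv χ₀ (Finset.mem_insert_self _ _)) H, smul_add,
          add_sub_add_left_eq_sub, Finset.smul_sum, ← Finset.sum_sub_distrib] at h2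
        convert h2 using 1
        refine Finset.sum_congr rfl fun χ hχ => ?_
        rw [mem_wt.1 (hv χ (Finset.mem_insert_of_mem hχ)) H, sub_smul]
      have h3 := ih (fun χ => (χ H - χ₀ H) • v χ)
        (fun χ hχ => (wt ρ χ).smul_mem _ (hv χ (Finset.mem_insert_of_mem hχ))) h1 χ hχ
      exact (N.smul_mem_iff (sub_ne_zero.2 hH)).1 h3
    intro χ hχ
    rcases Finset.mem_insert.1 hχ with rfl | hχ
    · exact (N.add_mem_iff_left (N.sum_mem key)).1 hs
    · exact key χ hχ

theorem iSupIndep_wt (ρ : h → Module.End K V) : iSupIndep (wt ρ) := by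
  rw [iSupIndep_iff_finsetSum_eq_zero_imp_eq_zero]
  intro s v hv hs
  have := mem_of_sum_wt_mem (ρ := ρ) (N := ⊥) (by rintro H v rfl; simp) s v hv (by simp [hs])
  simpa using this

/-- The sum of the weight spaces with weights in a given set. -/
def wtSum (ρ : h → Module.End K V) (D : Set (Module.Dual K h)) : Submodule K V :=
  ⨆ χ ∈ D, wt ρ χ

theorem wt_le_wtSum {ρ : h → Module.End K V} {D : Set (Module.Dual K h)} {χ : Module.Dual K h}
    (hχ : χ ∈ D) : wt ρ χ ≤ wtSum ρ D := le_biSup (wt ρ) hχ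

theorem wtSum_mono {ρ : h → Module.End K V} {D E : Set (Module.Dual K h)} (hDE : D ⊆ E) :
    wtSum ρ D ≤ wtSum ρ E := biSup_mono fun _ h => hDE h

theorem wtSum_le {ρ : h → Module.End K V} {D : Set (Module.Dual K h)} {N : Submodule K V} :
    wtSum ρ D ≤ N ↔ ∀ χ ∈ D, wt ρ χ ≤ N := iSup₂_le_iff

theorem eq_zero_of_mem_wt_of_mem_wtSum {ρ : h → Module.End K V} {D : Set (Module.Dual K h)}
    {χ : Module.Dual K h} (hχ : χ ∉ D) {v : V} (hv : v ∈ wt ρ χ) (hD : v ∈ wtSum ρ D) : v = 0 :=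
  Submodule.disjoint_def.1 ((iSupIndep_wt ρ).disjoint_biSup hχ) v hv hD

theorem wtSum_stable {ρ : h → Module.End K V} {D : Set (Module.Dual K h)} (H : h) (v : V)
    (hv : v ∈ wtSum ρ D) : ρ H v ∈ wtSum ρ D := by
  have : wtSum ρ D ≤ (wtSum ρ D).comap (ρ H) := wtSum_le.2 fun χ hχ v hv => by
    rw [Submodule.mem_comap, mem_wt.1 hv]
    exact Submodule.smul_mem _ _ (wt_le_wtSum hχ hv)
  exact this hv

theorem wtSum_union {ρ : h → Module.End K V} {D E : Set (Module.Dual K h)} :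
    wtSum ρ (D ∪ E) = wtSum ρ D ⊔ wtSum ρ E := iSup_union

theorem exists_sum_of_mem_wtSum {ρ : h → Module.End K V} {D : Set (Module.Dual K h)} {v : V}
    (hv : v ∈ wtSum ρ D) : ∃ (s : Finset (Module.Dual K h)) (f : Module.Dual K h → V),
      ↑s ⊆ D ∧ (∀ χ, f χ ∈ wt ρ χ) ∧ ∑ χ ∈ s, f χ = v := by
  classical
  obtain ⟨f, hf, hs⟩ := (Submodule.mem_iSup_iff_exists_finsupp _ _).1 hv
  have h1 : ∀ χ, f χ ∈ wt ρ χ := fun χ => (iSup_le (fun _ => le_rfl) : (⨆ _ : χ ∈ D, wt ρ χ) ≤ wt ρ χ) (hf χ)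
  refine ⟨f.support, f, fun χ hχ => ?_, h1, hs⟩
  by_contra hn
  have := hf χ
  rw [iSup_neg hn] at this
  exact (Finsupp.mem_support_iff.1 hχ) (by simpa using this)

theorem wtSum_disjoint {ρ : h → Module.End K V} {D E : Set (Module.Dual K h)}
    (hDE : Disjoint D E) : Disjoint (wtSum ρ D) (wtSum ρ E) := by
  rw [Submodule.disjoint_def]
  intro v hD hE
  obtain ⟨s, f, hs, hf, rfl⟩ := exists_sum_of_mem_wtSum hD
  refine Finset.sum_eq_zero fun χ hχ => ?_
  exact eq_zero_of_mem_wt_of_mem_wtSum (hDE.notMem_of_mem_left (hs hχ)) (hf χ)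
    (mem_of_sum_wt_mem wtSum_stable s f (fun χ _ => hf χ) hE χ hχ)

theorem wt_map {ρ : h → Module.End K V} {σ : h → Module.End K W} {f : V →ₗ[K] W}
    (hf : ∀ H v, f (ρ H v) = σ H (f v)) {χ : Module.Dual K h} {v : V} (hv : v ∈ wt ρ χ) :
    f v ∈ wt σ χ :=
  mem_wt.2 fun H => by rw [← hf, mem_wt.1 hv, map_smul]

theorem map_wtSum_le {ρ : h → Module.End K V} {σ : h → Module.End K W} {f : V →ₗ[K] W}
    (hf : ∀ H v, f (ρ H v) = σ H (f v)) {D : Set (Module.Dual K h)} {v : V}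
    (hv : v ∈ wtSum ρ D) : f v ∈ wtSum σ D := by
  have : wtSum ρ D ≤ (wtSum σ D).comap f :=
    wtSum_le.2 fun χ hχ v hv => wt_le_wtSum hχ (wt_map hf hv)
  exact this hv

/-- Weight vectors lift along surjections of weight modules. -/
theorem exists_wt_lift {ρ : h → Module.End K V} {σ : h → Module.End K W} {f : V →ₗ[K] W}
    (hf : ∀ H v, f (ρ H v) = σ H (f v)) {χ : Module.Dual K h} {v : V} {D : Set (Module.Dual K h)}
    (hv : v ∈ wtSum ρ D) (hw : f v ∈ wt σ χ) : ∃ v' ∈ wt ρ χ, f v' = f v := by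
  classical
  obtain ⟨s, φ, -, hφ, rfl⟩ := exists_sum_of_mem_wtSum hv
  by_cases h0 : f (∑ χ ∈ s, φ χ) = 0
  · exact ⟨0, zero_mem _, by rw [h0, map_zero]⟩
  let s' := insert χ s
  let u : Module.Dual K h → W := fun ψ =>
    (if ψ ∈ s then f (φ ψ) else 0) - (if ψ = χ then f (∑ χ ∈ s, φ χ) else 0)
  have hu := mem_of_sum_wt_mem (ρ := σ) (N := ⊥) (by rintro H v rfl; simp) s' u
    (fun ψ _ => by
      refine Submodule.sub_mem _ ?_ ?_
      · split_ifs
        · exact wt_map hf (hφ ψ)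
        · exact zero_mem _
      · split_ifs with h
        · rw [h]; exact hw
        · exact zero_mem _)
    (by
      simp only [u, Finset.sum_sub_distrib, Finset.sum_ite_eq', s', Finset.mem_insert_self, if_true]
      rw [Finset.sum_ite_mem, Finset.inter_eq_right.2 (Finset.subset_insert _ _), map_sum]
      simp) χ (Finset.mem_insert_self _ _)
  simp only [u, if_true, Submodule.mem_bot, sub_eq_zero] at hu
  split_ifs at hu with h
  · exact ⟨φ χ, hφ χ, hu⟩
  · exact absurd hu.symm h0

end Weights

namespace RootReductive

variable (S : RootReductive K g)

theorem h_abelian {x y : g} (hx : x ∈ S.h) (hy : y ∈ S.h) : ⁅x, y⁆ = 0 := by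
  have h1 := S.τ_anti x y
  rw [S.τ_h _ (S.h.lie_mem hx hy), S.τ_h x hx, S.τ_h y hy, ← lie_skew, eq_comm, eq_neg_iff_add_eq_zero,
    ← two_smul K] at h1
  rw [← lie_skew, neg_eq_zero]
  exact (smul_eq_zero.1 h1).resolve_left two_ne_zero

/-- The adjoint action of the Cartan subalgebra. -/
def adh : S.h → Module.End K g := fun H => LieModule.toEnd K g g H

theorem wt_adh (χ : Module.Dual K S.h) : wt S.adh χ = rootSp K g S.h χ := by
  ext v; rw [mem_wt]; rfl

theorem h_le_wt : S.h.toSubmodule ≤ wt S.adh 0 := fun x hx => mem_wt.2 fun H => by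
  change ⁅(H : g), x⁆ = (0 : K) • x
  rw [S.h_abelian H.2 hx, zero_smul]

theorem zero_notMem_Φp : (0 : Module.Dual K S.h) ∉ S.Φp := fun h0 =>
  ((S.root_iff 0).1 (S.pos_subset h0)).1 rfl

theorem nm_eq : S.nm.toSubmodule = wtSum S.adh (-S.Φp) := by
  rw [S.nm_def]
  refine le_antisymm (iSup₂_le fun α hα => ?_) (wtSum_le.2 fun α hα => ?_)
  · rw [← wt_adh]; exact wt_le_wtSum (by simpa using hα)
  · have := le_iSup₂ (f := fun α (_ : α ∈ S.Φp) => rootSp K g S.h (-α)) (-α) hα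
    rw [neg_neg, ← wt_adh] at this
    exact this

theorem np_eq : (⨆ α ∈ S.Φp, rootSp K g S.h α) = wtSum S.adh S.Φp := by
  rw [wtSum]; simp only [wt_adh]

theorem b_le : S.b.toSubmodule ≤ wtSum S.adh (insert 0 S.Φp) := by
  rw [S.b_def, np_eq]
  exact sup_le (S.h_le_wt.trans (wt_le_wtSum (Set.mem_insert _ _))) (wtSum_mono (Set.subset_insert _ _))

theorem isCompl_nm_b : IsCompl S.nm.toSubmodule S.b.toSubmodule := by
  constructor
  · rw [nm_eq]
    refine (wtSum_disjoint ?_).mono_right S.b_le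
    rw [Set.disjoint_insert_right]
    exact ⟨by simpa using S.zero_notMem_Φp, S.pos_disjoint.symm⟩
  · rw [codisjoint_iff, ← S.rootdec, S.b_def, nm_eq, np_eq]
    have : (⨆ α ∈ S.Φ, rootSp K g S.h α) = wtSum S.adh S.Φ := by
      rw [wtSum]; simp only [wt_adh]
    rw [this, S.pos_union, wtSum_union, sup_comm, sup_assoc]

/-- The projection to `n⁻` along `b`. -/
def pm : g →ₗ[K] S.nm := Submodule.projectionOnto _ _ S.isCompl_nm_b
/-- The projection to `b` along `n⁻`. -/
def pb : g →ₗ[K] S.b := Submodule.projectionOnto _ _ S.isCompl_nm_b.symm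

theorem pm_add_pb (x : g) : (S.pm x : g) + S.pb x = x :=
  Submodule.projection_add_projection_eq_self S.isCompl_nm_b x
theorem pm_nm (x : S.nm) : S.pm x = x := Submodule.projectionOnto_apply_left _ x
theorem pb_b (x : S.b) : S.pb x = x := Submodule.projectionOnto_apply_left _ x
theorem pm_b (x : S.b) : S.pm x = 0 := Submodule.projectionOnto_apply_right _ x
theorem pb_nm (x : S.nm) : S.pb x = 0 := Submodule.projectionOnto_apply_right _ x

end RootReductive


open scoped TensorProduct

namespace RootReductive

/-- The module induced from a module over the Borel subalgebra, realised on `U(n⁻) ⊗ F`. -/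
def Ind (S : RootReductive K g) (F : Type) [AddCommGroup F] [Module K F] : Type :=
  UEA K S.nm ⊗[K] F

section Ind

variable (S : RootReductive K g) {F : Type} [AddCommGroup F] [Module K F]

instance : AddCommGroup (S.Ind F) := inferInstanceAs (AddCommGroup (UEA K S.nm ⊗[K] F))
instance : Module K (S.Ind F) := inferInstanceAs (Module K (UEA K S.nm ⊗[K] F))

/-- The action of `U(n⁻)` on the induced module. -/
def iact : UEA K S.nm →ₐ[K] Module.End K (S.Ind F) :=
  Algebra.lsmul K K (UEA K S.nm ⊗[K] F)

/-- The elementary tensors. -/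
def itmul (u : UEA K S.nm) : F →ₗ[K] S.Ind F := TensorProduct.mk K (UEA K S.nm) F u

theorem iact_itmul (u v : UEA K S.nm) (f : F) :
    S.iact u (S.itmul v f) = S.itmul (u * v) f := by
  change u • (v ⊗ₜ[K] f) = (u * v) ⊗ₜ[K] f
  rw [TensorProduct.smul_tmul', smul_eq_mul]

/-- The unit of the induction adjunction. -/
def iunit : F →ₗ[K] S.Ind F := S.itmul 1

theorem ind_induction' {p : S.Ind F → Prop} (hu : ∀ u f, p (S.itmul u f))
    (ha : ∀ a b, p a → p b → p (a + b)) (m : S.Ind F) : p m := by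
  induction m using TensorProduct.induction_on with
  | zero => exact (map_zero (S.itmul (0 : UEA K S.nm) : F →ₗ[K] S.Ind F)) ▸ hu 0 0
  | tmul u f => exact hu u f
  | add a b h1 h2 => exact ha a b h1 h2

theorem ind_induction {p : S.Ind F → Prop} (h1 : ∀ f, p (S.iunit f))
    (hx : ∀ (x : S.nm) m, p m → p (S.iact (ι K x) m)) (ha : ∀ a b, p a → p b → p (a + b))
    (hk : ∀ (c : K) m, p m → p (c • m)) (m : S.Ind F) : p m := by
  have key : ∀ u m, p m → p (S.iact u m) := by
    refine uea_induction (p := fun u => ∀ m : S.Ind F, p m → p (S.iact u m)) (fun c m hm => ?_) hx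
      (fun u v hu hv m hm => ?_) (fun u v hu hv m hm => ?_)
    · rw [AlgHom.commutes]; exact hk c m hm
    · rw [map_add]; exact ha _ _ (hu m hm) (hv m hm)
    · rw [map_mul]; exact hu _ (hv m hm)
  refine S.ind_induction' (fun u f => ?_) ha m
  have := key u _ (h1 f)
  rwa [iunit, iact_itmul, mul_one] at this

instance : LieRingModule S.nm (S.Ind F) where
  bracket x m := S.iact (ι K x) m
  add_lie x y m := by
    change S.iact (ι K (x + y)) m = S.iact (ι K x) m + S.iact (ι K y) m
    rw [map_add, map_add]; rfl
  lie_add x m n := map_add (S.iact (ι K x)) m n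
  leibniz_lie x y m := by
    change S.iact (ι K x) (S.iact (ι K y) m) =
      S.iact (ι K ⁅x, y⁆) m + S.iact (ι K y) (S.iact (ι K x) m)
    letI : LieRing (UniversalEnvelopingAlgebra K S.nm) := LieRing.ofAssociativeRing
    rw [LieHom.map_lie, LieRing.of_associative_ring_bracket, map_sub, map_mul, map_mul]
    simp

instance : LieModule K S.nm (S.Ind F) where
  smul_lie c x m := by
    change S.iact (ι K (c • x)) m = c • S.iact (ι K x) m
    rw [map_smul, map_smul]; rfl
  lie_smul c x m := map_smul (S.iact (ι K x)) c m

theorem nm_lie (x : S.nm) (m : S.Ind F) : ⁅x, m⁆ = S.iact (ι K x) m := rfl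

variable [LieRingModule S.b F] [LieModule K S.b F]

/-- The action of `g` on the generators of the induced module. -/
def indGen : F →ₗ[K] g →ₗ[K] S.Ind F where
  toFun f :=
    { toFun := fun x => ⁅S.pm x, S.iunit f⁆ + S.iunit ⁅S.pb x, f⁆
      map_add' := fun x y => by simp only [map_add, add_lie]; abel
      map_smul' := fun c x => by simp only [map_smul, smul_lie, smul_add, RingHom.id_apply] }
  map_add' f f' := by
    ext x
    change ⁅S.pm x, S.iunit (f + f')⁆ + S.iunit ⁅S.pb x, f + f'⁆ =
      (⁅S.pm x, S.iunit f⁆ + S.iunit ⁅S.pb x, f⁆) + (⁅S.pm x, S.iunit f'⁆ + S.iunit ⁅S.pb x, f'⁆)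
    simp only [map_add, lie_add]; abel
  map_smul' c f := by
    ext x
    change ⁅S.pm x, S.iunit (c • f)⁆ + S.iunit ⁅S.pb x, c • f⁆ =
      c • (⁅S.pm x, S.iunit f⁆ + S.iunit ⁅S.pb x, f⁆)
    simp only [map_smul, lie_smul, smul_add]

/-- The action of `g` on the induced module. -/
def indAct : S.Ind F →ₗ[K] g →ₗ[K] S.Ind F :=
  TensorProduct.lift ((LinearMap.llcomp K F _ _).flip S.indGen ∘ₗ
    (UniversalEnvelopingAlgebra.lift K
      (LieModule.toEnd K S.nm (g →ₗ[K] S.Ind F))).toLinearMap)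

theorem indAct_iact (u : UEA K S.nm) (m : S.Ind F) : S.indAct (S.iact u m) =
    UniversalEnvelopingAlgebra.lift K (LieModule.toEnd K S.nm (g →ₗ[K] S.Ind F)) u
      (S.indAct m) := by
  refine S.ind_induction' (p := fun m => S.indAct (S.iact u m) =
    UniversalEnvelopingAlgebra.lift K (LieModule.toEnd K S.nm (g →ₗ[K] S.Ind F)) u
      (S.indAct m)) (fun v f => ?_) (fun a b ha hb => ?_) m
  · rw [iact_itmul]
    change UniversalEnvelopingAlgebra.lift K (LieModule.toEnd K S.nm (g →ₗ[K] S.Ind F)) (u * v)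
      (S.indGen f) = _
    rw [map_mul]; rfl
  · rw [map_add, map_add, ha, hb, map_add, map_add]

theorem indAct_lie (x : S.nm) (m : S.Ind F) (y : g) :
    S.indAct ⁅x, m⁆ y = ⁅x, S.indAct m y⁆ - S.indAct m ⁅(x : g), y⁆ := by
  rw [nm_lie, indAct_iact, UniversalEnvelopingAlgebra.lift_ι_apply]; rfl

theorem indAct_iunit (f : F) (y : g) :
    S.indAct (S.iunit f) y = ⁅S.pm y, S.iunit f⁆ + S.iunit ⁅S.pb y, f⁆ := by
  change UniversalEnvelopingAlgebra.lift K (LieModule.toEnd K S.nm (g →ₗ[K] S.Ind F)) 1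
      (S.indGen f) y = _
  rw [map_one]; rfl

theorem indAct_nm (x : S.nm) (m : S.Ind F) : S.indAct m x = ⁅x, m⁆ := by
  refine S.ind_induction (p := fun m => ∀ x : S.nm, S.indAct m x = ⁅x, m⁆) (fun f x => ?_)
    (fun y m hm x => ?_) (fun a b ha hb x => ?_) (fun c a ha x => ?_) m x
  · rw [indAct_iunit, pm_nm, pb_nm, zero_lie, map_zero, add_zero]
  · rw [← nm_lie, indAct_lie, hm, ← LieSubalgebra.coe_bracket, hm, leibniz_lie x y m,
      ← lie_skew x y, neg_lie]
    abel
  · rw [map_add, LinearMap.add_apply, ha, hb, lie_add]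
  · rw [map_smul, LinearMap.smul_apply, ha, lie_smul]

theorem indAct_b (y : S.b) (f : F) : S.indAct (S.iunit f) y = S.iunit ⁅y, f⁆ := by
  rw [indAct_iunit, pm_b, pb_b, zero_lie, zero_add]

theorem indAct_bracket_nm (a : S.nm) (y : g) (m : S.Ind F) :
    S.indAct m ⁅(a : g), y⁆ =
      S.indAct (S.indAct m y) a - S.indAct (S.indAct m a) y := by
  rw [indAct_nm, indAct_nm, indAct_lie]; abel

theorem indAct_bracket (m : S.Ind F) (x y : g) : S.indAct m ⁅x, y⁆ =
    S.indAct (S.indAct m y) x - S.indAct (S.indAct m x) y := by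
  refine S.ind_induction (p := fun m => ∀ x y, S.indAct m ⁅x, y⁆ =
    S.indAct (S.indAct m y) x - S.indAct (S.indAct m x) y) (fun f x y => ?_)
    (fun a m hm x y => ?_) (fun a b ha hb x y => ?_) (fun c a ha x y => ?_) m x y
  · rw [← S.pm_add_pb x, ← S.pm_add_pb y]
    generalize S.pm x = a, S.pm y = a', S.pb x = b, S.pb y = b'
    have h1 := S.indAct_bracket_nm a ((a' : g) + b') (S.iunit f)
    have h2 := S.indAct_bracket_nm a' (b : g) (S.iunit f)
    have h3 : S.indAct (S.iunit f) ⁅(b : g), (b' : g)⁆ = S.indAct (S.indAct (S.iunit f) b') b -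
        S.indAct (S.indAct (S.iunit f) b) b' := by
      rw [← LieSubalgebra.coe_bracket]
      simp only [indAct_b]
      rw [lie_lie, map_sub]
    rw [add_lie, map_add, h1, lie_add, map_add _ ⁅(b : g), (a' : g)⁆, h3,
      ← lie_skew, map_neg, h2]
    simp only [map_add, LinearMap.add_apply]
    abel
  · rw [← nm_lie]
    have e1 := hm ⁅(a : g), x⁆ y
    have e2 := hm x ⁅(a : g), y⁆
    have e3 := hm x y
    simp only [indAct_lie, map_sub, LinearMap.sub_apply, e3, lie_sub]
    rw [leibniz_lie (a : g) x y, map_add, e1, e2]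
    abel
  · simp only [map_add, LinearMap.add_apply, ha, hb]; abel
  · simp only [map_smul, LinearMap.smul_apply, ha, smul_sub]

instance : LieRingModule g (S.Ind F) where
  bracket x m := S.indAct m x
  add_lie x y m := map_add _ x y
  lie_add x m n := by
    rw [map_add]; rfl
  leibniz_lie x y m := by
    change S.indAct (S.indAct m y) x = S.indAct m ⁅x, y⁆ + S.indAct (S.indAct m x) y
    rw [indAct_bracket, sub_add_cancel]

instance : LieModule K g (S.Ind F) where
  smul_lie c x m := map_smul _ c x
  lie_smul c x m := by
    change S.indAct (c • m) x = c • S.indAct m x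
    rw [map_smul]; rfl

instance : Module (UEA K g) (S.Ind F) := lieUEA K g (S.Ind F)

theorem ind_algebraMap (c : K) (m : S.Ind F) : algebraMap K (UEA K g) c • m = c • m :=
  lieUEA_algebraMap c m

theorem ind_ι_nm (x : S.nm) (m : S.Ind F) : (ι K (x : g) : UEA K g) • m = S.iact (ι K x) m :=
  (lieUEA_ι (x : g) m).trans (S.indAct_nm x m)

theorem ind_ι_b (y : S.b) (f : F) : (ι K (y : g) : UEA K g) • S.iunit f = S.iunit ⁅y, f⁆ :=
  (lieUEA_ι (y : g) (S.iunit f)).trans (S.indAct_b y f)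

theorem ind_span (N : Submodule (UEA K g) (S.Ind F)) (hN : ∀ f, S.iunit f ∈ N) : N = ⊤ := by
  rw [Submodule.eq_top_iff']
  refine S.ind_induction hN (fun x m hm => ?_) (fun _ _ => N.add_mem) (fun c m hm => ?_)
  · rw [← ind_ι_nm]; exact N.smul_mem _ hm
  · rw [← ind_algebraMap]; exact N.smul_mem _ hm

theorem ind_hom_ext {M : Type} [AddCommGroup M] [Module (UEA K g) M]
    {φ ψ : S.Ind F →ₗ[UEA K g] M} (h : ∀ f : F, φ (S.iunit f) = ψ (S.iunit f)) : φ = ψ := by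
  have := S.ind_span (LinearMap.eqLocus φ ψ) h
  exact LinearMap.ext fun m => (this ▸ trivial : m ∈ LinearMap.eqLocus φ ψ)

end Ind
end RootReductive


namespace RootReductive

section IndHom

variable (S : RootReductive K g) {F F' F'' : Type} [AddCommGroup F] [Module K F]
  [LieRingModule S.b F] [LieModule K S.b F] [AddCommGroup F'] [Module K F']
  [LieRingModule S.b F'] [LieModule K S.b F'] [AddCommGroup F''] [Module K F'']
  [LieRingModule S.b F''] [LieModule K S.b F'']
  {M : Type} [AddCommGroup M] [Module (UEA K g) M]

/-- The linear map underlying the induction adjunction. -/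
def indLiftAux (φ : F →ₗ[K] Res K g M) : S.Ind F →ₗ[K] Res K g M :=
  TensorProduct.lift ((LinearMap.llcomp K F _ _).flip φ ∘ₗ
    (UniversalEnvelopingAlgebra.lift K (LieModule.toEnd K S.nm (Res K g M))).toLinearMap)

theorem indLiftAux_iunit (φ : F →ₗ[K] Res K g M) (f : F) :
    S.indLiftAux φ (S.iunit f) = φ f := by
  change UniversalEnvelopingAlgebra.lift K (LieModule.toEnd K S.nm (Res K g M)) 1 (φ f) = _
  rw [map_one]; rfl

theorem indLiftAux_iact (φ : F →ₗ[K] Res K g M) (x : S.nm) (m : S.Ind F) :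
    S.indLiftAux φ (S.iact (ι K x) m) = ⁅(x : g), S.indLiftAux φ m⁆ := by
  refine S.ind_induction' (p := fun m => S.indLiftAux φ (S.iact (ι K x) m) =
    ⁅(x : g), S.indLiftAux φ m⁆) (fun v f => ?_) (fun a b ha hb => ?_) m
  · rw [iact_itmul]
    change UniversalEnvelopingAlgebra.lift K (LieModule.toEnd K S.nm (Res K g M)) (ι K x * v)
      (φ f) = _
    rw [map_mul, UniversalEnvelopingAlgebra.lift_ι_apply]; rfl
  · rw [map_add, map_add, ha, hb, map_add, lie_add]

theorem indLiftAux_ι (φ : F →ₗ⁅K, S.b⁆ Res K g M) (x : g) (m : S.Ind F) :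
    S.indLiftAux (φ : F →ₗ[K] Res K g M) ((ι K x : UEA K g) • m) =
      ⁅x, S.indLiftAux (φ : F →ₗ[K] Res K g M) m⁆ := by
  refine S.ind_induction (p := fun m => ∀ x : g,
    S.indLiftAux (φ : F →ₗ[K] Res K g M) ((ι K x : UEA K g) • m) =
      ⁅x, S.indLiftAux (φ : F →ₗ[K] Res K g M) m⁆) (fun f x => ?_) (fun a m hm x => ?_)
      (fun a b ha hb x => ?_) (fun c a ha x => ?_) m x
  · rw [← S.pm_add_pb x, map_add, add_smul, map_add, ind_ι_nm, indLiftAux_iact, ind_ι_b,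
      indLiftAux_iunit, indLiftAux_iunit, add_lie]
    congr 1
    exact φ.map_lie (S.pb x) f
  · have h1 : (ι K x : UEA K g) • S.iact (ι K a) m =
        S.iact (ι K a) ((ι K x : UEA K g) • m) + (ι K ⁅x, (a : g)⁆ : UEA K g) • m := by
      rw [← ind_ι_nm, ← ind_ι_nm, ι_lie_smul]; abel
    rw [h1, map_add, indLiftAux_iact, indLiftAux_iact, hm, hm, leibniz_lie x (a : g)]
    abel
  · rw [smul_add, map_add, ha, hb, map_add, lie_add]
  · rw [← ind_algebraMap, ← mul_smul, ← Algebra.commutes, mul_smul, ind_algebraMap, map_smul, ha,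
      ind_algebraMap, map_smul, lie_smul]

/-- The induction adjunction. -/
def indLift (φ : F →ₗ⁅K, S.b⁆ Res K g M) : S.Ind F →ₗ[UEA K g] M :=
  ueaHom (S.indLiftAux (φ : F →ₗ[K] Res K g M)).toAddMonoidHom
    (fun c m => by
      rw [ind_algebraMap]
      exact map_smul (S.indLiftAux (φ : F →ₗ[K] Res K g M)) c m)
    (fun x m => S.indLiftAux_ι φ x m)

theorem indLift_iunit (φ : F →ₗ⁅K, S.b⁆ Res K g M) (f : F) : S.indLift φ (S.iunit f) = φ f :=
  S.indLiftAux_iunit (φ : F →ₗ[K] Res K g M) f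

/-- The unit of the adjunction as a homomorphism of `b`-modules. -/
def iunitHom : F →ₗ⁅K, S.b⁆ Res K g (S.Ind F) where
  toFun := S.iunit
  map_add' := S.iunit.map_add
  map_smul' c f := by
    rw [map_smul]; exact (S.ind_algebraMap c _).symm
  map_lie' {y f} := (S.ind_ι_b y f).symm

/-- Induction of homomorphisms. -/
def indMap (φ : F →ₗ⁅K, S.b⁆ F') : S.Ind F →ₗ[UEA K g] S.Ind F' :=
  S.indLift (S.iunitHom.comp φ)

theorem indMap_iunit (φ : F →ₗ⁅K, S.b⁆ F') (f : F) :
    S.indMap φ (S.iunit f) = S.iunit (φ f) := S.indLift_iunit _ f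

/-- The linear map underlying an induced homomorphism. -/
def indLT (φ : F →ₗ[K] F') : S.Ind F →ₗ[K] S.Ind F' := LinearMap.lTensor (UEA K S.nm) φ

theorem indLT_itmul (φ : F →ₗ[K] F') (u : UEA K S.nm) (f : F) :
    S.indLT φ (S.itmul u f) = S.itmul u (φ f) := rfl

theorem indMap_eq (φ : F →ₗ⁅K, S.b⁆ F') (m : S.Ind F) :
    S.indMap φ m = S.indLT (φ : F →ₗ[K] F') m := by
  refine S.ind_induction (p := fun m => S.indMap φ m = S.indLT (φ : F →ₗ[K] F') m)
    (fun f => S.indMap_iunit φ f) (fun a m hm => ?_) (fun a b ha hb => ?_) (fun c a ha => ?_) m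
  · rw [← ind_ι_nm, map_smul, hm, ind_ι_nm, ind_ι_nm]
    refine S.ind_induction' (p := fun m => S.iact (ι K a) (S.indLT (φ : F →ₗ[K] F') m) =
      S.indLT (φ : F →ₗ[K] F') (S.iact (ι K a) m)) (fun u f => ?_) (fun a b ha hb => ?_) m
    · rw [iact_itmul, indLT_itmul, indLT_itmul, iact_itmul]
    · simp only [map_add, ha, hb]
  · rw [map_add, ha, hb, map_add]
  · rw [map_smul (S.indLT (φ : F →ₗ[K] F')), ← ha, ← ind_algebraMap, ← ind_algebraMap, map_smul]

theorem indMap_injective {φ : F →ₗ⁅K, S.b⁆ F'} (h : Function.Injective φ) :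
    Function.Injective (S.indMap φ) := by
  rw [show (S.indMap φ : S.Ind F → S.Ind F') = S.indLT (φ : F →ₗ[K] F') from
    funext (S.indMap_eq φ)]
  exact Module.Flat.lTensor_preserves_injective_linearMap (φ : F →ₗ[K] F') h

theorem indMap_surjective {φ : F →ₗ⁅K, S.b⁆ F'} (h : Function.Surjective φ) :
    Function.Surjective (S.indMap φ) := by
  rw [show (S.indMap φ : S.Ind F → S.Ind F') = S.indLT (φ : F →ₗ[K] F') from
    funext (S.indMap_eq φ)]
  exact LinearMap.lTensor_surjective (UEA K S.nm) (g := (φ : F →ₗ[K] F')) h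

theorem indMap_exact {φ : F →ₗ⁅K, S.b⁆ F'} {ψ : F' →ₗ⁅K, S.b⁆ F''} (h : Function.Exact φ ψ)
    (hψ : Function.Surjective ψ) : Function.Exact (S.indMap φ) (S.indMap ψ) := by
  rw [show (S.indMap φ : S.Ind F → S.Ind F') = S.indLT (φ : F →ₗ[K] F') from
    funext (S.indMap_eq φ), show (S.indMap ψ : S.Ind F' → S.Ind F'') =
    S.indLT (ψ : F' →ₗ[K] F'') from funext (S.indMap_eq ψ)]
  exact lTensor_exact (UEA K S.nm) (f := (φ : F →ₗ[K] F')) (g := (ψ : F' →ₗ[K] F'')) h hψ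

open scoped TensorProduct in
theorem iunit_injective : Function.Injective (S.iunit : F →ₗ[K] S.Ind F) := by
  letI : LieRing K := LieRing.ofAssociativeRing
  let ε : UEA K S.nm →ₐ[K] K := UniversalEnvelopingAlgebra.lift K (0 : S.nm →ₗ⁅K⁆ K)
  let r : UEA K S.nm ⊗[K] F →ₗ[K] F := TensorProduct.lid K F ∘ₗ ε.toLinearMap.rTensor F
  refine Function.LeftInverse.injective (g := r) fun f => ?_
  change ε 1 • f = f
  rw [map_one, one_smul]

end IndHom

section WeightModules

variable (S : RootReductive K g) (F : Type) {F' : Type} [AddCommGroup F] [Module K F]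
  [LieRingModule S.b F] [LieModule K S.b F] [AddCommGroup F'] [Module K F']
  [LieRingModule S.b F'] [LieModule K S.b F']
  {M : Type} [AddCommGroup M] [Module (UEA K g) M]

/-- The action of the Cartan subalgebra on a `b`-module. -/
def rb : S.h → Module.End K F := fun H => LieModule.toEnd K S.b F ⟨H, S.h_le_b H.2⟩

/-- All weights of the module lie in a given set, and the module is a sum of weight spaces. -/
def WtIn (D : Set (Module.Dual K S.h)) : Prop := ∀ f : F, f ∈ wtSum (S.rb F) D

variable {F}

theorem hom_rb (φ : F →ₗ⁅K, S.b⁆ F') (H : S.h) (f : F) :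
    (φ : F →ₗ[K] F') (S.rb F H f) = S.rb F' H ((φ : F →ₗ[K] F') f) :=
  φ.map_lie _ f

variable {S} in
theorem WtIn.mono {D E : Set (Module.Dual K S.h)} (hF : S.WtIn F D)
    (h : D ⊆ E) : S.WtIn F E := fun f => wtSum_mono h (hF f)

variable {S} in
theorem WtIn.of_surjective {D : Set (Module.Dual K S.h)}
    (hF : S.WtIn F D) (φ : F →ₗ⁅K, S.b⁆ F') (hφ : Function.Surjective φ) : S.WtIn F' D := by
  intro f
  obtain ⟨f, rfl⟩ := hφ f
  exact map_wtSum_le (S.hom_rb φ) (hF f)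

theorem mem_wtSum_of_injective (φ : F →ₗ⁅K, S.b⁆ F') (hφ : Function.Injective φ)
    {D : Set (Module.Dual K S.h)} {f : F} (hf : φ f ∈ wtSum (S.rb F') D) :
    f ∈ wtSum (S.rb F) D := by
  obtain ⟨s, v, hs, hv, hsum⟩ := exists_sum_of_mem_wtSum hf
  have h1 : ∀ χ ∈ s, v χ ∈ LinearMap.range (φ : F →ₗ[K] F') :=
    mem_of_sum_wt_mem (ρ := S.rb F') (by
      rintro H _ ⟨f, rfl⟩
      exact ⟨_, S.hom_rb φ H f⟩) s v (fun χ _ => hv χ) (by rw [hsum]; exact ⟨f, rfl⟩)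
  choose! w hw using h1
  have h2 : ∀ χ ∈ s, w χ ∈ wt (S.rb F) χ := fun χ hχ => mem_wt.2 fun H => hφ <| by
    have e1 := S.hom_rb φ H (w χ)
    rw [hw χ hχ, mem_wt.1 (hv χ), ← hw χ hχ, ← map_smul] at e1
    exact e1
  have h3 : f = ∑ χ ∈ s, w χ := hφ <| by
    rw [← hsum]
    exact ((map_sum (φ : F →ₗ[K] F') w s).trans (Finset.sum_congr rfl hw)).symm
  rw [h3]
  exact Submodule.sum_mem _ fun χ hχ => wt_le_wtSum (hs hχ) (h2 χ hχ)

variable {S} in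
theorem WtIn.of_injective {D : Set (Module.Dual K S.h)}
    (hF : S.WtIn F' D) (φ : F →ₗ⁅K, S.b⁆ F') (hφ : Function.Injective φ) : S.WtIn F D :=
  fun f => S.mem_wtSum_of_injective φ hφ (hF (φ f))

theorem lie_mem_wtSum {D D' E : Set (Module.Dual K S.h)}
    (hE : ∀ α ∈ E, ∀ χ ∈ D, χ + α ∈ D') {x : g} (hx : x ∈ wtSum S.adh E) {m : Res K g M}
    (hm : m ∈ wtSum (S.rb (Res K g M)) D) : ⁅x, m⁆ ∈ wtSum (S.rb (Res K g M)) D' := by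
  have h1 : wtSum (S.rb (Res K g M)) D ≤ (wtSum (S.rb (Res K g M)) D').comap
      (LieModule.toEnd K g (Res K g M) x) := by
    refine wtSum_le.2 fun χ hχ m hm => ?_
    have h2 : wtSum S.adh E ≤ (wtSum (S.rb (Res K g M)) D').comap
        ((LieModule.toEnd K g (Res K g M) : g →ₗ[K] Module.End K (Res K g M)).flip m) := by
      refine wtSum_le.2 fun α hα x hx => ?_
      refine wt_le_wtSum (hE α hα χ hχ) (mem_wt.2 fun H => ?_)
      change ⁅(H : g), ⁅x, m⁆⁆ = (χ H + α H) • ⁅x, m⁆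
      have e1 : ⁅(H : g), x⁆ = α H • x := mem_wt.1 hx H
      have e2 : ⁅(H : g), m⁆ = χ H • m := mem_wt.1 hm H
      rw [leibniz_lie, e1, e2, smul_lie, lie_smul, add_smul, add_comm]
    exact h2 hx
  exact h1 hm

theorem lie_mem_wtSum_b {D D' : Set (Module.Dual K S.h)}
    (hE : ∀ α ∈ insert 0 S.Φp, ∀ χ ∈ D, χ + α ∈ D') (y : S.b) {f : F}
    (hf : f ∈ wtSum (S.rb F) D) : ⁅y, f⁆ ∈ wtSum (S.rb F) D' := by
  refine S.mem_wtSum_of_injective S.iunitHom S.iunit_injective ?_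
  rw [S.iunitHom.map_lie]
  exact S.lie_mem_wtSum hE (S.b_le y.2) (map_wtSum_le (S.hom_rb S.iunitHom) hf)

theorem ind_wtIn {D : Set (Module.Dual K S.h)} (hD : ∀ α ∈ S.Φp, ∀ χ ∈ D, χ - α ∈ D)
    (hF : S.WtIn F D) : S.WtIn (Res K g (S.Ind F)) D := by
  intro m
  refine S.ind_induction (p := fun m => (show Res K g (S.Ind F) from m) ∈ wtSum (S.rb _) D)
    (fun f => map_wtSum_le (S.hom_rb S.iunitHom) (hF f)) (fun x m hm => ?_)
    (fun _ _ => Submodule.add_mem _) (fun c m hm => ?_) m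
  · rw [← ind_ι_nm]
    refine S.lie_mem_wtSum (E := -S.Φp) (fun α hα χ hχ => ?_) (S.nm_eq ▸ x.2) hm
    simpa using hD (-α) hα χ hχ
  · rw [← ind_algebraMap]
    exact Submodule.smul_mem _ c hm

end WeightModules

end RootReductive


/-- A linear map of modules over the enveloping algebra, restricted to the Borel subalgebra. -/
def RootReductive.resb (S : RootReductive K g) {M N : Type} [AddCommGroup M] [Module (UEA K g) M]
    [AddCommGroup N] [Module (UEA K g) N] (f : M →ₗ[UEA K g] N) :
    Res K g M →ₗ⁅K, S.b⁆ Res K g N where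
  toFun := f
  map_add' := f.map_add
  map_smul' c m := f.map_smul (algebraMap K (UEA K g) c) m
  map_lie' {x m} := f.map_smul (ι K (x : g)) m

namespace RootReductive

section Order

variable {S : RootReductive K g} {Kset : Set (Module.Dual K S.h)}

theorem wle_refl (μ : Module.Dual K S.h) : S.wle μ μ := by
  rw [wle, sub_self]; exact zero_mem _

theorem wle.trans {a b c : Module.Dual K S.h} (h1 : S.wle a b) (h2 : S.wle b c) : S.wle a c := by
  have := add_mem h1 h2
  rwa [add_comm, sub_add_sub_cancel] at this

theorem wle_add {α : Module.Dual K S.h} (hα : α ∈ S.Φp) (μ : Module.Dual K S.h) :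
    S.wle μ (μ + α) := by
  rw [wle, add_sub_cancel_left]; exact AddSubmonoid.subset_closure hα

/-- The monoid generated by the positive roots contains no nontrivial subgroup. -/
def Pointed (S : RootReductive K g) : Prop := ∀ α ∈ S.Γp, -α ∈ S.Γp → α = 0

theorem pointed_of (hne : Kset.Nonempty) (hId : S.IsIdeal Kset) (hUF : S.UpperFinite Kset) :
    S.Pointed := by
  intro α h1 h2
  by_contra h0
  obtain ⟨μ, hμ⟩ := hne
  have hinj : Function.Injective fun n : ℕ => μ + n • α := by
    intro m n hmn
    have := add_left_cancel hmn
    simp only [← Nat.cast_smul_eq_nsmul K] at this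
    exact Nat.cast_injective (smul_left_injective K h0 this)
  refine Set.infinite_of_injective_forall_mem hinj (fun n => ?_) (hUF μ hμ)
  refine ⟨hId μ hμ _ ?_, ?_⟩
  · change μ - (μ + n • α) ∈ S.Γp
    rw [sub_add_cancel_left]; simpa using nsmul_mem h2 n
  · change μ + n • α - μ ∈ S.Γp
    rw [add_sub_cancel_left]; exact nsmul_mem h1 n

theorem interval_finite (hne : Kset.Nonempty) (hId : S.IsIdeal Kset) (hUF : S.UpperFinite Kset)
    (μ lam : Module.Dual K S.h) : {ν | S.wle μ ν ∧ S.wle ν lam}.Finite := by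
  obtain ⟨κ, hκ⟩ := hne
  by_cases hle : S.wle μ lam
  · have hμ : μ + (κ - lam) ∈ Kset := hId κ hκ _ (by
      change κ - (μ + (κ - lam)) ∈ S.Γp
      rw [show κ - (μ + (κ - lam)) = lam - μ by abel]; exact hle)
    refine Set.Finite.of_injOn (f := fun ν => ν + (κ - lam)) (fun ν hν => ?_)
      (add_left_injective _).injOn (hUF _ hμ)
    refine ⟨hId κ hκ _ ?_, ?_⟩
    · change κ - (ν + (κ - lam)) ∈ S.Γp
      rw [show κ - (ν + (κ - lam)) = lam - ν by abel]; exact hν.2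
    · change ν + (κ - lam) - (μ + (κ - lam)) ∈ S.Γp
      rw [show ν + (κ - lam) - (μ + (κ - lam)) = ν - μ by abel]; exact hν.1
  · convert Set.finite_empty
    ext ν
    exact ⟨fun h => hle (h.1.trans h.2), fun h => h.elim⟩

end Order

section Bridge

variable (S : RootReductive K g) {M N : Type} [AddCommGroup M] [Module (UEA K g) M]
  [AddCommGroup N] [Module (UEA K g) N]

theorem mem_wtSet {χ : Module.Dual K S.h} {m : M} :
    m ∈ S.wtSet M χ ↔ (show Res K g M from m) ∈ wt (S.rb (Res K g M)) χ := by
  rw [mem_wt]; rfl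

theorem isWeightMod_iff : S.IsWeightMod M ↔ S.WtIn (Res K g M) Set.univ := by
  refine forall_congr' fun m => ⟨fun hm => ?_, fun hm => ?_⟩
  · refine AddSubgroup.closure_induction
      (p := fun (m : M) _ => (show Res K g M from m) ∈ wtSum (S.rb (Res K g M)) Set.univ)
      (fun m hm => ?_) (zero_mem _) (fun a b _ _ ha hb => add_mem ha hb)
      (fun a _ ha => neg_mem ha) hm
    obtain ⟨χ, hm⟩ := Set.mem_iUnion.1 hm
    exact wt_le_wtSum (Set.mem_univ χ) (S.mem_wtSet.1 hm)
  · obtain ⟨s, f, -, hf, rfl⟩ := exists_sum_of_mem_wtSum hm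
    exact AddSubgroup.sum_mem _ fun χ _ => AddSubgroup.subset_closure
      (Set.mem_iUnion.2 ⟨χ, S.mem_wtSet.2 (hf χ)⟩)

theorem isWeightMod_supp_iff {D : Set (Module.Dual K S.h)} :
    S.IsWeightMod M ∧ S.suppSet M ⊆ D ↔ S.WtIn (Res K g M) D := by
  rw [isWeightMod_iff]
  refine ⟨fun ⟨h1, h2⟩ m => ?_, fun h => ⟨h.mono (Set.subset_univ _), ?_⟩⟩
  · obtain ⟨s, f, -, hf, rfl⟩ := exists_sum_of_mem_wtSum (h1 m)
    refine Submodule.sum_mem _ fun χ _ => ?_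
    by_cases h0 : f χ = 0
    · rw [h0]; exact zero_mem _
    · exact wt_le_wtSum (h2 ⟨f χ, S.mem_wtSet.2 (hf χ), h0⟩) (hf χ)
  · rintro χ ⟨m, hm, h0⟩
    by_contra hχ
    exact h0 (eq_zero_of_mem_wt_of_mem_wtSum (V := Res K g M) hχ (S.mem_wtSet.1 hm) (h m))

theorem hom_mem_wtSum {F F' : Type} [AddCommGroup F] [Module K F] [LieRingModule S.b F]
    [LieModule K S.b F] [AddCommGroup F'] [Module K F'] [LieRingModule S.b F']
    [LieModule K S.b F'] (φ : F →ₗ⁅K, S.b⁆ F') {D : Set (Module.Dual K S.h)} {f : F}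
    (hf : f ∈ wtSum (S.rb F) D) : φ f ∈ wtSum (S.rb F') D :=
  map_wtSum_le (f := (φ : F →ₗ[K] F')) (S.hom_rb φ) hf

theorem res_prod_eq (x : Res K g (M × N)) :
    x = S.resb (LinearMap.inl (UEA K g) M N) (show M × N from x).1 +
      S.resb (LinearMap.inr (UEA K g) M N) (show M × N from x).2 := by
  obtain ⟨m, n⟩ := x
  change ((m, n) : M × N) = ((m, 0) : M × N) + ((0, n) : M × N)
  simp

theorem wtIn_prod {D : Set (Module.Dual K S.h)} (hM : S.WtIn (Res K g M) D)
    (hN : S.WtIn (Res K g N) D) : S.WtIn (Res K g (M × N)) D := fun x => by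
  rw [S.res_prod_eq x]
  exact add_mem (S.hom_mem_wtSum _ (hM _)) (S.hom_mem_wtSum _ (hN _))

end Bridge

section LocallyFinite

variable (S : RootReductive K g) (F : Type) {F' : Type} [AddCommGroup F] [Module K F]
  [LieRingModule S.b F] [LieModule K S.b F] [AddCommGroup F'] [Module K F']
  [LieRingModule S.b F'] [LieModule K S.b F']
  {M N : Type} [AddCommGroup M] [Module (UEA K g) M]
  [AddCommGroup N] [Module (UEA K g) N]

/-- A locally finite module over the Borel subalgebra. -/
def LF : Prop := ∀ f : F, ∃ N : LieSubmodule K S.b F, f ∈ N ∧ FiniteDimensional K N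

theorem isLocFin_iff : S.IsLocFin M ↔ S.LF (Res K g M) := by
  refine forall_congr' fun m => ⟨?_, ?_⟩
  · rintro ⟨N, hm, hfd, hN⟩
    exact ⟨{ toSubmodule := N, lie_mem := fun {x v} hv => hN x.1 x.2 v hv }, hm, hfd⟩
  · rintro ⟨N, hm, hfd⟩
    exact ⟨N.toSubmodule, hm, hfd, fun x hx v hv => N.lie_mem (x := ⟨x, hx⟩) hv⟩

variable {F}

theorem locFin_add {f f' : F} (h : ∃ N : LieSubmodule K S.b F, f ∈ N ∧ FiniteDimensional K N)
    (h' : ∃ N : LieSubmodule K S.b F, f' ∈ N ∧ FiniteDimensional K N) :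
    ∃ N : LieSubmodule K S.b F, f + f' ∈ N ∧ FiniteDimensional K N := by
  obtain ⟨N, hN, hfd⟩ := h
  obtain ⟨N', hN', hfd'⟩ := h'
  refine ⟨N ⊔ N', add_mem (le_sup_left (a := N) hN) (le_sup_right (a := N) hN'), ?_⟩
  change FiniteDimensional K (N ⊔ N').toSubmodule
  rw [LieSubmodule.sup_toSubmodule]
  have : FiniteDimensional K N.toSubmodule := hfd
  have : FiniteDimensional K N'.toSubmodule := hfd'
  infer_instance

theorem locFin_map (φ : F →ₗ⁅K, S.b⁆ F') {f : F}
    (h : ∃ N : LieSubmodule K S.b F, f ∈ N ∧ FiniteDimensional K N) :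
    ∃ N : LieSubmodule K S.b F', φ f ∈ N ∧ FiniteDimensional K N := by
  obtain ⟨N, hN, hfd⟩ := h
  refine ⟨N.map φ, LieSubmodule.mem_map_of_mem hN, ?_⟩
  change FiniteDimensional K (N.map φ).toSubmodule
  rw [LieSubmodule.toSubmodule_map]
  have : FiniteDimensional K N.toSubmodule := hfd
  infer_instance

variable {S} in
theorem LF.of_surjective (hF : S.LF F) (φ : F →ₗ⁅K, S.b⁆ F') (hφ : Function.Surjective φ) :
    S.LF F' := fun f => by
  obtain ⟨f, rfl⟩ := hφ f
  exact S.locFin_map φ (hF f)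

variable {S} in
theorem LF.of_injective (hF : S.LF F') (φ : F →ₗ⁅K, S.b⁆ F') (hφ : Function.Injective φ) :
    S.LF F := fun f => by
  obtain ⟨N, hN, hfd⟩ := hF (φ f)
  refine ⟨N.comap φ, hN, ?_⟩
  have : FiniteDimensional K N.toSubmodule := hfd
  let ψ : (N.comap φ).toSubmodule →ₗ[K] N.toSubmodule :=
    (φ : F →ₗ[K] F').restrict fun x hx => hx
  exact FiniteDimensional.of_injective ψ fun x y hxy => Subtype.ext (hφ (congrArg Subtype.val hxy))

theorem lf_prod (hM : S.LF (Res K g M)) (hN : S.LF (Res K g N)) :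
    S.LF (Res K g (M × N)) := fun x => by
  rw [S.res_prod_eq x]
  exact S.locFin_add (S.locFin_map _ (hM _)) (S.locFin_map _ (hN _))

theorem exists_root_vector {α : Module.Dual K S.h} (hα : α ∈ S.Φ) :
    ∃ e ∈ rootSp K g S.h α, ∀ x ∈ rootSp K g S.h α, ∃ c : K, x = c • e := by
  obtain ⟨e, he⟩ := rank_le_one_iff.1 (S.root_dim α hα).le
  refine ⟨e, e.2, fun x hx => ?_⟩
  obtain ⟨c, hc⟩ := he ⟨x, hx⟩
  exact ⟨c, (congrArg Subtype.val hc).symm⟩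

theorem rootSp_le_b {α : Module.Dual K S.h} (hα : α ∈ S.Φp) :
    rootSp K g S.h α ≤ S.b.toSubmodule := by
  rw [S.b_def]
  exact le_sup_of_le_right (le_iSup₂ (f := fun α (_ : α ∈ S.Φp) => rootSp K g S.h α) α hα)

/-- A subspace containing `h` and all positive root spaces contains `b`. -/
theorem b_induction {T : Submodule K S.b} (hh : ∀ H : S.h, (⟨H, S.h_le_b H.2⟩ : S.b) ∈ T)
    (hr : ∀ α (hα : α ∈ S.Φp) x (hx : x ∈ rootSp K g S.h α),
      (⟨x, S.rootSp_le_b hα hx⟩ : S.b) ∈ T) (y : S.b) : y ∈ T := by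
  have : S.b.toSubmodule ≤ T.map S.b.toSubmodule.subtype := by
    conv_lhs => rw [S.b_def]
    refine sup_le (fun H hH => ⟨_, hh ⟨H, hH⟩, rfl⟩) (iSup₂_le fun α hα x hx => ⟨_, hr α hα x hx, rfl⟩)
  obtain ⟨y', hy', h⟩ := this y.2
  rwa [← Subtype.ext h]

theorem lie_mem_wt_b {α χ : Module.Dual K S.h} {y : S.b} (hy : (y : g) ∈ rootSp K g S.h α) {f : F}
    (hf : f ∈ wt (S.rb F) χ) : ⁅y, f⁆ ∈ wt (S.rb F) (χ + α) := by
  refine mem_wt.2 fun H => ?_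
  have e1 : ⁅(⟨H, S.h_le_b H.2⟩ : S.b), y⁆ = α H • y := Subtype.ext (hy H)
  have e2 : ⁅(⟨H, S.h_le_b H.2⟩ : S.b), f⁆ = χ H • f := mem_wt.1 hf H
  change ⁅(⟨H, S.h_le_b H.2⟩ : S.b), ⁅y, f⁆⁆ = (χ H + α H) • ⁅y, f⁆
  rw [leibniz_lie, e1, e2, smul_lie, lie_smul, add_smul, add_comm]

theorem lf_of_upperFinite (hp : S.Pointed) {D : Set (Module.Dual K S.h)} (hD : S.UpperFinite D)
    (hF : S.WtIn F D) : S.LF F := by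
  classical
  have key : ∀ (n : ℕ) (χ : Module.Dual K S.h), {lam ∈ D | S.wle χ lam}.ncard = n → χ ∈ D →
      ∀ f ∈ wt (S.rb F) χ, ∃ N : LieSubmodule K S.b F, f ∈ N ∧ FiniteDimensional K N := by
    intro n
    induction n using Nat.strong_induction_on with
    | _ n ih =>
    intro χ hn hχ f hf
    have hroot : ∀ α : S.Φp, ∃ N : LieSubmodule K S.b F, FiniteDimensional K N ∧
        ∀ x (hx : x ∈ rootSp K g S.h (α : Module.Dual K S.h)),
          ⁅(⟨x, S.rootSp_le_b α.2 hx⟩ : S.b), f⁆ ∈ N := by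
      rintro ⟨α, hα⟩
      obtain ⟨e, he, hspan⟩ := S.exists_root_vector (S.pos_subset hα)
      have h1 : ∃ N : LieSubmodule K S.b F, ⁅(⟨e, S.rootSp_le_b hα he⟩ : S.b), f⁆ ∈ N ∧
          FiniteDimensional K N := by
        have h2 := S.lie_mem_wt_b (y := ⟨e, S.rootSp_le_b hα he⟩) he hf
        by_cases hχα : χ + α ∈ D
        · refine ih _ ?_ (χ + α) rfl hχα _ h2
          rw [← hn]
          refine Set.ncard_lt_ncard ⟨fun lam h => ⟨h.1, (wle_add hα χ).trans h.2⟩, fun hcon => ?_⟩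
            (hD χ hχ)
          have h3 : S.wle (χ + α) χ := (hcon ⟨hχ, wle_refl χ⟩).2
          rw [wle, sub_add_cancel_left] at h3
          have := hp α (AddSubmonoid.subset_closure hα) h3
          exact S.zero_notMem_Φp (this ▸ hα)
        · rw [eq_zero_of_mem_wt_of_mem_wtSum hχα h2 (hF _)]
          exact ⟨⊥, zero_mem _, inferInstanceAs (FiniteDimensional K (⊥ : Submodule K F))⟩
      obtain ⟨N, hN, hfd⟩ := h1
      refine ⟨N, hfd, fun x hx => ?_⟩
      obtain ⟨c, rfl⟩ := hspan x hx
      have : (⟨c • e, S.rootSp_le_b hα hx⟩ : S.b) = c • (⟨e, S.rootSp_le_b hα he⟩ : S.b) := rfl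
      rw [this, smul_lie]
      exact N.smul_mem c hN
    choose N hfd hN using hroot
    have hfin : {α : S.Φp | χ + α ∈ D}.Finite := by
      refine Set.Finite.of_injOn (f := fun α : S.Φp => χ + (α : Module.Dual K S.h))
        (t := {lam ∈ D | S.wle χ lam}) (fun α hα => ⟨hα, wle_add α.2 χ⟩) ?_ (hD χ hχ)
      exact (add_right_injective χ).comp Subtype.val_injective |>.injOn
    let T : LieSubmodule K S.b F := ⨆ α ∈ hfin.toFinset, N α
    have hTm : T.toSubmodule = hfin.toFinset.sup fun α => (N α).toSubmodule := by
      rw [Finset.sup_eq_iSup]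
      simp only [T, LieSubmodule.iSup_toSubmodule]
    have hTN : ∀ α ∈ hfin.toFinset, N α ≤ T := fun α hα => le_iSup₂ (f := fun α _ => N α) α hα
    have hTfd : FiniteDimensional K T.toSubmodule := by
      rw [hTm]
      have := fun α => (hfd α : FiniteDimensional K (N α).toSubmodule)
      exact Submodule.finiteDimensional_finset_sup _ _
    have hstab : ∀ y : S.b, ⁅y, f⁆ ∈ Submodule.span K {f} ⊔ T.toSubmodule := by
      refine S.b_induction (T := (Submodule.span K {f} ⊔ T.toSubmodule).comap
        ((LieModule.toEnd K S.b F : S.b →ₗ[K] Module.End K F).flip f)) (fun H => ?_)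
        (fun α hα x hx => ?_)
      · refine le_sup_left (a := Submodule.span K {f}) ?_
        have : ⁅(⟨H, S.h_le_b H.2⟩ : S.b), f⁆ = χ H • f := mem_wt.1 hf H
        change ⁅(⟨H, S.h_le_b H.2⟩ : S.b), f⁆ ∈ _
        rw [this]
        exact Submodule.smul_mem _ _ (Submodule.mem_span_singleton_self f)
      · refine le_sup_right (a := Submodule.span K {f}) ?_
        change ⁅(⟨x, S.rootSp_le_b hα hx⟩ : S.b), f⁆ ∈ T
        by_cases hχα : χ + α ∈ D
        · exact hTN ⟨α, hα⟩ (by simpa using hχα) (hN ⟨α, hα⟩ x hx)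
        · rw [eq_zero_of_mem_wt_of_mem_wtSum hχα (S.lie_mem_wt_b hx hf) (hF _)]
          exact zero_mem _
    refine ⟨{ toSubmodule := Submodule.span K {f} ⊔ T.toSubmodule, lie_mem := ?_ }, ?_, ?_⟩
    · intro y m hm
      obtain ⟨a, ha, t, ht, rfl⟩ := Submodule.mem_sup.1 hm
      obtain ⟨c, rfl⟩ := Submodule.mem_span_singleton.1 ha
      rw [lie_add, lie_smul]
      exact Submodule.add_mem _ (Submodule.smul_mem _ _ (hstab y))
        (le_sup_right (a := Submodule.span K {f}) (T.lie_mem ht))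
    · exact le_sup_left (a := Submodule.span K {f}) (Submodule.mem_span_singleton_self f)
    · change FiniteDimensional K ((Submodule.span K {f} ⊔ T.toSubmodule : Submodule K F))
      infer_instance
  intro f
  obtain ⟨s, v, hs, hv, rfl⟩ := exists_sum_of_mem_wtSum (hF f)
  clear hF
  induction s using Finset.induction_on with
  | empty => exact ⟨⊥, zero_mem _, inferInstanceAs (FiniteDimensional K (⊥ : Submodule K F))⟩
  | insert χ s h0 ih =>
    rw [Finset.sum_insert h0]
    exact S.locFin_add (key _ χ rfl (hs (Finset.mem_insert_self _ _)) _ (hv χ))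
      (ih fun χ hχ => hs (Finset.mem_insert_of_mem hχ))

/-- The lower set generated by a set of weights. -/
def lowerSet (E : Set (Module.Dual K S.h)) : Set (Module.Dual K S.h) :=
  {μ | ∃ lam ∈ E, S.wle μ lam}

theorem lowerSet_isIdeal (E : Set (Module.Dual K S.h)) : S.IsIdeal (S.lowerSet E) := by
  rintro lam ⟨ν, hν, h⟩ μ hμ
  exact ⟨ν, hν, hμ.trans h⟩

variable {S} in
theorem IsIdeal.sub_mem {D : Set (Module.Dual K S.h)} (hD : S.IsIdeal D) :
    ∀ α ∈ S.Φp, ∀ χ ∈ D, χ - α ∈ D := fun α hα χ hχ => hD χ hχ _ <| by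
  rw [wle, sub_sub_cancel]; exact AddSubmonoid.subset_closure hα

theorem lowerSet_upperFinite
    (hInt : ∀ μ lam : Module.Dual K S.h, {ν | S.wle μ ν ∧ S.wle ν lam}.Finite)
    {E : Set (Module.Dual K S.h)} (hE : E.Finite) : S.UpperFinite (S.lowerSet E) := by
  intro μ _
  refine (hE.biUnion fun lam _ => hInt μ lam).subset ?_
  rintro ν ⟨⟨lam, hlam, h1⟩, h2⟩
  exact Set.mem_biUnion hlam ⟨h2, h1⟩

theorem exists_finite_wtIn [FiniteDimensional K F] {D : Set (Module.Dual K S.h)}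
    (hF : S.WtIn F D) : ∃ E : Set (Module.Dual K S.h), E.Finite ∧ E ⊆ D ∧ S.WtIn F E := by
  have hfin := WellFoundedGT.finite_ne_bot_of_iSupIndep (iSupIndep_wt (S.rb F))
  refine ⟨D ∩ {χ | wt (S.rb F) χ ≠ ⊥}, hfin.inter_of_right D, Set.inter_subset_left, fun f => ?_⟩
  obtain ⟨s, v, hs, hv, rfl⟩ := exists_sum_of_mem_wtSum (hF f)
  refine Submodule.sum_mem _ fun χ hχ => ?_
  by_cases h0 : v χ = 0
  · rw [h0]; exact zero_mem _
  · refine wt_le_wtSum (D := D ∩ {χ | wt (S.rb F) χ ≠ ⊥}) ⟨hs hχ, fun hbot => h0 ?_⟩ (hv χ)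
    have := hv χ
    rwa [hbot] at this

theorem exists_mem_range_ind (hF : S.LF F) (m : S.Ind F) : ∃ N : LieSubmodule K S.b F,
    FiniteDimensional K N ∧ ∃ m', S.indMap N.incl m' = m := by
  refine S.ind_induction' (p := fun m => ∃ N : LieSubmodule K S.b F,
    FiniteDimensional K N ∧ ∃ m', S.indMap N.incl m' = m) (fun u f => ?_) ?_ m
  · obtain ⟨N, hN, hfd⟩ := hF f
    refine ⟨N, hfd, S.itmul u ⟨f, hN⟩, ?_⟩
    rw [indMap_eq]; rfl
  · rintro a b ⟨N, hfd, a', rfl⟩ ⟨N', hfd', b', rfl⟩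
    refine ⟨N ⊔ N', ?_, S.indMap (LieSubmodule.inclusion le_sup_left) a' +
      S.indMap (LieSubmodule.inclusion le_sup_right) b', ?_⟩
    · change FiniteDimensional K (N ⊔ N').toSubmodule
      rw [LieSubmodule.sup_toSubmodule]
      have : FiniteDimensional K N.toSubmodule := hfd
      have : FiniteDimensional K N'.toSubmodule := hfd'
      infer_instance
    · rw [map_add]
      congr 1
      · exact LinearMap.congr_fun (S.ind_hom_ext (φ := S.indMap (N ⊔ N').incl ∘ₗ
          S.indMap (LieSubmodule.inclusion le_sup_left)) (ψ := S.indMap N.incl) fun f => by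
            simp only [LinearMap.comp_apply, indMap_iunit]; rfl) a'
      · exact LinearMap.congr_fun (S.ind_hom_ext (φ := S.indMap (N ⊔ N').incl ∘ₗ
          S.indMap (LieSubmodule.inclusion le_sup_right)) (ψ := S.indMap N'.incl) fun f => by
            simp only [LinearMap.comp_apply, indMap_iunit]; rfl) b'

theorem lf_ind (hp : S.Pointed)
    (hInt : ∀ μ lam : Module.Dual K S.h, {ν | S.wle μ ν ∧ S.wle ν lam}.Finite)
    (hF : S.LF F) (hw : S.WtIn F Set.univ) : S.LF (Res K g (S.Ind F)) := by
  intro m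
  obtain ⟨N, hfd, m', rfl⟩ := S.exists_mem_range_ind hF m
  refine S.locFin_map (S.resb (S.indMap N.incl)) (f := m') ?_
  obtain ⟨E, hE, -, hNE⟩ := S.exists_finite_wtIn (hw.of_injective N.incl Subtype.val_injective)
  refine S.lf_of_upperFinite (F := Res K g (S.Ind N)) hp (S.lowerSet_upperFinite hInt hE) ?_ m'
  exact S.ind_wtIn (S.lowerSet_isIdeal E).sub_mem
    (hNE.mono fun χ hχ => ⟨χ, hχ, wle_refl χ⟩)

end LocallyFinite

end RootReductive


namespace RootReductive

section Bad

variable {S : RootReductive K g} {D : Set (Module.Dual K S.h)}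

/-- A set of weights stable under addition of positive roots. -/
def UpSet (S : RootReductive K g) (D : Set (Module.Dual K S.h)) : Prop :=
  ∀ α ∈ insert 0 S.Φp, ∀ χ ∈ D, χ + α ∈ D

theorem IsIdeal.upSet_compl {Kset : Set (Module.Dual K S.h)} (hK : S.IsIdeal Kset) :
    S.UpSet Ksetᶜ := by
  rintro α (rfl | hα) χ hχ
  · rwa [add_zero]
  · exact fun h => hχ (by simpa using hK.sub_mem α hα _ h)

variable (hD : S.UpSet D) (F : Type) {F' F'' : Type} [AddCommGroup F] [Module K F]
  [LieRingModule S.b F] [LieModule K S.b F] [AddCommGroup F'] [Module K F']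
  [LieRingModule S.b F'] [LieModule K S.b F'] [AddCommGroup F''] [Module K F'']
  [LieRingModule S.b F''] [LieModule K S.b F'']

/-- The largest `b`-submodule generated by weight vectors with weights in `D`. -/
def bad : LieSubmodule K S.b F where
  toSubmodule := wtSum (S.rb F) D
  lie_mem {y _} hf := S.lie_mem_wtSum_b hD y hf

variable {F}

theorem hom_mem_wt (φ : F →ₗ⁅K, S.b⁆ F') {χ : Module.Dual K S.h} {f : F}
    (hf : f ∈ wt (S.rb F) χ) : φ f ∈ wt (S.rb F') χ :=
  wt_map (f := (φ : F →ₗ[K] F')) (S.hom_rb φ) hf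

/-- Functoriality of `bad`. -/
def badMap (φ : F →ₗ⁅K, S.b⁆ F') : bad hD F →ₗ⁅K, S.b⁆ bad hD F' where
  toFun f := ⟨φ f, S.hom_mem_wtSum φ f.2⟩
  map_add' a b := Subtype.ext (φ.map_add a b)
  map_smul' c a := Subtype.ext (φ.map_smul c a)
  map_lie' {y a} := Subtype.ext (φ.map_lie y a)

theorem wtIn_bad (F : Type) [AddCommGroup F] [Module K F]
    [LieRingModule S.b F] [LieModule K S.b F] : S.WtIn (bad hD F) D := fun f =>
  S.mem_wtSum_of_injective (bad hD F).incl Subtype.val_injective f.2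

theorem badMap_injective {φ : F →ₗ⁅K, S.b⁆ F'} (h : Function.Injective φ) :
    Function.Injective (badMap hD φ) := fun _ _ hxy =>
  Subtype.ext (h (congrArg Subtype.val hxy))

theorem exists_hom_wt_lift {φ : F →ₗ⁅K, S.b⁆ F'} (h : Function.Surjective φ)
    (hF : S.WtIn F Set.univ) {χ : Module.Dual K S.h} {f' : F'} (hf' : f' ∈ wt (S.rb F') χ) :
    ∃ f ∈ wt (S.rb F) χ, φ f = f' := by
  obtain ⟨f, rfl⟩ := h f'
  exact exists_wt_lift (f := (φ : F →ₗ[K] F')) (S.hom_rb φ) (hF f) hf'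

theorem badMap_surjective {φ : F →ₗ⁅K, S.b⁆ F'} (h : Function.Surjective φ)
    (hF : S.WtIn F Set.univ) : Function.Surjective (badMap hD φ) := by
  rintro ⟨f', hf'⟩
  have : wtSum (S.rb F') D ≤ (wtSum (S.rb F) D).map (φ : F →ₗ[K] F') := by
    refine wtSum_le.2 fun χ hχ f' hf' => ?_
    obtain ⟨f, hf, rfl⟩ := exists_hom_wt_lift h hF hf'
    exact ⟨f, wt_le_wtSum hχ hf, rfl⟩
  obtain ⟨f, hf, rfl⟩ := this hf'
  exact ⟨⟨f, hf⟩, rfl⟩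

theorem badMap_exact {φ : F →ₗ⁅K, S.b⁆ F'} {ψ : F' →ₗ⁅K, S.b⁆ F''} (hφ : Function.Injective φ)
    (h : Function.Exact φ ψ) : Function.Exact (badMap hD φ) (badMap hD ψ) := by
  rintro ⟨f', hf'⟩
  constructor
  · intro h0
    obtain ⟨f, rfl⟩ := (h f').1 (congrArg Subtype.val h0)
    exact ⟨⟨f, S.mem_wtSum_of_injective φ hφ hf'⟩, rfl⟩
  · rintro ⟨f, hf⟩
    exact Subtype.ext ((h f').2 ⟨f, congrArg Subtype.val hf⟩)

/-- The module induced from the bad vectors. -/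
abbrev sInd (M : ModuleCat.{0} (UEA K g)) : ModuleCat.{0} (UEA K g) :=
  ModuleCat.of (UEA K g) (S.Ind (bad hD (Res K g M)))

/-- The canonical map from the module induced from the bad vectors. -/
def ε (M : ModuleCat.{0} (UEA K g)) : sInd hD M →ₗ[UEA K g] M :=
  S.indLift (bad hD (Res K g M)).incl

theorem ε_iunit (M : ModuleCat.{0} (UEA K g)) (f : bad hD (Res K g M)) :
    ε hD M (S.iunit f) = (f : Res K g M) := S.indLift_iunit _ f

/-- Functoriality of `sInd`. -/
def sMap {M N : ModuleCat.{0} (UEA K g)} (f : M →ₗ[UEA K g] N) :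
    sInd hD M →ₗ[UEA K g] sInd hD N := S.indMap (badMap hD (S.resb f))

theorem ε_sMap {M N : ModuleCat.{0} (UEA K g)} (f : M →ₗ[UEA K g] N) (s : sInd hD M) :
    ε hD N (sMap hD f s) = f (ε hD M s) :=
  LinearMap.congr_fun (S.ind_hom_ext (φ := ε hD N ∘ₗ sMap hD f) (ψ := f ∘ₗ ε hD M) fun s => by
    change ε hD N (S.indMap (badMap hD (S.resb f)) (S.iunit s)) = f (ε hD M (S.iunit s))
    rw [indMap_iunit, ε_iunit, ε_iunit]; rfl) s

/-- The submodule generated by the bad vectors. -/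
def badSpan (M : ModuleCat.{0} (UEA K g)) : Submodule (UEA K g) M := LinearMap.range (ε hD M)

theorem badSpan_le {M : ModuleCat.{0} (UEA K g)} {L : Submodule (UEA K g) M}
    (h : ∀ χ ∈ D, ∀ m : Res K g M, m ∈ wt (S.rb (Res K g M)) χ → (show M from m) ∈ L) :
    badSpan hD M ≤ L := by
  have hL : ∀ m : Res K g M, m ∈ wtSum (S.rb (Res K g M)) D → (show M from m) ∈ L := by
    intro m hm
    obtain ⟨s, f, hs, hf, rfl⟩ := exists_sum_of_mem_wtSum hm
    exact Submodule.sum_mem L fun χ hχ => h χ (hs hχ) _ (hf χ)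
  rintro _ ⟨s, rfl⟩
  have := S.ind_span (L.comap (ε hD M)) fun f => by
    change ε hD M (S.iunit f) ∈ L
    rw [ε_iunit]
    exact hL f f.2
  exact (this ▸ trivial : s ∈ L.comap (ε hD M))

theorem mem_badSpan {M : ModuleCat.{0} (UEA K g)} {m : Res K g M}
    (h : m ∈ wtSum (S.rb (Res K g M)) D) : (show M from m) ∈ badSpan hD M :=
  ⟨S.iunit ⟨m, h⟩, ε_iunit hD M ⟨m, h⟩⟩

theorem iunit_mem_badSpan {f : F} (hf : f ∈ bad hD F) :
    (S.iunit f : S.Ind F) ∈ badSpan hD (ModuleCat.of (UEA K g) (S.Ind F)) := by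
  have h : S.iunitHom f ∈ wtSum (S.rb (Res K g (S.Ind F))) D := S.hom_mem_wtSum S.iunitHom hf
  exact mem_badSpan hD (M := ModuleCat.of (UEA K g) (S.Ind F)) h

/-- The kernel of `ε`. -/
abbrev κ (M : ModuleCat.{0} (UEA K g)) : ModuleCat.{0} (UEA K g) :=
  ModuleCat.of (UEA K g) (LinearMap.ker (ε hD M))

/-- The module has an `n`-step partial resolution by modules induced from bad vectors. -/
def BadRes : ℕ → ModuleCat.{0} (UEA K g) → Prop
  | 0, _ => True
  | n + 1, M => badSpan hD M = ⊤ ∧ BadRes n (κ hD M)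

theorem subsingleton_ind [Subsingleton F] : Subsingleton (S.Ind F) := by
  refine ⟨fun a b => ?_⟩
  have : ∀ c : S.Ind F, c = 0 := S.ind_induction (p := fun c => c = 0)
    (fun f => by rw [Subsingleton.elim f 0, map_zero]) (fun x m h => by rw [h, map_zero])
    (fun a b ha hb => by rw [ha, hb, add_zero]) (fun c a ha => by rw [ha, smul_zero])
  rw [this a, this b]

theorem badRes_of_subsingleton : ∀ (n : ℕ) (M : ModuleCat.{0} (UEA K g)) [Subsingleton M],
    BadRes hD n M
  | 0, _, _ => trivial
  | n + 1, M, hM => by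
    have h1 : Subsingleton (Res K g M) := hM
    have h2 : Subsingleton (bad hD (Res K g M)) := ⟨fun a b => Subtype.ext (Subsingleton.elim _ _)⟩
    have h3 : Subsingleton (S.Ind (bad hD (Res K g M))) := subsingleton_ind
    have h4 : Subsingleton (κ hD M) := ⟨fun a b => Subtype.ext (Subsingleton.elim _ _)⟩
    exact ⟨Subsingleton.elim _ _, badRes_of_subsingleton n (κ hD M)⟩

section Exact

variable {Z X : ModuleCat.{0} (UEA K g)} {E : SES Z X}

theorem SESexact (h : E.IsEx) : Function.Exact E.i E.p := fun m =>
  ⟨fun hm => h.ex m hm, by rintro ⟨z, rfl⟩; exact E.zero z⟩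

theorem sMap_exact (h : E.IsEx) (hM : S.WtIn (Res K g E.M) Set.univ) :
    Function.Exact (sMap hD E.i) (sMap hD E.p) :=
  S.indMap_exact (badMap_exact hD (φ := S.resb E.i) (ψ := S.resb E.p) h.inj (SESexact h))
    (badMap_surjective hD (φ := S.resb E.p) h.surj hM)

theorem sMap_injective (h : E.IsEx) : Function.Injective (sMap hD E.i) :=
  S.indMap_injective (badMap_injective hD (φ := S.resb E.i) h.inj)

theorem sMap_surjective (h : E.IsEx) (hM : S.WtIn (Res K g E.M) Set.univ) :
    Function.Surjective (sMap hD E.p) :=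
  S.indMap_surjective (badMap_surjective hD (φ := S.resb E.p) h.surj hM)

theorem wtIn_sInd_univ {M : ModuleCat.{0} (UEA K g)} :
    S.WtIn (Res K g (sInd hD M)) Set.univ :=
  S.ind_wtIn (fun _ _ _ _ => trivial) ((wtIn_bad hD _).mono (Set.subset_univ _))

theorem wtIn_κ {M : ModuleCat.{0} (UEA K g)} :
    S.WtIn (Res K g (κ hD M)) Set.univ :=
  (wtIn_sInd_univ hD (M := M)).of_injective (S.resb (LinearMap.ker (ε hD M)).subtype)
    Subtype.val_injective

theorem badSpan_inter (h : E.IsEx) (hM : S.WtIn (Res K g E.M) Set.univ)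
    (hX : badSpan hD (κ hD X) = ⊤) : (badSpan hD E.M).comap E.i ≤ badSpan hD Z := by
  let L : Submodule (UEA K g) (κ hD X) :=
    { carrier := {k | ∃ s : sInd hD E.M, ∃ w ∈ badSpan hD Z, sMap hD E.p s = k.1 ∧
        ε hD E.M s = E.i w}
      zero_mem' := ⟨0, 0, zero_mem _, by simp, by simp⟩
      add_mem' := by
        rintro a b ⟨s, w, hw, h1, h2⟩ ⟨s', w', hw', h1', h2'⟩
        exact ⟨s + s', w + w', add_mem hw hw', by rw [map_add, h1, h1']; rfl,
          by rw [map_add, map_add, h2, h2']⟩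
      smul_mem' := by
        rintro u a ⟨s, w, hw, h1, h2⟩
        exact ⟨u • s, u • w, Submodule.smul_mem _ _ hw, by rw [map_smul, h1]; rfl,
          by rw [map_smul, map_smul, h2]⟩ }
  have hL : L = ⊤ := by
    rw [eq_top_iff, ← hX]
    refine badSpan_le hD fun χ hχ k hk => ?_
    let incl : Res K g (κ hD X) →ₗ⁅K, S.b⁆ Res K g (sInd hD X) :=
      S.resb (LinearMap.ker (ε hD X)).subtype
    have hk' : incl k ∈ wt (S.rb (Res K g (sInd hD X))) χ :=
      hom_mem_wt incl hk
    obtain ⟨s, hs, hsk⟩ := exists_hom_wt_lift (φ := S.resb (sMap hD E.p))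
      (sMap_surjective hD h hM) (wtIn_sInd_univ hD) hk'
    have h1 : E.p (ε hD E.M s) = 0 :=
       (ε_sMap hD E.p s).symm.trans ((congrArg (ε hD X) hsk).trans k.2)
    obtain ⟨w, hw⟩ := h.ex _ h1
    refine ⟨s, w, mem_badSpan hD (S.mem_wtSum_of_injective (S.resb E.i) h.inj ?_), hsk, hw.symm⟩
    have h2 := hom_mem_wt (S.resb (ε hD E.M)) hs
    have h3 : S.resb E.i w = S.resb (ε hD E.M) s := hw
    rw [h3]
    exact wt_le_wtSum hχ h2
  rintro z ⟨s, hs⟩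
  have h0 : ε hD X (sMap hD E.p s) = 0 := by rw [ε_sMap, hs, E.zero]
  obtain ⟨s', w, hw, h1, h2⟩ := (hL ▸ trivial : (⟨sMap hD E.p s, h0⟩ : κ hD X) ∈ L)
  have h3 : sMap hD E.p (s - s') = 0 := by rw [map_sub, h1]; exact sub_self _
  obtain ⟨t, ht⟩ := (sMap_exact hD h hM _).1 h3
  have h4 : z = w + ε hD Z t := h.inj (by
    rw [map_add, ← ε_sMap, ht, map_sub, h2, hs]; abel)
  rw [h4]
  exact add_mem hw ⟨t, rfl⟩

/-- The map between kernels. -/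
def κMap {M N : ModuleCat.{0} (UEA K g)} (f : M →ₗ[UEA K g] N) : κ hD M →ₗ[UEA K g] κ hD N :=
  (sMap hD f).restrict fun s hs => by
    rw [LinearMap.mem_ker] at hs ⊢
    rw [ε_sMap, hs, map_zero]

/-- The complex of kernels. -/
def κSES (h : E.IsEx) (hM : S.WtIn (Res K g E.M) Set.univ) : SES (κ hD Z) (κ hD X) where
  M := κ hD E.M
  i := κMap hD E.i
  p := κMap hD E.p
  zero z := Subtype.ext ((sMap_exact hD h hM _).2 ⟨z.1, rfl⟩)

theorem κSES_isEx (h : E.IsEx) (hM : S.WtIn (Res K g E.M) Set.univ)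
    (hX : badSpan hD (κ hD X) = ⊤) : (κSES hD h hM).IsEx where
  inj a b hab := Subtype.ext (sMap_injective hD h (congrArg Subtype.val hab))
  surj k := by
    obtain ⟨s, hs⟩ := sMap_surjective hD h hM k.1
    have h1 : E.p (ε hD E.M s) = 0 := by rw [← ε_sMap, hs]; exact k.2
    obtain ⟨z, hz⟩ := h.ex _ h1
    obtain ⟨t, rfl⟩ := badSpan_inter hD h hM hX (x := z) ⟨s, hz.symm⟩
    refine ⟨⟨s - sMap hD E.i t, ?_⟩, Subtype.ext ?_⟩
    · rw [LinearMap.mem_ker, map_sub, ε_sMap, hz, sub_self]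
    · change sMap hD E.p (s - sMap hD E.i t) = k.1
      rw [map_sub, hs, (sMap_exact hD h hM _).2 ⟨t, rfl⟩, sub_zero]
  ex k hk := by
    obtain ⟨t, ht⟩ := (sMap_exact hD h hM k.1).1 (congrArg Subtype.val hk)
    refine ⟨⟨t, ?_⟩, Subtype.ext ht⟩
    rw [LinearMap.mem_ker]
    refine h.inj ?_
    rw [← ε_sMap, ht, map_zero]
    exact k.2

end Exact

theorem badRes_ker : ∀ (n : ℕ) {Z X : ModuleCat.{0} (UEA K g)} (E : SES Z X), E.IsEx →
    S.WtIn (Res K g E.M) Set.univ → BadRes hD n E.M → BadRes hD (n + 1) X → BadRes hD n Z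
  | 0, _, _, _, _, _, _, _ => trivial
  | n + 1, Z, X, E, h, hM, hB, hX => by
    refine ⟨eq_top_iff.2 fun z _ => badSpan_inter hD h hM hX.2.1 ?_,
      badRes_ker n (κSES hD h hM) (κSES_isEx hD h hM hX.2.1) (wtIn_κ hD) hB.2 hX.2⟩
    change E.i z ∈ badSpan hD E.M
    rw [hB.1]; trivial

theorem BadRes.of_equiv {n : ℕ} {B B' : ModuleCat.{0} (UEA K g)} (e : B ≃ₗ[UEA K g] B')
    (hB' : S.WtIn (Res K g B') Set.univ) (h : BadRes hD n B') : BadRes hD n B :=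
  badRes_ker hD n (X := ModuleCat.of (UEA K g) PUnit)
    { M := B', i := e.toLinearMap, p := 0, zero := fun _ => rfl }
    ⟨e.injective, fun _ => ⟨0, rfl⟩, fun m _ => ⟨e.symm m, e.apply_symm_apply m⟩⟩ hB' h
    (badRes_of_subsingleton hD _ _)

theorem badRes_ind : ∀ (n : ℕ) (F : Type) [AddCommGroup F] [Module K F] [LieRingModule S.b F]
    [LieModule K S.b F], S.WtIn F D → BadRes hD n (ModuleCat.of (UEA K g) (S.Ind F))
  | 0, _, _, _, _, _, _ => trivial
  | n + 1, F, _, _, _, _, hF => by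
    let N := ModuleCat.of (UEA K g) (S.Ind F)
    have hmem : ∀ f : F, S.iunitHom f ∈ bad hD (Res K g N) := fun f =>
      S.hom_mem_wtSum S.iunitHom (hF f)
    let j : F →ₗ⁅K, S.b⁆ bad hD (Res K g N) :=
      { toFun := fun f => ⟨S.iunitHom f, hmem f⟩
        map_add' := fun a b => Subtype.ext (S.iunitHom.map_add a b)
        map_smul' := fun c a => Subtype.ext (S.iunitHom.map_smul c a)
        map_lie' := fun {y a} => Subtype.ext (S.iunitHom.map_lie y a) }
    let q : bad hD (Res K g N) →ₗ⁅K, S.b⁆ (bad hD (Res K g N) ⧸ j.range) :=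
      LieSubmodule.Quotient.mk' j.range
    have hq : Function.Surjective q := LieSubmodule.Quotient.surjective_mk' _
    have hex : Function.Exact j q := fun f => by
      rw [← LieModuleHom.mem_ker, LieSubmodule.Quotient.mk'_ker]
      exact LieModuleHom.mem_range _ _
    have hεj : ∀ m : S.Ind F, ε hD N (S.indMap j m) = m := fun m =>
      LinearMap.congr_fun (S.ind_hom_ext (φ := ε hD N ∘ₗ S.indMap j) (ψ := LinearMap.id)
        fun f => by
          change ε hD N (S.indMap j (S.iunit f)) = S.iunit f
          rw [indMap_iunit, ε_iunit]; rfl) m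
    refine ⟨?_, ?_⟩
    · exact S.ind_span _ fun f => mem_badSpan hD (hmem f)
    · let φ : κ hD N →ₗ[UEA K g] S.Ind (bad hD (Res K g N) ⧸ j.range) :=
        S.indMap q ∘ₗ (LinearMap.ker (ε hD N)).subtype
      have hφ : Function.Bijective φ := by
        constructor
        · refine (injective_iff_map_eq_zero φ).2 fun k hk => Subtype.ext ?_
          obtain ⟨t, ht⟩ := (S.indMap_exact hex hq k.1).1 hk
          have h1 : t = 0 := by rw [← hεj t, ht]; exact k.2
          rw [← ht, h1, map_zero]; rfl
        · intro x
          obtain ⟨s, rfl⟩ := S.indMap_surjective hq x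
          refine ⟨⟨s - S.indMap j (ε hD N s), ?_⟩, ?_⟩
          · rw [LinearMap.mem_ker, map_sub, hεj, sub_self]
          · change S.indMap q (s - S.indMap j (ε hD N s)) = _
            rw [map_sub, (S.indMap_exact hex hq _).2 ⟨_, rfl⟩, sub_zero]
      have hw : S.WtIn (bad hD (Res K g N) ⧸ j.range) D := (wtIn_bad hD _).of_surjective q hq
      exact BadRes.of_equiv hD (B' := ModuleCat.of (UEA K g) (S.Ind (bad hD (Res K g N) ⧸ j.range)))
        (LinearEquiv.ofBijective φ hφ)
        (S.ind_wtIn (fun _ _ _ _ => trivial) (hw.mono (Set.subset_univ _))) (badRes_ind n _ hw)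

theorem badRes_κ_ind {Kset : Set (Module.Dual K S.h)} (hK : S.IsIdeal Kset) (n : ℕ)
    (hF : S.WtIn F Set.univ) :
    BadRes hK.upSet_compl n (κ hK.upSet_compl (ModuleCat.of (UEA K g) (S.Ind F))) := by
  have hD := hK.upSet_compl
  let N := ModuleCat.of (UEA K g) (S.Ind F)
  let q : F →ₗ⁅K, S.b⁆ (F ⧸ bad hD F) := LieSubmodule.Quotient.mk' (bad hD F)
  have hq : Function.Surjective q := LieSubmodule.Quotient.surjective_mk' _
  have hex : Function.Exact (bad hD F).incl q := fun f => by
    rw [← LieModuleHom.mem_ker, LieSubmodule.Quotient.mk'_ker]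
    exact ⟨fun h => ⟨⟨f, h⟩, rfl⟩, by rintro ⟨f, rfl⟩; exact f.2⟩
  have hwq : S.WtIn (F ⧸ bad hD F) Kset := by
    intro x
    obtain ⟨f, rfl⟩ := hq x
    have h1 : f ∈ wtSum (S.rb F) Kset ⊔ wtSum (S.rb F) Ksetᶜ := by
      rw [← wtSum_union, Set.union_compl_self]; exact hF f
    obtain ⟨a, ha, c, hc, rfl⟩ := Submodule.mem_sup.1 h1
    rw [map_add, (hex c).2 ⟨⟨c, hc⟩, rfl⟩, add_zero]
    exact S.hom_mem_wtSum q ha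
  have hrange : badSpan hD N = LinearMap.range (S.indMap (bad hD F).incl) := by
    refine le_antisymm (badSpan_le hD fun χ hχ m hm => ?_) ?_
    · refine (S.indMap_exact hex hq m).1 ?_
      have h1 : S.resb (S.indMap q) m ∈ wt (S.rb (Res K g (S.Ind (F ⧸ bad hD F)))) χ :=
        hom_mem_wt (S.resb (S.indMap q)) hm
      have h2 : S.resb (S.indMap q) m ∈ wtSum (S.rb (Res K g (S.Ind (F ⧸ bad hD F)))) Kset :=
        S.ind_wtIn hK.sub_mem hwq _
      have h3 := eq_zero_of_mem_wt_of_mem_wtSum hχ h1 h2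
      exact h3
    · rintro _ ⟨x, rfl⟩
      have hf : ∀ f : bad hD F, S.indMap (bad hD F).incl (S.iunit f) ∈
          (badSpan hD N : Submodule (UEA K g) (S.Ind F)) := fun f => by
        have h1 := S.indMap_iunit (bad hD F).incl f
        exact h1 ▸ iunit_mem_badSpan hD f.2
      have := S.ind_span
        ((badSpan hD N : Submodule (UEA K g) (S.Ind F)).comap (S.indMap (bad hD F).incl)) hf
      exact (this ▸ trivial : x ∈ (badSpan hD N : Submodule (UEA K g) (S.Ind F)).comap
        (S.indMap (bad hD F).incl))
  let e : badSpan hD N ≃ₗ[UEA K g] S.Ind (bad hD F) :=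
    (LinearEquiv.ofEq _ _ hrange).trans
      (LinearEquiv.ofInjective _ (S.indMap_injective (φ := (bad hD F).incl)
        Subtype.val_injective)).symm
  refine badRes_ker hD n (X := ModuleCat.of (UEA K g) (badSpan hD N))
    { M := sInd hD N, i := (LinearMap.ker (ε hD N)).subtype, p := (ε hD N).rangeRestrict,
      zero := fun z => Subtype.ext z.2 }
    ⟨Subtype.val_injective, LinearMap.surjective_rangeRestrict _,
      fun m hm => ⟨⟨m, congrArg Subtype.val hm⟩, rfl⟩⟩ (wtIn_sInd_univ hD)
      (badRes_ind hD n _ (wtIn_bad hD _)) ?_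
  exact BadRes.of_equiv hD (B' := ModuleCat.of (UEA K g) (S.Ind (bad hD F))) e
    (S.ind_wtIn (fun _ _ _ _ => trivial) ((wtIn_bad hD _).mono (Set.subset_univ _)))
    (badRes_ind hD _ _ (wtIn_bad hD _))

end Bad

end RootReductive


namespace RootReductive

section Truncation

variable {S : RootReductive K g} {Kset : Set (Module.Dual K S.h)}

theorem subQuot_wtIn (D : Set (Module.Dual K S.h)) :
    SubQuot fun M : ModuleCat.{0} (UEA K g) => S.WtIn (Res K g M) D where
  sub f hf h := h.of_injective (S.resb f) hf
  quot f hf h := h.of_surjective (S.resb f) hf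
  prod hM hN := S.wtIn_prod hM hN

theorem subQuot_lf : SubQuot fun M : ModuleCat.{0} (UEA K g) => S.LF (Res K g M) where
  sub f hf h := h.of_injective (S.resb f) hf
  quot f hf h := h.of_surjective (S.resb f) hf
  prod hM hN := S.lf_prod hM hN

theorem _root_.SubQuot.and {A : Type} [Ring A] {P Q : ModuleCat.{0} A → Prop} (hP : SubQuot P)
    (hQ : SubQuot Q) : SubQuot fun M => P M ∧ Q M where
  sub f hf h := ⟨hP.sub f hf h.1, hQ.sub f hf h.2⟩
  quot f hf h := ⟨hP.quot f hf h.1, hQ.quot f hf h.2⟩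
  prod hM hN := ⟨hP.prod hM.1 hN.1, hQ.prod hM.2 hN.2⟩

theorem isWeightMod_eq : (fun M : ModuleCat.{0} (UEA K g) => S.IsWeightMod M) =
    fun M : ModuleCat.{0} (UEA K g) => S.WtIn (Res K g M) Set.univ :=
  funext fun _ => propext S.isWeightMod_iff

theorem inO_eq : (fun M : ModuleCat.{0} (UEA K g) => S.InO M) =
    fun M : ModuleCat.{0} (UEA K g) => S.WtIn (Res K g M) Set.univ ∧ S.LF (Res K g M) :=
  funext fun _ => propext (and_congr S.isWeightMod_iff S.isLocFin_iff)

theorem inO_supp_iff (hne : Kset.Nonempty) (hId : S.IsIdeal Kset) (hUF : S.UpperFinite Kset)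
    (M : Type) [AddCommGroup M] [Module (UEA K g) M] :
    S.InO M ∧ S.suppSet M ⊆ Kset ↔ S.WtIn (Res K g M) Kset :=
  ⟨fun h => S.isWeightMod_supp_iff.1 ⟨h.1.1, h.2⟩, fun h =>
    ⟨⟨(S.isWeightMod_supp_iff.2 h).1, S.isLocFin_iff.2
      (S.lf_of_upperFinite (pointed_of hne hId hUF) hUF h)⟩, (S.isWeightMod_supp_iff.2 h).2⟩⟩

theorem inO_supp_eq (hne : Kset.Nonempty) (hId : S.IsIdeal Kset) (hUF : S.UpperFinite Kset) :
    (fun M : ModuleCat.{0} (UEA K g) => S.InO M ∧ S.suppSet M ⊆ Kset) =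
    fun M : ModuleCat.{0} (UEA K g) => S.WtIn (Res K g M) Kset :=
  funext fun M => propext (inO_supp_iff hne hId hUF M)

theorem wtIn_quot_badSpan (hId : S.IsIdeal Kset) {M : ModuleCat.{0} (UEA K g)}
    (hM : S.WtIn (Res K g M) Set.univ) :
    S.WtIn (Res K g (M ⧸ badSpan hId.upSet_compl M)) Kset := by
  intro x
  obtain ⟨m, rfl⟩ := Submodule.mkQ_surjective _ x
  have h1 : (show Res K g M from m) ∈
      wtSum (S.rb (Res K g M)) Kset ⊔ wtSum (S.rb (Res K g M)) Ksetᶜ := by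
    rw [← wtSum_union, Set.union_compl_self]; exact hM m
  obtain ⟨a, ha, c, hc, hac⟩ := Submodule.mem_sup.1 h1
  have h2 : (badSpan hId.upSet_compl M).mkQ m = (badSpan hId.upSet_compl M).mkQ (show M from a) := by
    refine (Submodule.Quotient.eq _).2 ?_
    have h3 : m - (show M from a) = (show M from c) := sub_eq_of_eq_add' hac.symm
    rw [h3]
    exact mem_badSpan _ hc
  rw [h2]
  exact S.hom_mem_wtSum (S.resb (badSpan hId.upSet_compl M).mkQ) ha

theorem subsingleton_bad (hId : S.IsIdeal Kset) {M : ModuleCat.{0} (UEA K g)}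
    (hM : S.WtIn (Res K g M) Kset) : Subsingleton (bad hId.upSet_compl (Res K g M)) :=
  subsingleton_of_forall_eq 0 fun f => Subtype.ext <| Submodule.disjoint_def.1
    (wtSum_disjoint (ρ := S.rb (Res K g M)) (disjoint_compl_right (a := Kset))) f.1 (hM f.1) f.2

/-- The truncation to weights in an ideal, with resolutions by induced modules. -/
def truncData (hId : S.IsIdeal Kset) : TruncData
    (fun M : ModuleCat.{0} (UEA K g) => S.WtIn (Res K g M) Kset)
    (fun M : ModuleCat.{0} (UEA K g) => S.WtIn (Res K g M) Set.univ) where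
  R := badSpan hId.upSet_compl
  R_map f := by
    rintro _ ⟨s, rfl⟩
    exact ⟨sMap hId.upSet_compl f s, ε_sMap _ f s⟩
  R_surj f hM hf := by
    rintro _ ⟨s, rfl⟩
    obtain ⟨s, rfl⟩ := S.indMap_surjective
      (badMap_surjective hId.upSet_compl (φ := S.resb f) hf hM) s
    exact ⟨_, ⟨s, rfl⟩, (ε_sMap hId.upSet_compl f s).symm⟩
  quot hM := wtIn_quot_badSpan hId hM
  R_bot {M} hM := by
    have := subsingleton_bad hId hM
    have h2 : Subsingleton (sInd hId.upSet_compl M) :=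
      subsingleton_ind (F := bad hId.upSet_compl (Res K g M))
    refine (Submodule.eq_bot_iff _).2 ?_
    rintro _ ⟨s, rfl⟩
    rw [Subsingleton.elim s 0, map_zero]
  T M := ModuleCat.of (UEA K g) (S.Ind (Res K g M))
  π M := S.indLift (LieModuleHom.id : Res K g M →ₗ⁅K, S.b⁆ Res K g M)
  π_surj M m := ⟨S.iunit (F := Res K g M) m,
    S.indLift_iunit (LieModuleHom.id : Res K g M →ₗ⁅K, S.b⁆ Res K g M) m⟩
  T_map {M N} f := ⟨S.indMap (S.resb f), LinearMap.congr_fun (S.ind_hom_ext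
    (φ := S.indLift (LieModuleHom.id : Res K g N →ₗ⁅K, S.b⁆ Res K g N) ∘ₗ S.indMap (S.resb f))
    (ψ := f ∘ₗ S.indLift (LieModuleHom.id : Res K g M →ₗ⁅K, S.b⁆ Res K g M)) fun s => by
      have h1 := S.indMap_iunit (S.resb f) s
      have h2 := S.indLift_iunit (LieModuleHom.id : Res K g N →ₗ⁅K, S.b⁆ Res K g N) (S.resb f s)
      have h3 := S.indLift_iunit (LieModuleHom.id : Res K g M →ₗ⁅K, S.b⁆ Res K g M) s
      exact (congrArg _ h1).trans (h2.trans (congrArg f h3).symm))⟩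
  Good M := ∀ n, BadRes hId.upSet_compl n (κ hId.upSet_compl M)
  good_T {M} hM n := badRes_κ_ind (F := Res K g M) hId n hM
  good_P {M} hM n := by
    have := subsingleton_bad hId hM
    have h2 : Subsingleton (sInd hId.upSet_compl M) :=
      subsingleton_ind (F := bad hId.upSet_compl (Res K g M))
    have h3 : Subsingleton (κ hId.upSet_compl M) := ⟨fun a b => Subtype.ext (Subsingleton.elim _ _)⟩
    exact badRes_of_subsingleton _ n _
  good_ker E h hM hEM hX n :=
    badRes_ker hId.upSet_compl n (κSES hId.upSet_compl h hM)
      (κSES_isEx hId.upSet_compl h hM (hX 1).1) (wtIn_κ _) (hEM n) (hX (n + 1))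
  good_inj E h hM hX := badSpan_inter hId.upSet_compl h hM (hX 1).1

theorem extFullPair_inO (hne : Kset.Nonempty) (hId : S.IsIdeal Kset) (hUF : S.UpperFinite Kset) :
    ExtFullPair (UEA K g) (fun M => S.InO M ∧ S.suppSet M ⊆ Kset) (fun M => S.InO M)
      (fun _ h => h.1) := by
  have h : ∀ (P Q : ModuleCat.{0} (UEA K g) → Prop) (hPQ : ∀ M, P M → Q M),
      P = (fun M : ModuleCat.{0} (UEA K g) => S.WtIn (Res K g M) Kset) →
      Q = (fun M : ModuleCat.{0} (UEA K g) =>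
        S.WtIn (Res K g M) Set.univ ∧ S.LF (Res K g M)) →
      ExtFullPair (UEA K g) P Q hPQ := by
    rintro P Q hPQ rfl rfl
    exact (truncData hId).bijective hPQ (fun M h => h.1) (subQuot_wtIn _)
      ((subQuot_wtIn _).and subQuot_lf) (subQuot_wtIn _)
      (fun M hM => S.ind_wtIn hId.sub_mem hM)
      (fun M hM => ⟨S.ind_wtIn (fun _ _ _ _ => trivial) hM.1,
        S.lf_ind (pointed_of hne hId hUF) (interval_finite hne hId hUF) hM.2 hM.1⟩)
      (fun M hM => S.ind_wtIn (fun _ _ _ _ => trivial) hM)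
  exact h _ _ _ (inO_supp_eq hne hId hUF) inO_eq

theorem extFullPair_isWeightMod (hne : Kset.Nonempty) (hId : S.IsIdeal Kset)
    (hUF : S.UpperFinite Kset) :
    ExtFullPair (UEA K g) (fun M => S.InO M ∧ S.suppSet M ⊆ Kset) (fun M => S.IsWeightMod M)
      (fun _ h => h.1.1) := by
  have h : ∀ (P Q : ModuleCat.{0} (UEA K g) → Prop) (hPQ : ∀ M, P M → Q M),
      P = (fun M : ModuleCat.{0} (UEA K g) => S.WtIn (Res K g M) Kset) →
      Q = (fun M : ModuleCat.{0} (UEA K g) => S.WtIn (Res K g M) Set.univ) →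
      ExtFullPair (UEA K g) P Q hPQ := by
    rintro P Q hPQ rfl rfl
    exact (truncData hId).bijective hPQ (fun M h => h) (subQuot_wtIn _)
      (subQuot_wtIn _) (subQuot_wtIn _)
      (fun M hM => S.ind_wtIn hId.sub_mem hM)
      (fun M hM => S.ind_wtIn (fun _ _ _ _ => trivial) hM)
      (fun M hM => S.ind_wtIn (fun _ _ _ _ => trivial) hM)
  exact h _ _ _ (inO_supp_eq hne hId hUF) isWeightMod_eq

end Truncation

end RootReductive

section Zero

variable {A : Type} [Ring A]

/-- The zero short complex ending in `X`, which is exact if `X = 0`. -/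
def SES.triv (X : ModuleCat.{0} A) : SES X X where
  M := X
  i := 0
  p := 0
  zero _ := rfl

theorem SES.triv_isEx (X : ModuleCat.{0} A) [Subsingleton X] : (SES.triv X).IsEx where
  inj _ _ _ := Subsingleton.elim _ _
  surj x := ⟨x, Subsingleton.elim _ _⟩
  ex _ _ := ⟨0, Subsingleton.elim (α := X) _ _⟩

/-- The zero complex. -/
def YE.triv (Y X : ModuleCat.{0} A) : ∀ n : ℕ, YE Y n X
  | 0 => ({ M := X, i := 0, p := 0, zero := fun _ => rfl } : SES Y X)
  | n + 1 => ⟨X, SES.triv X, YE.triv Y X n⟩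

theorem YE.triv_ok {P : ModuleCat.{0} A → Prop} {Y X : ModuleCat.{0} A} [Subsingleton X]
    [Subsingleton Y] (hX : P X) : ∀ n : ℕ, (YE.triv Y X n).Ok P
  | 0 => ⟨⟨fun _ _ _ => Subsingleton.elim _ _, fun x => ⟨x, Subsingleton.elim _ _⟩,
      fun _ _ => ⟨0, Subsingleton.elim (α := X) _ _⟩⟩, hX⟩
  | n + 1 => ⟨SES.triv_isEx X, hX, YE.triv_ok hX n⟩

theorem YE.triv_mor {Y X X' : ModuleCat.{0} A} [Subsingleton X] [Subsingleton Y] :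
    ∀ {n : ℕ} (E : YE Y n X') (φ : X →ₗ[A] X'), YE.Mor LinearMap.id (YE.triv Y X n) E φ
  | 0, E, φ => ⟨0, fun y => by
      have h : y = 0 := Subsingleton.elim _ _
      subst h
      exact (map_zero (SES.i E)).symm, fun x => by
      have h : SES.p (YE.triv Y X 0) x = 0 := Subsingleton.elim (α := X) _ _
      rw [h, map_zero]; exact map_zero _⟩
  | n + 1, E, φ => ⟨0, 0, fun y => (map_zero E.2.1.i).symm, fun x => by
      have h : (YE.triv Y X (n + 1)).2.1.p x = 0 := Subsingleton.elim (α := X) _ _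
      rw [h, map_zero]; exact map_zero _, YE.triv_mor (X := X) E.2.2 0⟩

theorem bijective_yextFamMap_of_subsingleton {P Q : ModuleCat.{0} A → Prop}
    (hPQ : ∀ M, P M → Q M) {X Y : ModuleCat.{0} A} (hX : P X) (hY : P Y) [Subsingleton X]
    [Subsingleton Y] (i : ℕ) : Function.Bijective (yextFamMap A hPQ (X := X) (Y := Y) i) :=
  bijective_yextFamMap hPQ hX hY
    (fun n E hE => ⟨_, YE.triv_ok hX n, (YE.Eqv.of_mor (YE.triv_ok (hPQ _ hX) n) hE
      (YE.triv_mor E _)).symm⟩)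
    (fun n E F hE hF _ => ((YE.Eqv.of_mor (YE.triv_ok hX n) hE (YE.triv_mor E _)).symm).trans _ _ _
      (YE.Eqv.of_mor (YE.triv_ok hX n) hF (YE.triv_mor F _))) i

end Zero

namespace RootReductive

theorem subsingleton_of_supp_empty {S : RootReductive K g} {M : Type} [AddCommGroup M]
    [Module (UEA K g) M] (h : S.IsWeightMod M) (hs : S.suppSet M ⊆ ∅) : Subsingleton M := by
  have h1 := S.isWeightMod_supp_iff.1 ⟨h, hs⟩
  refine subsingleton_of_forall_eq 0 fun m => ?_
  have h2 : (show Res K g M from m) ∈ wtSum (S.rb (Res K g M)) ∅ := h1 m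
  rw [wtSum, iSup_emptyset] at h2
  exact h2

end RootReductive


section Cover

variable {A : Type} [Ring A]

/-- The first term of a spliced complex. -/
def YE.top {Y : ModuleCat.{0} A} : ∀ {n : ℕ} {X : ModuleCat.{0} A}, YE Y n X → ModuleCat.{0} A
  | 0, _, E => SES.M E
  | _ + 1, _, E => E.2.1.M

/-- The augmentation of a spliced complex. -/
def YE.aug {Y : ModuleCat.{0} A} : ∀ {n : ℕ} {X : ModuleCat.{0} A} (E : YE Y n X), E.top →ₗ[A] X
  | 0, _, E => SES.p E
  | _ + 1, _, E => E.2.1.p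

theorem YE.Ok.top {Q : ModuleCat.{0} A → Prop} {Y : ModuleCat.{0} A} :
    ∀ {n : ℕ} {X : ModuleCat.{0} A} {E : YE Y n X}, E.Ok Q → Q E.top
  | 0, _, _, h => h.2
  | _ + 1, _, _, h => h.2.1

theorem YE.Ok.aug_surjective {Q : ModuleCat.{0} A → Prop} {Y : ModuleCat.{0} A} :
    ∀ {n : ℕ} {X : ModuleCat.{0} A} {E : YE Y n X}, E.Ok Q → Function.Surjective E.aug
  | 0, _, _, h => h.1.surj
  | _ + 1, _, _, h => h.1.surj

/-- `n`-step hereditary covering of `Q`-epimorphisms onto the module by `P`-objects. -/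
def Cov (P Q : ModuleCat.{0} A → Prop) : ℕ → ModuleCat.{0} A → Prop
  | 0, V => P V
  | n + 1, V => P V ∧ ∀ (M : ModuleCat.{0} A) (f : M →ₗ[A] V), Q M → Function.Surjective f →
      ∃ (H : ModuleCat.{0} A) (h : H →ₗ[A] M), P H ∧ Function.Surjective (f ∘ₗ h) ∧
        Cov P Q n (ModuleCat.of A (LinearMap.ker (f ∘ₗ h)))

variable {P Q : ModuleCat.{0} A → Prop}

theorem Cov.prop : ∀ {n : ℕ} {V : ModuleCat.{0} A}, Cov P Q n V → P V
  | 0, _, h => h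
  | _ + 1, _, h => h.1

/-- Closure under extensions in an ambient class. -/
def ExtClosed (P Q : ModuleCat.{0} A → Prop) : Prop :=
  ∀ {Z X : ModuleCat.{0} A} (E : SES Z X), E.IsEx → Q E.M → P Z → P X → P E.M

theorem Cov.extension (hPQ : ∀ M, P M → Q M) (hP : SubQuot P) (hQ : SubQuot Q)
    (hext : ExtClosed P Q) : ∀ {n : ℕ} {Z X : ModuleCat.{0} A} (E : SES Z X), E.IsEx → Q E.M →
      Cov P Q n Z → Cov P Q n X → Cov P Q n E.M
  | 0, _, _, E, h, hE, hZ, hX => hext E h hE hZ hX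
  | n + 1, Z, X, E, h, hE, hZ, hX => by
    refine ⟨hext E h hE hZ.1 hX.1, fun M f hM hf => ?_⟩
    obtain ⟨H₂, h₂, hH₂, hs₂, hc₂⟩ := hX.2 M (E.p ∘ₗ f) hM (h.surj.comp hf)
    let M₁ := LinearMap.eqLocus (f ∘ₗ LinearMap.fst A M Z) (E.i ∘ₗ LinearMap.snd A M Z)
    let f₁ : M₁ →ₗ[A] Z := LinearMap.snd A M Z ∘ₗ M₁.subtype
    have hM₁ : Q (ModuleCat.of A M₁) := hQ.sub (M := ModuleCat.of A (M × Z)) M₁.subtype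
      Subtype.val_injective (hQ.prod hM (hPQ _ hZ.1))
    have hf₁ : Function.Surjective f₁ := fun z => by
      obtain ⟨m, hm⟩ := hf (E.i z)
      exact ⟨⟨(m, z), hm⟩, rfl⟩
    obtain ⟨H₁, h₁, hH₁, hs₁, hc₁⟩ := hZ.2 (ModuleCat.of A M₁) f₁ hM₁ hf₁
    let k₁ : H₁ →ₗ[A] M := LinearMap.fst A M Z ∘ₗ M₁.subtype ∘ₗ h₁
    have hk₁ : ∀ x, f (k₁ x) = E.i (f₁ (h₁ x)) := fun x => (h₁ x).2
    let H := ModuleCat.of A (H₁ × H₂)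
    let k : H →ₗ[A] M := k₁.coprod h₂
    have hk : ∀ x : H, f (k x) = E.i (f₁ (h₁ x.1)) + f (h₂ x.2) := fun x => by
      change f (k₁ x.1 + h₂ x.2) = _
      rw [map_add, hk₁]
    have hH : P H := hP.prod hH₁ hH₂
    have key : ∀ (m : E.M) (x₂ : H₂), E.p (f (h₂ x₂)) = E.p m →
        ∃ x₁ : H₁, f (k (x₁, x₂)) = m := fun m x₂ hx => by
      obtain ⟨z, hz⟩ := h.ex (m - f (h₂ x₂)) (by rw [map_sub, hx, sub_self])
      obtain ⟨x₁, rfl⟩ := hs₁ z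
      exact ⟨x₁, by rw [hk]; exact (congrArg (· + _) hz).trans (sub_add_cancel _ _)⟩
    refine ⟨H, k, hH, fun m => ?_, ?_⟩
    · obtain ⟨x₂, hx₂⟩ := hs₂ (E.p m)
      obtain ⟨x₁, hx⟩ := key m x₂ hx₂
      exact ⟨(x₁, x₂), hx⟩
    · let N := LinearMap.ker (f ∘ₗ k)
      let i : LinearMap.ker (f₁ ∘ₗ h₁) →ₗ[A] N :=
        ((LinearMap.inl A H₁ H₂).restrict (p := LinearMap.ker (f₁ ∘ₗ h₁)) (q := N) fun x hx => by
          have hx' : f₁ (h₁ x) = 0 := hx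
          change f (k (x, 0)) = 0
          rw [hk, hx', map_zero, map_zero, map_zero, add_zero])
      let p : N →ₗ[A] LinearMap.ker ((E.p ∘ₗ f) ∘ₗ h₂) :=
        ((LinearMap.snd A H₁ H₂).restrict (p := N) (q := LinearMap.ker ((E.p ∘ₗ f) ∘ₗ h₂))
          fun x hx => by
            have hx' : f (k x) = 0 := hx
            rw [hk] at hx'
            change E.p (f (h₂ x.2)) = 0
            rw [eq_neg_of_add_eq_zero_right hx', map_neg, E.zero, neg_zero])
      refine Cov.extension hPQ hP hQ hext
        (Z := ModuleCat.of A (LinearMap.ker (f₁ ∘ₗ h₁)))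
        (X := ModuleCat.of A (LinearMap.ker ((E.p ∘ₗ f) ∘ₗ h₂)))
        { M := ModuleCat.of A N, i := i, p := p, zero := fun z => rfl } ⟨?_, ?_, ?_⟩
        (hPQ _ (hP.sub (M := H) N.subtype Subtype.val_injective hH)) hc₁ hc₂
      · intro a b hab
        exact Subtype.ext (congrArg (fun x : N => x.1.1) hab)
      · rintro ⟨x₂, hx₂⟩
        obtain ⟨x₁, hx⟩ := key 0 x₂ (by rw [map_zero]; exact hx₂)
        exact ⟨⟨(x₁, x₂), hx⟩, rfl⟩
      · rintro ⟨⟨x₁, x₂⟩, hx⟩ hx₂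
        obtain rfl : x₂ = 0 := congrArg Subtype.val hx₂
        have hx' : f (k (x₁, 0)) = 0 := hx
        rw [hk, map_zero, map_zero, add_zero] at hx'
        exact ⟨⟨x₁, h.inj (hx'.trans (map_zero _).symm)⟩, rfl⟩

theorem Cov.of_equiv (hP : SubQuot P) : ∀ {n : ℕ} {V W : ModuleCat.{0} A} (_ : V ≃ₗ[A] W),
    Cov P Q n V → Cov P Q n W
  | 0, _, _, e, h => hP.quot e.toLinearMap e.surjective h
  | n + 1, V, W, e, h => by
    refine ⟨hP.quot e.toLinearMap e.surjective h.1, fun M f hM hf => ?_⟩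
    obtain ⟨H, k, hH, hs, hc⟩ := h.2 M (e.symm.toLinearMap ∘ₗ f) hM (e.symm.surjective.comp hf)
    refine ⟨H, k, hH, fun w => ?_, ?_⟩
    · obtain ⟨x, hx⟩ := hs (e.symm w)
      exact ⟨x, e.symm.injective hx⟩
    · have h1 : LinearMap.ker ((e.symm.toLinearMap ∘ₗ f) ∘ₗ k) = LinearMap.ker (f ∘ₗ k) := by
        ext x
        exact e.symm.map_eq_zero_iff
      exact Cov.of_equiv hP (V := ModuleCat.of A _) (W := ModuleCat.of A _)
        (LinearEquiv.ofEq _ _ h1) hc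

theorem exists_roof (hPQ : ∀ M, P M → Q M) (hQ : SubQuot Q)
    (hext : ExtClosed P Q) {Y : ModuleCat.{0} A} (hY : P Y) : ∀ {n : ℕ}
    {X X' X'' V : ModuleCat.{0} A} {E : YE Y n X} {F : YE Y n X'} {G : YE Y n X''}
    {φ : X →ₗ[A] X''} {ψ : X' →ₗ[A] X''}, E.Ok Q → F.Ok Q → G.Ok Q →
    YE.Mor LinearMap.id E G φ → YE.Mor LinearMap.id F G ψ → Cov P Q n V →
    ∀ (a : V →ₗ[A] X) (c : V →ₗ[A] X') (t : V →ₗ[A] G.top),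
    (∀ v, G.aug (t v) = φ (a v) - ψ (c v)) →
    ∃ H : YE Y n V, H.Ok P ∧ YE.Mor LinearMap.id H E a ∧ YE.Mor LinearMap.id H F c
  | 0, X, X', X'', V, E, F, G, φ, ψ, hE, hF, hG, ⟨mE, hE1, hE2⟩, ⟨mF, hF1, hF2⟩, hV, a, c, t,
      ht => by
    change SES Y X at E
    change SES Y X' at F
    change SES Y X'' at G
    change V →ₗ[A] G.M at t
    change ∀ v, G.p (t v) = φ (a v) - ψ (c v) at ht
    change ∀ y, mE (E.i y) = G.i y at hE1
    change ∀ y, mF (F.i y) = G.i y at hF1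
    have hE' : E.IsEx := hE.1
    have hF' : F.IsEx := hF.1
    have hG' : G.IsEx := hG.1
    let N : Submodule A (V × E.M × F.M) :=
      { carrier := {x | E.p x.2.1 = a x.1 ∧ F.p x.2.2 = c x.1 ∧ mE x.2.1 - mF x.2.2 = t x.1}
        add_mem' := by
          rintro x y ⟨h1, h2, h3⟩ ⟨h1', h2', h3'⟩
          refine ⟨?_, ?_, ?_⟩
          · simp only [Prod.fst_add, Prod.snd_add, map_add, h1, h1']
          · simp only [Prod.fst_add, Prod.snd_add, map_add, h2, h2']
          · simp only [Prod.fst_add, Prod.snd_add, map_add, ← h3, ← h3']; abel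
        zero_mem' := by simp
        smul_mem' := by
          rintro r x ⟨h1, h2, h3⟩
          refine ⟨?_, ?_, ?_⟩
          · simp only [Prod.smul_fst, Prod.smul_snd, map_smul, h1]
          · simp only [Prod.smul_fst, Prod.smul_snd, map_smul, h2]
          · simp only [Prod.smul_fst, Prod.smul_snd, map_smul, ← h3, smul_sub] }
    have hN : Q (ModuleCat.of A N) := hQ.sub (M := ModuleCat.of A (V × E.M × F.M)) N.subtype
      Subtype.val_injective (hQ.prod (N := ModuleCat.of A (E.M × F.M)) (hPQ _ hV.prop)
        (hQ.prod hE.2 hF.2))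
    let H : SES Y V :=
      { M := ModuleCat.of A N
        i := ((0 : Y →ₗ[A] V).prod (E.i.prod F.i)).codRestrict N fun y =>
          ⟨(E.zero y).trans (map_zero _).symm, (F.zero y).trans (map_zero _).symm, by
            change mE (E.i y) - mF (F.i y) = t 0
            rw [hE1, hF1, sub_self, map_zero]⟩
        p := LinearMap.fst A _ _ ∘ₗ N.subtype
        zero := fun _ => rfl }
    have hH : H.IsEx := by
      refine ⟨fun y y' hy => hE'.inj (congrArg (fun x : N => x.1.2.1) hy), fun v => ?_, ?_⟩
      · obtain ⟨e, he⟩ := hE'.surj (a v)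
        obtain ⟨f, hf⟩ := hF'.surj (c v)
        obtain ⟨y, hy⟩ := hG'.ex (mE e - mF f - t v) (by
          rw [map_sub, map_sub, hE2, hF2, ht]
          exact (congrArg₂ (fun x y => φ x - ψ y - (φ (a v) - ψ (c v))) he hf).trans (sub_self _))
        refine ⟨⟨(v, e, f + F.i y), he, ?_, ?_⟩, rfl⟩
        · rw [map_add, F.zero, add_zero]; exact hf
        · rw [map_add, hF1, hy]; abel
      · rintro ⟨⟨v, e, f⟩, h1, h2, h3⟩ hv
        obtain rfl : v = 0 := hv
        obtain ⟨y, rfl⟩ := hE'.ex e (h1.trans (map_zero _))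
        obtain ⟨y', rfl⟩ := hF'.ex f (h2.trans (map_zero _))
        obtain rfl : y = y' := hG'.inj (by
          have : mE (E.i y) - mF (F.i y') = t 0 := h3
          rw [map_zero, hE1, hF1, sub_eq_zero] at this
          exact this)
        exact ⟨y, rfl⟩
    exact ⟨H, ⟨hH, hext H hH hN hY hV.prop⟩,
      ⟨LinearMap.fst A _ _ ∘ₗ LinearMap.snd A _ _ ∘ₗ N.subtype, fun _ => rfl, fun x => x.2.1⟩,
      ⟨LinearMap.snd A _ _ ∘ₗ LinearMap.snd A _ _ ∘ₗ N.subtype, fun _ => rfl, fun x => x.2.2.1⟩⟩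
  | n + 1, X, X', X'', V, ⟨ZE, E, E'⟩, ⟨ZF, F, F'⟩, ⟨ZG, G, G'⟩, φ, ψ, ⟨hE, hEM, hE'⟩,
      ⟨hF, hFM, hF'⟩, ⟨hG, hGM, hG'⟩, ⟨mE, zE, hE1, hE2, hE3⟩, ⟨mF, zF, hF1, hF2, hF3⟩, hV, a, c,
      t, ht => by
    change E.IsEx at hE
    change F.IsEx at hF
    change G.IsEx at hG
    change V →ₗ[A] G.M at t
    change E.M →ₗ[A] G.M at mE
    change F.M →ₗ[A] G.M at mF
    change ZE →ₗ[A] ZG at zE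
    change ZF →ₗ[A] ZG at zF
    change ∀ v, G.p (t v) = φ (a v) - ψ (c v) at ht
    change ∀ y, mE (E.i y) = G.i (zE y) at hE1
    change ∀ y, mF (F.i y) = G.i (zF y) at hF1
    change ∀ y, G.p (mE y) = φ (E.p y) at hE2
    change ∀ y, G.p (mF y) = ψ (F.p y) at hF2
    let N : Submodule A (V × E.M × F.M × G'.top) :=
      { carrier := {x | E.p x.2.1 = a x.1 ∧ F.p x.2.2.1 = c x.1 ∧
          mE x.2.1 - mF x.2.2.1 - t x.1 = G.i (G'.aug x.2.2.2)}
        add_mem' := by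
          rintro x y ⟨h1, h2, h3⟩ ⟨h1', h2', h3'⟩
          refine ⟨?_, ?_, ?_⟩
          · simp only [Prod.fst_add, Prod.snd_add, map_add, h1, h1']
          · simp only [Prod.fst_add, Prod.snd_add, map_add, h2, h2']
          · simp only [Prod.fst_add, Prod.snd_add, map_add, ← h3, ← h3']; abel
        zero_mem' := by simp
        smul_mem' := by
          rintro r x ⟨h1, h2, h3⟩
          refine ⟨?_, ?_, ?_⟩
          · simp only [Prod.smul_fst, Prod.smul_snd, map_smul, h1]
          · simp only [Prod.smul_fst, Prod.smul_snd, map_smul, h2]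
          · simp only [Prod.smul_fst, Prod.smul_snd, map_smul, ← h3, smul_sub] }
    have hN : Q (ModuleCat.of A N) := hQ.sub (M := ModuleCat.of A (V × E.M × F.M × G'.top))
      N.subtype Subtype.val_injective
      (hQ.prod (N := ModuleCat.of A (E.M × F.M × G'.top)) (hPQ _ hV.prop)
        (hQ.prod (N := ModuleCat.of A (F.M × G'.top)) hEM (hQ.prod hFM hG'.top)))
    let f : N →ₗ[A] V := LinearMap.fst A _ _ ∘ₗ N.subtype
    have hf : Function.Surjective f := fun v => by
      obtain ⟨e, he⟩ := hE.surj (a v)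
      obtain ⟨f, hf⟩ := hF.surj (c v)
      obtain ⟨y, hy⟩ := hG.ex (mE e - mF f - t v) (by
        rw [map_sub, map_sub, hE2, hF2, ht, he, hf, sub_self])
      obtain ⟨s, rfl⟩ := hG'.aug_surjective y
      exact ⟨⟨(v, e, f, s), he, hf, hy.symm⟩, rfl⟩
    obtain ⟨H, h, hH, hs, hc⟩ := hV.2 (ModuleCat.of A N) f hN hf
    let V' := LinearMap.ker (f ∘ₗ h)
    let hE' : H →ₗ[A] E.M := LinearMap.fst A _ _ ∘ₗ LinearMap.snd A _ _ ∘ₗ N.subtype ∘ₗ h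
    let hF'' : H →ₗ[A] F.M :=
      LinearMap.fst A _ _ ∘ₗ LinearMap.snd A _ _ ∘ₗ LinearMap.snd A _ _ ∘ₗ N.subtype ∘ₗ h
    let ht' : H →ₗ[A] G'.top :=
      LinearMap.snd A _ _ ∘ₗ LinearMap.snd A _ _ ∘ₗ LinearMap.snd A _ _ ∘ₗ N.subtype ∘ₗ h
    have e1 : ∀ x, E.p (hE' x) = a (f (h x)) := fun x => (h x).2.1
    have e2 : ∀ x, F.p (hF'' x) = c (f (h x)) := fun x => (h x).2.2.1
    have e3 : ∀ x, mE (hE' x) - mF (hF'' x) - t (f (h x)) = G.i (G'.aug (ht' x)) :=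
      fun x => (h x).2.2.2
    have lift : ∀ {Z X : ModuleCat.{0} A} (E : SES Z X), E.IsEx → ∀ k : H →ₗ[A] E.M,
        (∀ x : V', E.p (k x) = 0) → ∃ a' : V' →ₗ[A] Z, ∀ x, E.i (a' x) = k x := by
      intro Z X E hE k hk
      let e := LinearEquiv.ofInjective E.i hE.inj
      refine ⟨e.symm.toLinearMap ∘ₗ (k ∘ₗ V'.subtype).codRestrict (LinearMap.range E.i)
        fun x => hE.ex _ (hk x), fun x => ?_⟩
      exact congrArg Subtype.val (e.apply_symm_apply _)
    have hV' : ∀ x : V', f (h x) = 0 := fun x => x.2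
    obtain ⟨a', ha'⟩ := lift E hE hE' fun x => by rw [e1, hV', map_zero]
    obtain ⟨c', hc'⟩ := lift F hF hF'' fun x => by rw [e2, hV', map_zero]
    obtain ⟨H', hH', hm1, hm2⟩ := exists_roof hPQ hQ hext hY (V := ModuleCat.of A V') ‹_› hF' hG'
      hE3 hF3 hc a' c' (ht' ∘ₗ V'.subtype) fun x => hG.inj <| by
        change G.i (G'.aug (ht' x)) = _
        rw [← e3, hV', map_zero, sub_zero, ← ha', ← hc', hE1, hF1, map_sub]
    let T : SES (ModuleCat.of A V') V :=
      { M := H, i := V'.subtype, p := f ∘ₗ h, zero := fun x => x.2 }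
    have hT : T.IsEx := ⟨Subtype.val_injective, hs, fun x hx => ⟨⟨x, hx⟩, rfl⟩⟩
    exact ⟨⟨_, T, H'⟩, ⟨hT, hH, hH'⟩, ⟨hE', a', fun y => (ha' y).symm, e1, hm1⟩,
      ⟨hF'', c', fun y => (hc' y).symm, e2, hm2⟩⟩

theorem YE.exists_ok_of_cov (hPQ : ∀ M, P M → Q M) (hQ : SubQuot Q)
    (hext : ExtClosed P Q) {X Y : ModuleCat.{0} A} (hY : P Y) {n : ℕ} (hX : Cov P Q n X)
    {E F G : YE Y n X} (hE : E.Ok Q) (hF : F.Ok Q) (hG : G.Ok Q)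
    (h1 : YE.Mor LinearMap.id E G LinearMap.id) (h2 : YE.Mor LinearMap.id F G LinearMap.id) :
    ∃ H : YE Y n X, H.Ok P ∧ YE.Mor LinearMap.id H E LinearMap.id ∧
      YE.Mor LinearMap.id H F LinearMap.id :=
  exists_roof hPQ hQ hext hY hE hF hG h1 h2 hX LinearMap.id LinearMap.id 0 fun v => by simp

theorem YE.exists_eqv_of_cov (hPQ : ∀ M, P M → Q M) (hQ : SubQuot Q)
    (hext : ExtClosed P Q) {X Y : ModuleCat.{0} A} (hY : P Y) {n : ℕ} (hX : Cov P Q n X)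
    (E : YE Y n X) (hE : E.Ok Q) : ∃ F : YE Y n X, F.Ok P ∧ YE.Eqv Q E F := by
  obtain ⟨H, hH, h1, -⟩ := YE.exists_ok_of_cov hPQ hQ hext hY hX hE hE hE (YE.Mor.refl E)
    (YE.Mor.refl E)
  exact ⟨H, hH, (YE.Eqv.of_mor (hH.mono hPQ) hE h1).symm⟩

theorem YE.eqv_of_cov (hPQ : ∀ M, P M → Q M) (hQ : SubQuot Q)
    (hext : ExtClosed P Q) {X Y : ModuleCat.{0} A} (hY : P Y) {n : ℕ} (hX : Cov P Q n X)
    (E F : YE Y n X) (hE : E.Ok P) (hF : F.Ok P) (h : YE.Eqv Q E F) : YE.Eqv P E F := by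
  have roof := @YE.exists_ok_of_cov _ _ _ _ hPQ hQ hext _ _ hY _ hX
  have key : E = F ∨ (E.Ok Q ∧ F.Ok Q ∧ ∃ H : YE Y n X, H.Ok P ∧
      YE.Mor LinearMap.id H E LinearMap.id ∧ YE.Mor LinearMap.id H F LinearMap.id) := by
    clear hE hF
    induction h with
    | rel E F h => exact .inr ⟨h.1, h.2.1, roof h.1 h.2.1 h.2.1 h.2.2 (YE.Mor.refl F)⟩
    | refl E => exact .inl rfl
    | symm E F _ ih =>
      rcases ih with rfl | ⟨h1, h2, H, hH, h3, h4⟩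
      · exact .inl rfl
      · exact .inr ⟨h2, h1, H, hH, h4, h3⟩
    | trans E F G _ _ ih ih' =>
      rcases ih with rfl | ⟨h1, h2, H, hH, h3, h4⟩
      · exact ih'
      · rcases ih' with rfl | ⟨h1', h2', H', hH', h3', h4'⟩
        · exact .inr ⟨h1, h2, H, hH, h3, h4⟩
        · obtain ⟨J, hJ, h5, h6⟩ := roof (hH.mono hPQ) (hH'.mono hPQ) h2 h4 h3'
          exact .inr ⟨h1, h2', J, hJ, h5.comp h3, h6.comp h4'⟩
  rcases key with rfl | ⟨-, -, H, hH, h1, h2⟩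
  · exact .refl _
  · exact (YE.Eqv.of_mor hH hE h1).symm.trans _ _ _ (YE.Eqv.of_mor hH hF h2)

theorem bijective_yextFamMap_of_cov (hPQ : ∀ M, P M → Q M) (hQ : SubQuot Q)
    (hext : ExtClosed P Q) {X Y : ModuleCat.{0} A} (hY : P Y) (hX : ∀ n, Cov P Q n X) (i : ℕ) :
    Function.Bijective (yextFamMap A hPQ (X := X) (Y := Y) i) :=
  bijective_yextFamMap hPQ (hX 0).prop hY
    (fun n => YE.exists_eqv_of_cov hPQ hQ hext hY (hX n))
    (fun n => YE.eqv_of_cov hPQ hQ hext hY (hX n)) i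

end Cover

section Weights

variable {h : Type} [AddCommGroup h] [Module K h] {V : Type} [AddCommGroup V] [Module K V]

theorem wt_le_of_iSup_eq_top {ρ : h → Module.End K V} {N : Module.Dual K h → Submodule K V}
    (hN : ∀ χ, N χ ≤ wt ρ χ) (htop : ⨆ χ, N χ = ⊤) (χ : Module.Dual K h) : wt ρ χ ≤ N χ := by
  intro v hv
  have h1 : ⨆ χ, N χ ≤ N χ ⊔ wtSum ρ {χ}ᶜ := by
    refine iSup_le fun χ' => ?_
    by_cases h : χ' = χ
    · subst h; exact le_sup_left
    · exact le_sup_of_le_right ((hN χ').trans (wt_le_wtSum h))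
  obtain ⟨a, ha, b, hb, rfl⟩ := Submodule.mem_sup.1 (h1 (htop ▸ Submodule.mem_top : v ∈ _))
  have h2 : b ∈ wt ρ χ := (Submodule.add_mem_iff_right _ (hN χ ha)).1 hv
  rw [eq_zero_of_mem_wt_of_mem_wtSum (by simp) h2 hb, add_zero]
  exact ha

end Weights

namespace RootReductive

section FiniteWeights

variable (S : RootReductive K g) (F : Type) {F' : Type} [AddCommGroup F] [Module K F]
  [LieRingModule S.b F] [LieModule K S.b F] [AddCommGroup F'] [Module K F']
  [LieRingModule S.b F'] [LieModule K S.b F']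
  {M N : Type} [AddCommGroup M] [Module (UEA K g) M]
  [AddCommGroup N] [Module (UEA K g) N]

/-- The weight spaces of a `b`-module are finite-dimensional. -/
def FW : Prop := ∀ χ, (wt (S.rb F) χ).FG

variable {F}

theorem hasFinDimWt_iff : S.HasFinDimWt M ↔ S.FW (Res K g M) := by
  refine forall_congr' fun χ => ⟨?_, ?_⟩
  · rintro ⟨s, -, hs⟩
    refine Submodule.FG.of_le (T := Submodule.span K (show Set (Res K g M) from (s : Set M)))
      ⟨s, rfl⟩ fun m hm => ?_
    exact hs (S.mem_wtSet.2 hm)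
  · rintro ⟨s, hs⟩
    refine ⟨s, fun m hm => S.mem_wtSet.2 ?_, fun m hm => ?_⟩
    · rw [← hs]; exact Submodule.subset_span hm
    · have := S.mem_wtSet.1 hm
      rw [← hs] at this
      exact this

variable {S} in
theorem FW.of_injective (hF : S.FW F') (φ : F →ₗ⁅K, S.b⁆ F') (hφ : Function.Injective φ) :
    S.FW F := fun χ => by
  refine Submodule.fg_of_fg_map_injective (φ : F →ₗ[K] F') hφ ((hF χ).of_le ?_)
  rintro _ ⟨f, hf, rfl⟩
  exact hom_mem_wt φ hf

variable {S} in
theorem FW.of_surjective (hF : S.FW F) (hw : S.WtIn F Set.univ) (φ : F →ₗ⁅K, S.b⁆ F')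
    (hφ : Function.Surjective φ) : S.FW F' := fun χ => by
  refine ((hF χ).map (φ : F →ₗ[K] F')).of_le fun f' hf' => ?_
  obtain ⟨f, hf, rfl⟩ := exists_hom_wt_lift hφ hw hf'
  exact ⟨f, hf, rfl⟩

theorem fw_prod (hM : S.FW (Res K g M)) (hN : S.FW (Res K g N)) : S.FW (Res K g (M × N)) := by
  intro χ
  refine (((hM χ).map (S.resb (LinearMap.inl (UEA K g) M N) : Res K g M →ₗ[K] _)).sup
    ((hN χ).map (S.resb (LinearMap.inr (UEA K g) M N) : Res K g N →ₗ[K] _))).of_le fun x hx => ?_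
  rw [S.res_prod_eq x]
  exact Submodule.add_mem_sup
    ⟨_, hom_mem_wt (S.resb (LinearMap.fst (UEA K g) M N)) hx, rfl⟩
    ⟨_, hom_mem_wt (S.resb (LinearMap.snd (UEA K g) M N)) hx, rfl⟩

theorem subQuot_wtIn_fw (D : Set (Module.Dual K S.h)) :
    SubQuot fun M : ModuleCat.{0} (UEA K g) =>
      S.WtIn (Res K g M) D ∧ S.FW (Res K g M) where
  sub f hf h := ⟨h.1.of_injective (S.resb f) hf, h.2.of_injective (S.resb f) hf⟩
  quot f hf h := ⟨h.1.of_surjective (S.resb f) hf,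
    h.2.of_surjective (h.1.mono (Set.subset_univ _)) (S.resb f) hf⟩
  prod hM hN := ⟨S.wtIn_prod hM.1 hN.1, S.fw_prod hM.2 hN.2⟩

theorem extClosed_wtIn_fw (D : Set (Module.Dual K S.h)) :
    ExtClosed (fun M : ModuleCat.{0} (UEA K g) => S.WtIn (Res K g M) D ∧ S.FW (Res K g M))
      (fun M : ModuleCat.{0} (UEA K g) => S.WtIn (Res K g M) D) := by
  intro Z X E hE hM hZ hX
  refine ⟨hM, fun χ => Submodule.fg_of_fg_map_of_fg_inf_ker
    (S.resb E.p : Res K g E.M →ₗ[K] Res K g X) ((hX.2 χ).of_le ?_)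
    (((hZ.2 χ).map (S.resb E.i : Res K g Z →ₗ[K] Res K g E.M)).of_le ?_)⟩
  · rintro _ ⟨f, hf, rfl⟩
    exact hom_mem_wt (S.resb E.p) hf
  · rintro m ⟨hm, hpm⟩
    obtain ⟨z, rfl⟩ := hE.ex m hpm
    refine ⟨z, mem_wt.2 fun H => hE.inj ?_, rfl⟩
    have h1 := mem_wt.1 hm H
    have h2 := S.hom_rb (S.resb E.i) H z
    exact h2.trans (h1.trans ((S.resb E.i : Res K g Z →ₗ[K] Res K g E.M).map_smul (χ H) z).symm)

theorem lie_mem_wt {α χ : Module.Dual K S.h} {x : g} (hx : x ∈ rootSp K g S.h α) {m : Res K g M}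
    (hm : m ∈ wt (S.rb (Res K g M)) χ) : ⁅x, m⁆ ∈ wt (S.rb (Res K g M)) (χ + α) := by
  refine mem_wt.2 fun H => ?_
  have h1 : ⁅(H : g), m⁆ = χ H • m := mem_wt.1 hm H
  have h2 : ⁅(H : g), x⁆ = α H • x := hx H
  change ⁅(H : g), ⁅x, m⁆⁆ = (χ H + α H) • ⁅x, m⁆
  rw [leibniz_lie, h1, h2, lie_smul, smul_lie, add_smul, add_comm]

variable {S} in
theorem fw_ind {D : Set (Module.Dual K S.h)} (hp : S.Pointed) (hId : S.IsIdeal D)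
    (hD : S.UpperFinite D) (hF : S.WtIn F D) (hfw : S.FW F) : S.FW (Res K g (S.Ind F)) := by
  have hM : S.WtIn (Res K g (S.Ind F)) D := S.ind_wtIn hId.sub_mem hF
  let W := wt (S.rb (Res K g (S.Ind F)))
  let B : g →ₗ[K] Res K g (S.Ind F) →ₗ[K] Res K g (S.Ind F) :=
    LieModule.toEnd K g (Res K g (S.Ind F))
  let N (χ : Module.Dual K S.h) : Submodule K (Res K g (S.Ind F)) :=
    (wt (S.rb F) χ).map (S.iunitHom (F := F) : F →ₗ[K] Res K g (S.Ind F)) ⊔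
      ⨆ α ∈ {α | α ∈ S.Φp ∧ χ + α ∈ D}, Submodule.map₂ B (rootSp K g S.h (-α)) (W (χ + α))
  have hNW (χ) : N χ ≤ W χ := by
    refine sup_le ?_ (iSup₂_le fun α hα => Submodule.map₂_le.2 fun x hx m hm => ?_)
    · rintro _ ⟨f, hf, rfl⟩
      exact hom_mem_wt S.iunitHom hf
    · have := S.lie_mem_wt hx hm
      rwa [add_neg_cancel_right] at this
  have hle (χ) : N χ ≤ ⨆ χ, N χ := le_iSup N χ
  have hunit (f : F) : (S.iunitHom (F := F) : F →ₗ[K] Res K g (S.Ind F)) f ∈ ⨆ χ, N χ := by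
    have : wtSum (S.rb F) D ≤
        (⨆ χ, N χ).comap (S.iunitHom (F := F) : F →ₗ[K] Res K g (S.Ind F)) :=
      wtSum_le.2 fun χ _ f hf => hle χ (Submodule.mem_sup_left ⟨f, hf, rfl⟩)
    exact this (hF f)
  have hlie (x : g) (hx : x ∈ S.nm.toSubmodule) (m : Res K g (S.Ind F)) : B x m ∈ ⨆ χ, N χ := by
    have h1 : S.nm.toSubmodule ≤ (⨆ χ, N χ).comap (B.flip m) := by
      rw [S.nm_eq]
      refine wtSum_le.2 fun α hα x hx => ?_
      rw [wt_adh] at hx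
      have h2 : wtSum (S.rb (Res K g (S.Ind F))) D ≤ (⨆ χ, N χ).comap (B x) := by
        refine wtSum_le.2 fun χ hχ m hm => hle (χ + α) (Submodule.mem_sup_right ?_)
        have h3 : χ + α + -α = χ := add_neg_cancel_right _ _
        refine Submodule.mem_iSup_of_mem (-α) (Submodule.mem_iSup_of_mem ⟨hα, h3.symm ▸ hχ⟩ ?_)
        rw [h3, neg_neg]
        exact Submodule.apply_mem_map₂ B hx hm
      exact h2 (hM m)
    exact h1 hx
  have htop : ⨆ χ, N χ = ⊤ := by
    refine (Submodule.eq_top_iff' (p := ⨆ χ, N χ)).2 fun m => ?_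
    refine S.ind_induction (p := fun m => (show Res K g (S.Ind F) from m) ∈ ⨆ χ, N χ)
      (fun f => hunit f) (fun x m _ => ?_) (fun _ _ => Submodule.add_mem _) (fun c m hm => ?_) m
    · rw [← ind_ι_nm]
      exact hlie x x.2 m
    · rw [← ind_algebraMap]
      exact Submodule.smul_mem _ c hm
  have key : ∀ (n : ℕ) (χ : Module.Dual K S.h), {lam ∈ D | S.wle χ lam}.ncard = n → χ ∈ D →
      (W χ).FG := by
    intro n
    induction n using Nat.strong_induction_on with
    | _ n ih =>
    intro χ hn hχ
    refine Submodule.FG.of_le ?_ (wt_le_of_iSup_eq_top hNW htop χ)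
    have hfin : {α | α ∈ S.Φp ∧ χ + α ∈ D}.Finite :=
      Set.Finite.of_injOn (f := fun α => χ + α) (t := {lam ∈ D | S.wle χ lam})
        (fun α hα => ⟨hα.2, wle_add hα.1 χ⟩) (add_right_injective χ).injOn (hD χ hχ)
    refine ((hfw χ).map _).sup ?_
    have h1 := Submodule.fg_biSup hfin.toFinset
      (fun α => Submodule.map₂ B (rootSp K g S.h (-α)) (W (χ + α))) fun α hα => ?_
    · simpa only [Set.Finite.mem_toFinset] using h1
    obtain ⟨hα, hχα⟩ := hfin.mem_toFinset.1 hα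
    refine Submodule.FG.map₂ B ?_ (ih _ ?_ (χ + α) rfl hχα)
    · obtain ⟨e, he, hspan⟩ := S.exists_root_vector (α := -α)
        (S.pos_union ▸ Or.inr (by simpa using hα))
      refine (Submodule.fg_span_singleton e).of_le fun x hx => ?_
      obtain ⟨c, rfl⟩ := hspan x hx
      exact Submodule.smul_mem _ _ (Submodule.mem_span_singleton_self e)
    · rw [← hn]
      refine Set.ncard_lt_ncard ⟨fun lam h => ⟨h.1, (wle_add hα χ).trans h.2⟩, fun hcon => ?_⟩
        (hD χ hχ)
      have h3 : S.wle (χ + α) χ := (hcon ⟨hχ, wle_refl χ⟩).2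
      rw [wle, sub_add_cancel_left] at h3
      have := hp α (AddSubmonoid.subset_closure hα) h3
      exact S.zero_notMem_Φp (this ▸ hα)
  intro χ
  by_cases hχ : χ ∈ D
  · exact key _ χ rfl hχ
  · have : wt (S.rb (Res K g (S.Ind F))) χ = ⊥ := (Submodule.eq_bot_iff _).2 fun m hm =>
      eq_zero_of_mem_wt_of_mem_wtSum hχ hm (hM m)
    rw [this]
    exact Submodule.fg_bot

end FiniteWeights

end RootReductive

namespace RootReductive

section Covers

variable (S : RootReductive K g) {F : Type} {F' : Type} [AddCommGroup F] [Module K F]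
  [LieRingModule S.b F] [LieModule K S.b F] [AddCommGroup F'] [Module K F']
  [LieRingModule S.b F'] [LieModule K S.b F']

variable {S} in
theorem LF.exists_le (hF : S.LF F) {N : Submodule K F} (hN : N.FG) :
    ∃ T : LieSubmodule K S.b F, N ≤ T.toSubmodule ∧ FiniteDimensional K T := by
  induction N, hN using Submodule.fg_induction with
  | singleton f =>
    obtain ⟨T, hT, hfd⟩ := hF f
    exact ⟨T, (Submodule.span_singleton_le_iff_mem f _).2 hT, hfd⟩
  | sup N N' _ _ h h' =>
    obtain ⟨T, hT, hfd⟩ := h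
    obtain ⟨T', hT', hfd'⟩ := h'
    refine ⟨T ⊔ T', ?_, ?_⟩
    · rw [LieSubmodule.sup_toSubmodule]
      exact sup_le_sup hT hT'
    · change FiniteDimensional K (T ⊔ T').toSubmodule
      rw [LieSubmodule.sup_toSubmodule]
      have : FiniteDimensional K T.toSubmodule := hfd
      have : FiniteDimensional K T'.toSubmodule := hfd'
      infer_instance

/-- A `b`-module map whose values lie in the image of an injective one factors. -/
theorem exists_hom_factor {G : Type} [AddCommGroup G] [Module K G] [LieRingModule S.b G]
    [LieModule K S.b G] (ψ : F →ₗ⁅K, S.b⁆ G) (hψ : Function.Injective ψ) (φ : F' →ₗ⁅K, S.b⁆ G)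
    (h : ∀ x, ∃ y, ψ y = φ x) : ∃ θ : F' →ₗ⁅K, S.b⁆ F, ∀ x, ψ (θ x) = φ x := by
  choose θ hθ using h
  exact ⟨{  toFun := θ
            map_add' := fun a b => hψ (by simp only [map_add, hθ])
            map_smul' := fun c a => hψ (by simp only [map_smul, hθ, RingHom.id_apply])
            map_lie' := fun {x a} => hψ (by simp only [LieModuleHom.map_lie, hθ]) }, hθ⟩

theorem exists_findim_cover {M : Type} [AddCommGroup M] [Module (UEA K g) M]
    [FiniteDimensional K F] (hM : S.LF (Res K g M)) {f : M →ₗ[UEA K g] S.Ind F}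
    (hf : Function.Surjective f) : ∃ (T : LieSubmodule K S.b (Res K g M)) (ψ : T →ₗ⁅K, S.b⁆ F),
      FiniteDimensional K T ∧ Function.Surjective ψ ∧
      f ∘ₗ S.indLift T.incl = S.indMap ψ := by
  have hi : Function.Injective (S.iunitHom (F := F)) := S.iunit_injective
  let G : LieSubmodule K S.b (Res K g M) := LieSubmodule.comap (S.resb f) (S.iunitHom (F := F)).range
  obtain ⟨θ, hθ⟩ := S.exists_hom_factor S.iunitHom hi ((S.resb f).comp G.incl)
    fun x => (LieModuleHom.mem_range _ _).1 (LieSubmodule.mem_comap.1 x.2)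
  have hθs : Function.Surjective θ := fun y => by
    obtain ⟨m, hm⟩ := hf (S.iunit y)
    refine ⟨⟨m, ?_⟩, hi ?_⟩
    · change (S.resb f) m ∈ (S.iunitHom (F := F)).range
      exact (LieModuleHom.mem_range _ _).2 ⟨y, hm.symm⟩
    · rw [hθ]; exact hm
  obtain ⟨σ, hσ⟩ := (θ : G →ₗ[K] F).exists_rightInverse_of_surjective
    (LinearMap.range_eq_top.2 hθs)
  have hlf : S.LF G := hM.of_injective G.incl Subtype.val_injective
  obtain ⟨T', hT', hfd⟩ := hlf.exists_le
    (show (LinearMap.range σ).FG by rw [LinearMap.range_eq_map]; exact (Module.Finite.fg_top).map σ)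
  let T := T'.map G.incl
  have hTG : ∀ t : T, (t : Res K g M) ∈ G := by
    rintro ⟨t, ht⟩
    obtain ⟨t', -, rfl⟩ := (LieSubmodule.mem_map _).1 ht
    exact t'.2
  obtain ⟨ψ, hψ⟩ := S.exists_hom_factor S.iunitHom hi ((S.resb f).comp T.incl)
    fun x => (LieModuleHom.mem_range _ _).1 (LieSubmodule.mem_comap.1 (hTG x))
  refine ⟨T, ψ, ?_, fun y => ?_, ?_⟩
  · have : FiniteDimensional K T'.toSubmodule := hfd
    exact inferInstanceAs (FiniteDimensional K (T'.toSubmodule.map (G.incl : G →ₗ[K] Res K g M)))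
  · have h1 : σ y ∈ T' := hT' ⟨y, rfl⟩
    refine ⟨⟨G.incl (σ y), (LieSubmodule.mem_map _).2 ⟨σ y, h1, rfl⟩⟩, hi ?_⟩
    rw [hψ]
    exact (hθ (σ y)).symm.trans (congrArg _ (LinearMap.congr_fun hσ y))
  · refine S.ind_hom_ext fun t => ?_
    have h1 := S.indLift_iunit T.incl t
    rw [indMap_iunit]
    exact (congrArg f h1).trans (hψ t).symm

variable {S} in
theorem cov_ind {D : Set (Module.Dual K S.h)} (hp : S.Pointed) (hId : S.IsIdeal D)
    (hD : S.UpperFinite D) : ∀ (n : ℕ) (F : Type) [AddCommGroup F] [Module K F]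
    [LieRingModule S.b F] [LieModule K S.b F] [FiniteDimensional K F], S.WtIn F D →
    Cov (fun M : ModuleCat.{0} (UEA K g) => S.WtIn (Res K g M) D ∧ S.FW (Res K g M))
      (fun M : ModuleCat.{0} (UEA K g) => S.WtIn (Res K g M) D) n
      (ModuleCat.of (UEA K g) (S.Ind F)) := by
  have hP : ∀ (F : Type) [AddCommGroup F] [Module K F] [LieRingModule S.b F] [LieModule K S.b F]
      [FiniteDimensional K F], S.WtIn F D →
      S.WtIn (Res K g (S.Ind F)) D ∧ S.FW (Res K g (S.Ind F)) := fun F _ _ _ _ _ hF =>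
    ⟨S.ind_wtIn hId.sub_mem hF, fw_ind hp hId hD hF fun χ => IsNoetherian.noetherian _⟩
  intro n
  induction n with
  | zero => intro F _ _ _ _ _ hF; exact hP F hF
  | succ n ih =>
    intro F _ _ _ _ _ hF
    refine ⟨hP F hF, fun M f hM hf => ?_⟩
    obtain ⟨T, ψ, hfd, hψ, hfT⟩ := S.exists_findim_cover (S.lf_of_upperFinite hp hD hM) hf
    have hT : S.WtIn T D := WtIn.of_injective hM T.incl Subtype.val_injective
    refine ⟨ModuleCat.of _ (S.Ind T), S.indLift T.incl, hP T hT, ?_, ?_⟩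
    · rw [hfT]
      exact S.indMap_surjective hψ
    · let κ := ψ.ker
      have : FiniteDimensional K κ := inferInstanceAs (FiniteDimensional K κ.toSubmodule)
      have hex : Function.Exact κ.incl ψ := fun t => by
        rw [← LieModuleHom.mem_ker]
        exact ⟨fun h => ⟨⟨t, h⟩, rfl⟩, by rintro ⟨⟨t, h⟩, rfl⟩; exact h⟩
      have h1 : LinearMap.range (S.indMap κ.incl) = LinearMap.ker (f ∘ₗ S.indLift T.incl) := by
        rw [hfT]
        exact (LinearMap.exact_iff.1 (S.indMap_exact hex hψ)).symm
      exact Cov.of_equiv (V := ModuleCat.of (UEA K g) (S.Ind κ)) (S.subQuot_wtIn_fw D)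
        ((LinearEquiv.ofInjective _ (S.indMap_injective Subtype.val_injective)).trans
          (LinearEquiv.ofEq _ _ h1))
        (ih κ (WtIn.of_injective hT κ.incl Subtype.val_injective))

end Covers

end RootReductive

section Flag

variable {A : Type} [Ring A]

/-- Induction along a finite filtration. -/
theorem flag_induction {Q p : ModuleCat.{0} A → Prop} (hQ : SubQuot Q)
    (hzero : ∀ Z : ModuleCat.{0} A, Subsingleton Z → Q Z → p Z)
    (hext : ∀ {Z X : ModuleCat.{0} A} (E : SES Z X), E.IsEx → Q E.M → p Z → p X → p E.M)
    (hequiv : ∀ {V W : ModuleCat.{0} A}, (V ≃ₗ[A] W) → p V → p W) {X : ModuleCat.{0} A}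
    (hX : Q X) {m : ℕ} (F : Fin (m + 1) →o Submodule A X) (h0 : F 0 = ⊥)
    (hl : F (Fin.last m) = ⊤)
    (hi : ∀ i : Fin m, p (ModuleCat.of A (subquot (F i.castSucc) (F i.succ)))) : p X := by
  have key : ∀ i : Fin (m + 1), p (ModuleCat.of A (F i)) := by
    intro i
    induction i using Fin.induction with
    | zero =>
      exact hzero _ (by rw [h0]; infer_instance : Subsingleton (F 0)) (hQ.sub_sub _ hX)
    | succ i ih =>
      have hle : F i.castSucc ≤ F i.succ := F.monotone i.castSucc_le_succ
      refine hext (Z := ModuleCat.of A (F i.castSucc))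
        (X := ModuleCat.of A (subquot (F i.castSucc) (F i.succ)))
        { M := ModuleCat.of A (F i.succ)
          i := Submodule.inclusion hle
          p := Submodule.mkQ _
          zero := fun z => (Submodule.Quotient.mk_eq_zero _).2 z.2 }
        ⟨Submodule.inclusion_injective hle, Submodule.mkQ_surjective _, fun x hx => ?_⟩
        (hQ.sub_sub _ hX) ih (hi i)
      exact ⟨⟨(show F i.succ from x).1,
        (Submodule.Quotient.mk_eq_zero ((F i.castSucc).comap (F i.succ).subtype)).1 hx⟩, rfl⟩
  exact hequiv (V := ModuleCat.of A (F (Fin.last m)))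
    ((LinearEquiv.ofEq _ _ hl).trans Submodule.topEquiv) (key _)

end Flag

namespace RootReductive

section Verma

variable (S : RootReductive K g) (lam : Module.Dual K S.h)

/-- The canonical generator of the Verma module. -/
def vgen : Res K g (S.Verma lam) := Submodule.Quotient.mk (p := S.vIdeal lam) 1

theorem smul_vgen (u : UEA K g) : (u • (show S.Verma lam from S.vgen lam)) =
    (Submodule.Quotient.mk (p := S.vIdeal lam) u : S.Verma lam) := by
  change u • Submodule.Quotient.mk (p := S.vIdeal lam) 1 = _
  rw [← Submodule.Quotient.mk_smul, smul_eq_mul, mul_one]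

theorem root_vgen {α : Module.Dual K S.h} (hα : α ∈ S.Φp) {x : g} (hx : x ∈ rootSp K g S.h α) :
    ⁅x, S.vgen lam⁆ = 0 := by
  refine (S.smul_vgen lam (ι K x)).trans ((Submodule.Quotient.mk_eq_zero _).2 ?_)
  exact Submodule.subset_span (Or.inl ⟨x, Submodule.mem_iSup_of_mem α
    (Submodule.mem_iSup_of_mem hα hx), rfl⟩)

theorem vgen_mem_wt : S.vgen lam ∈ wt (S.rb (Res K g (S.Verma lam))) lam := by
  refine mem_wt.2 fun H => ?_
  refine (S.smul_vgen lam (ι K (H : g))).trans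
    (Eq.trans ?_ (S.smul_vgen lam (algebraMap K _ (lam H))).symm)
  refine (Submodule.Quotient.eq _).2 (Submodule.subset_span (Or.inr ⟨H, rfl⟩))

theorem nplus_vgen {x : g} (hx : x ∈ S.nplus) : ⁅x, S.vgen lam⁆ = 0 := by
  have h1 : S.nplus ≤ LinearMap.ker ((LieModule.toEnd K g (Res K g (S.Verma lam)) : g →ₗ[K]
      Module.End K (Res K g (S.Verma lam))).flip (S.vgen lam)) :=
    iSup₂_le fun α hα x hx => S.root_vgen lam hα hx
  exact h1 hx

/-- The highest weight line of the Verma module. -/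
def vline : LieSubmodule K S.b (Res K g (S.Verma lam)) where
  toSubmodule := Submodule.span K {S.vgen lam}
  lie_mem {y m} hm := by
    obtain ⟨c, rfl⟩ := Submodule.mem_span_singleton.1 hm
    rw [lie_smul]
    refine Submodule.smul_mem _ _ ?_
    refine S.b_induction (T := (Submodule.span K {S.vgen lam}).comap
      ((LieModule.toEnd K S.b (Res K g (S.Verma lam)) : S.b →ₗ[K]
        Module.End K (Res K g (S.Verma lam))).flip (S.vgen lam)))
      (fun H => ?_) (fun α hα x hx => ?_) y
    · have h1 := mem_wt.1 (S.vgen_mem_wt lam) H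
      change S.rb (Res K g (S.Verma lam)) H (S.vgen lam) ∈ Submodule.span K {S.vgen lam}
      rw [h1]
      exact Submodule.smul_mem _ _ (Submodule.mem_span_singleton_self _)
    · have h1 : ⁅(⟨x, S.rootSp_le_b hα hx⟩ : S.b), S.vgen lam⁆ = 0 := S.root_vgen lam hα hx
      change ⁅(⟨x, S.rootSp_le_b hα hx⟩ : S.b), S.vgen lam⁆ ∈ Submodule.span K {S.vgen lam}
      rw [h1]
      exact zero_mem _

/-- The generator, in the highest weight line. -/
def vgenL : S.vline lam := ⟨S.vgen lam, Submodule.mem_span_singleton_self _⟩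

theorem exists_smul_vgenL (l : S.vline lam) : ∃ c : K, c • S.vgenL lam = l := by
  obtain ⟨c, hc⟩ := Submodule.mem_span_singleton.1 l.2
  exact ⟨c, Subtype.ext hc⟩

instance : FiniteDimensional K (S.vline lam) :=
  inferInstanceAs (FiniteDimensional K (Submodule.span K {S.vgen lam}))

/-- The map from the Verma module to the induced module. -/
def vermaToInd : S.Verma lam →ₗ[UEA K g] S.Ind (S.vline lam) :=
  Submodule.liftQ (S.vIdeal lam)
    (LinearMap.toSpanSingleton (UEA K g) _ (S.iunit (S.vgenL lam))) (by
    refine Submodule.span_le.2 ?_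
    rintro _ (⟨x, hx, rfl⟩ | ⟨H, rfl⟩)
    · have hb : x ∈ S.b := (iSup₂_le fun _ hα => S.rootSp_le_b hα : S.nplus ≤ S.b.toSubmodule) hx
      refine (S.ind_ι_b ⟨x, hb⟩ (S.vgenL lam)).trans ?_
      have : ⁅(⟨x, hb⟩ : S.b), S.vgenL lam⁆ = 0 := Subtype.ext (S.nplus_vgen lam hx)
      rw [this, map_zero]
    · change (ι K (H : g) - algebraMap K (UEA K g) (lam H)) • S.iunit (S.vgenL lam) = 0
      have : ⁅(⟨H, S.h_le_b H.2⟩ : S.b), S.vgenL lam⁆ = lam H • S.vgenL lam :=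
        Subtype.ext (mem_wt.1 (S.vgen_mem_wt lam) H)
      rw [sub_smul, ind_algebraMap, S.ind_ι_b ⟨H, S.h_le_b H.2⟩, this, map_smul, sub_self])

theorem vermaToInd_vgen :
    S.vermaToInd lam (show S.Verma lam from S.vgen lam) = S.iunit (S.vgenL lam) :=
  one_smul (UEA K g) (S.iunit (S.vgenL lam))

/-- The Verma module is induced from its highest weight line. -/
def vermaEquiv : S.Ind (S.vline lam) ≃ₗ[UEA K g] S.Verma lam :=
  LinearEquiv.ofLinearMap (S.indLift (S.vline lam).incl) (S.vermaToInd lam)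
    (Submodule.linearMap_qext _ (LinearMap.ext_ring (by
      have h1 := S.indLift_iunit (S.vline lam).incl (S.vgenL lam)
      exact (congrArg (S.indLift (S.vline lam).incl)
        (one_smul (UEA K g) (S.iunit (S.vgenL lam)))).trans h1)))
    (S.ind_hom_ext fun l => by
      obtain ⟨c, rfl⟩ := S.exists_smul_vgenL lam l
      have h1 := S.indLift_iunit (S.vline lam).incl (c • S.vgenL lam)
      refine (congrArg (S.vermaToInd lam) h1).trans ?_
      refine ((S.vermaToInd lam).map_smul (algebraMap K (UEA K g) c)
        (show S.Verma lam from S.vgen lam)).trans ?_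
      exact (congrArg (algebraMap K (UEA K g) c • ·) (S.vermaToInd_vgen lam)).trans
        ((S.ind_algebraMap c _).trans (map_smul S.iunit c _).symm))

variable {S lam} in
theorem cov_verma {D : Set (Module.Dual K S.h)} (hp : S.Pointed) (hId : S.IsIdeal D)
    (hD : S.UpperFinite D) (h : S.WtIn (Res K g (S.Verma lam)) D) (n : ℕ) :
    Cov (fun M : ModuleCat.{0} (UEA K g) => S.WtIn (Res K g M) D ∧ S.FW (Res K g M))
      (fun M : ModuleCat.{0} (UEA K g) => S.WtIn (Res K g M) D) n
      (ModuleCat.of (UEA K g) (S.Verma lam)) :=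
  Cov.of_equiv (V := ModuleCat.of (UEA K g) (S.Ind (S.vline lam))) (S.subQuot_wtIn_fw D)
    (S.vermaEquiv lam)
    (cov_ind hp hId hD n (S.vline lam) (h.of_injective (S.vline lam).incl Subtype.val_injective))

theorem subsingleton_ind_of (F : Type) [AddCommGroup F] [Module K F] [Subsingleton F] :
    Subsingleton (S.Ind F) := by
  refine subsingleton_of_forall_eq 0 fun m => ?_
  refine S.ind_induction' (p := fun m => m = 0) (fun u f => ?_) ?_ m
  · rw [Subsingleton.elim f 0, map_zero]
  · rintro _ _ rfl rfl; exact add_zero 0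

variable {S} in
theorem cov_of_subsingleton {D : Set (Module.Dual K S.h)} (hp : S.Pointed) (hId : S.IsIdeal D)
    (hD : S.UpperFinite D) (n : ℕ) (Z : ModuleCat.{0} (UEA K g)) (hZ : Subsingleton Z) :
    Cov (fun M : ModuleCat.{0} (UEA K g) => S.WtIn (Res K g M) D ∧ S.FW (Res K g M))
      (fun M : ModuleCat.{0} (UEA K g) => S.WtIn (Res K g M) D) n Z := by
  have : Subsingleton (Res K g Z) := hZ
  have : FiniteDimensional K (Res K g Z) := inferInstance
  have := S.subsingleton_ind_of (Res K g Z)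
  refine Cov.of_equiv (V := ModuleCat.of (UEA K g) (S.Ind (Res K g Z))) (S.subQuot_wtIn_fw D)
    (0 : S.Ind (Res K g Z) ≃ₗ[UEA K g] Z)
    (cov_ind hp hId hD n (Res K g Z) fun f => ?_)
  rw [Subsingleton.elim f 0]
  exact zero_mem _

variable {S} in
theorem HasVermaFlag.cov {D : Set (Module.Dual K S.h)} (hp : S.Pointed) (hId : S.IsIdeal D)
    (hD : S.UpperFinite D) {X : ModuleCat.{0} (UEA K g)} (hX : S.WtIn (Res K g X) D)
    (h : S.HasVermaFlag X) (n : ℕ) :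
    Cov (fun M : ModuleCat.{0} (UEA K g) => S.WtIn (Res K g M) D ∧ S.FW (Res K g M))
      (fun M : ModuleCat.{0} (UEA K g) => S.WtIn (Res K g M) D) n X := by
  obtain ⟨m, F, h0, hl, hi⟩ := h
  refine flag_induction (subQuot_wtIn D) (fun Z hZ _ => cov_of_subsingleton hp hId hD n Z hZ)
    (fun E hE hQ => Cov.extension (fun _ h => h.1) (S.subQuot_wtIn_fw D) (subQuot_wtIn D)
      (S.extClosed_wtIn_fw D) E hE hQ) (fun e => Cov.of_equiv (S.subQuot_wtIn_fw D) e)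
    hX F h0 hl fun i => ?_
  obtain ⟨lam, -, ⟨e⟩⟩ := hi i
  have h1 : S.WtIn (Res K g (subquot (F i.castSucc) (F i.succ))) D :=
    (subQuot_wtIn D).quot (M := ModuleCat.of _ (F i.succ)) (N := ModuleCat.of _ (subquot _ _))
      (Submodule.mkQ _) (Submodule.mkQ_surjective _) ((subQuot_wtIn D).sub_sub _ hX)
  exact Cov.of_equiv (V := ModuleCat.of (UEA K g) (S.Verma lam)) (S.subQuot_wtIn_fw D) e.symm
    (cov_verma hp hId hD (h1.of_surjective (S.resb e.toLinearMap) e.surjective) n)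

end Verma

end RootReductive

section Duality

variable {A : Type} [Ring A]

namespace SES

/-- Replace the outer terms of a complex by isomorphic ones. -/
def tr {Z Z' X X' : ModuleCat.{0} A} (a : Z ≃ₗ[A] Z') (b : X ≃ₗ[A] X') (E : SES Z X) :
    SES Z' X' where
  M := E.M
  i := E.i ∘ₗ a.symm.toLinearMap
  p := b.toLinearMap ∘ₗ E.p
  zero z := (congrArg b (E.zero _)).trans (map_zero b)

theorem IsEx.tr {Z Z' X X' : ModuleCat.{0} A} (a : Z ≃ₗ[A] Z') (b : X ≃ₗ[A] X') {E : SES Z X}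
    (h : E.IsEx) : (E.tr a b).IsEx where
  inj := h.inj.comp a.symm.injective
  surj := b.surjective.comp h.surj
  ex m hm := by
    obtain ⟨z, rfl⟩ := h.ex m (b.map_eq_zero_iff.1 hm)
    exact ⟨a z, congrArg E.i (a.symm_apply_apply z)⟩

end SES

namespace YE

/-- Replace the outer terms of a spliced complex by isomorphic ones. -/
def tr {Y Y' : ModuleCat.{0} A} (a : Y ≃ₗ[A] Y') :
    ∀ {n : ℕ} {X X' : ModuleCat.{0} A}, (X ≃ₗ[A] X') → YE Y n X → YE Y' n X'
  | 0, _, _, b, E => SES.tr a b E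
  | _ + 1, _, _, b, E => ⟨E.1, E.2.1.tr (LinearEquiv.refl A _) b, tr a (LinearEquiv.refl A _) E.2.2⟩

theorem Ok.tr {P : ModuleCat.{0} A → Prop} {Y Y' : ModuleCat.{0} A} (a : Y ≃ₗ[A] Y') :
    ∀ {n : ℕ} {X X' : ModuleCat.{0} A} (b : X ≃ₗ[A] X') {E : YE Y n X}, E.Ok P → (E.tr a b).Ok P
  | 0, _, _, b, _, h => ⟨h.1.tr a b, h.2⟩
  | _ + 1, _, _, b, _, h => ⟨h.1.tr _ b, h.2.1, h.2.2.tr a _⟩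

theorem mor_tr {Y Y' : ModuleCat.{0} A} (a : Y ≃ₗ[A] Y') :
    ∀ {n : ℕ} {X X' : ModuleCat.{0} A} (b : X ≃ₗ[A] X') (E : YE Y n X),
      Mor a.toLinearMap E (E.tr a b) b.toLinearMap
  | 0, _, _, b, E => ⟨LinearMap.id, fun y => congrArg (SES.i E) (a.symm_apply_apply y).symm,
      fun _ => rfl⟩
  | _ + 1, _, _, b, E => ⟨LinearMap.id, LinearMap.id, fun _ => rfl, fun _ => rfl,
      mor_tr a (LinearEquiv.refl A _) E.2.2⟩

theorem mor_tr_symm {Y Y' : ModuleCat.{0} A} (a : Y ≃ₗ[A] Y') :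
    ∀ {n : ℕ} {X X' : ModuleCat.{0} A} (b : X ≃ₗ[A] X') (E : YE Y n X),
      Mor a.symm.toLinearMap (E.tr a b) E b.symm.toLinearMap
  | 0, _, _, b, E => ⟨LinearMap.id, fun _ => rfl, fun x => (b.symm_apply_apply _).symm⟩
  | _ + 1, _, _, b, E => ⟨LinearMap.id, LinearMap.id, fun _ => rfl,
      fun x => (b.symm_apply_apply _).symm, mor_tr_symm a (LinearEquiv.refl A _) E.2.2⟩

/-- Splice a complex at the left end. -/
def snoc {Y Z : ModuleCat.{0} A} (T : SES Y Z) :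
    ∀ {n : ℕ} {X : ModuleCat.{0} A}, YE Z n X → YE Y (n + 1) X
  | 0, _, E => ⟨Z, E, T⟩
  | _ + 1, _, E => ⟨E.1, E.2.1, snoc T E.2.2⟩

theorem Ok.snoc {P : ModuleCat.{0} A → Prop} {Y Z : ModuleCat.{0} A} {T : SES Y Z} (hT : T.IsEx)
    (hP : P T.M) : ∀ {n : ℕ} {X : ModuleCat.{0} A} {E : YE Z n X}, E.Ok P → (snoc T E).Ok P
  | 0, _, _, h => ⟨h.1, h.2, hT, hP⟩
  | _ + 1, _, _, h => ⟨h.1, h.2.1, h.2.2.snoc hT hP⟩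

theorem Mor.snoc {Y Y' Z Z' : ModuleCat.{0} A} {T : SES Y Z} {T' : SES Y' Z'} {ψ : Y →ₗ[A] Y'}
    {z : Z →ₗ[A] Z'} (m : T.M →ₗ[A] T'.M) (h1 : ∀ y, m (T.i y) = T'.i (ψ y))
    (h2 : ∀ x, T'.p (m x) = z (T.p x)) :
    ∀ {n : ℕ} {X X' : ModuleCat.{0} A} {E : YE Z n X} {E' : YE Z' n X'} {φ : X →ₗ[A] X'},
      Mor z E E' φ → Mor ψ (YE.snoc T E) (YE.snoc T' E') φ
  | 0, _, _, _, _, _, ⟨m', h1', h2'⟩ => ⟨m', z, h1', h2', m, h1, h2⟩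
  | _ + 1, _, _, _, _, _, ⟨m', z', h1', h2', h3'⟩ => ⟨m', z', h1', h2', h3'.snoc m h1 h2⟩

end YE

/-- A contravariant functor on modules with a natural map to its square, exact on the modules
satisfying `Q`. -/
structure DualFun (Q : ModuleCat.{0} A → Prop) where
  obj : ModuleCat.{0} A → ModuleCat.{0} A
  map : ∀ {M N : ModuleCat.{0} A}, (M →ₗ[A] N) → (obj N →ₗ[A] obj M)
  map_id : ∀ {M : ModuleCat.{0} A}, map (LinearMap.id : M →ₗ[A] M) = LinearMap.id
  map_comp : ∀ {M N L : ModuleCat.{0} A} (f : M →ₗ[A] N) (f' : N →ₗ[A] L),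
    map (f' ∘ₗ f) = map f ∘ₗ map f'
  map_zero : ∀ {M N : ModuleCat.{0} A}, map (0 : M →ₗ[A] N) = 0
  inj : ∀ {M N : ModuleCat.{0} A} (f : M →ₗ[A] N), Function.Surjective f →
    Function.Injective (map f)
  surj : ∀ {M N : ModuleCat.{0} A} (f : M →ₗ[A] N), Q N → Function.Injective f →
    Function.Surjective (map f)
  ex : ∀ {Z X : ModuleCat.{0} A} (E : SES Z X), E.IsEx → ∀ f : obj E.M, map E.i f = 0 →
    ∃ f', map E.p f' = f
  η : ∀ {M : ModuleCat.{0} A}, Q M → (M →ₗ[A] obj (obj M))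
  η_nat : ∀ {M N : ModuleCat.{0} A} (hM : Q M) (hN : Q N) (f : M →ₗ[A] N) (m : M),
    map (map f) (η hM m) = η hN (f m)
  prop : ∀ {M : ModuleCat.{0} A}, Q M → Q (obj M)

namespace DualFun

variable {Q : ModuleCat.{0} A → Prop} (D : DualFun Q)

theorem map_map {M N L : ModuleCat.{0} A} (f : M →ₗ[A] N) (f' : N →ₗ[A] L) (x : D.obj L) :
    D.map f (D.map f' x) = D.map (f' ∘ₗ f) x := by
  rw [D.map_comp]; rfl

theorem map_sq {M N N' L : ModuleCat.{0} A} {f : M →ₗ[A] N} {f' : N →ₗ[A] L} {k : M →ₗ[A] N'}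
    {k' : N' →ₗ[A] L} (h : ∀ m, f' (f m) = k' (k m)) (x : D.obj L) :
    D.map f (D.map f' x) = D.map k (D.map k' x) := by
  rw [D.map_map, D.map_map, show f' ∘ₗ f = k' ∘ₗ k from LinearMap.ext h]

/-- The dual of an isomorphism. -/
def mapEquiv {M N : ModuleCat.{0} A} (e : M ≃ₗ[A] N) : D.obj N ≃ₗ[A] D.obj M :=
  LinearEquiv.ofLinearMap (D.map e.toLinearMap) (D.map e.symm.toLinearMap)
    (by rw [← D.map_comp, LinearEquiv.symm_comp, D.map_id])
    (by rw [← D.map_comp, LinearEquiv.comp_symm, D.map_id])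

/-- The dual of a complex. -/
def ses {Z X : ModuleCat.{0} A} (E : SES Z X) : SES (D.obj X) (D.obj Z) where
  M := D.obj E.M
  i := D.map E.p
  p := D.map E.i
  zero z := by
    have : E.p ∘ₗ E.i = 0 := LinearMap.ext E.zero
    rw [D.map_map, this, D.map_zero]; rfl

theorem ses_isEx {Z X : ModuleCat.{0} A} {E : SES Z X} (h : E.IsEx) (hQ : Q E.M) :
    (D.ses E).IsEx :=
  ⟨D.inj _ h.surj, D.surj _ hQ h.inj, D.ex E h⟩

/-- The dual of a spliced complex. -/
def ye {Y : ModuleCat.{0} A} :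
    ∀ {n : ℕ} {X : ModuleCat.{0} A}, YE Y n X → YE (D.obj X) n (D.obj Y)
  | 0, _, E => D.ses E
  | _ + 1, _, E => YE.snoc (D.ses E.2.1) (ye E.2.2)

theorem ye_ok {P : ModuleCat.{0} A → Prop} (hPQ : ∀ M, P M → Q M)
    (hP : ∀ M, P M → P (D.obj M)) {Y : ModuleCat.{0} A} :
    ∀ {n : ℕ} {X : ModuleCat.{0} A} {E : YE Y n X}, E.Ok P → (D.ye E).Ok P
  | 0, _, _, h => ⟨D.ses_isEx h.1 (hPQ _ h.2), hP _ h.2⟩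
  | _ + 1, _, _, h => (ye_ok hPQ hP h.2.2).snoc (D.ses_isEx h.1 (hPQ _ h.2.1)) (hP _ h.2.1)

theorem ye_mor {Y Y' : ModuleCat.{0} A} {ψ : Y →ₗ[A] Y'} :
    ∀ {n : ℕ} {X X' : ModuleCat.{0} A} {E : YE Y n X} {E' : YE Y' n X'} {φ : X →ₗ[A] X'},
      YE.Mor ψ E E' φ → YE.Mor (D.map φ) (D.ye E') (D.ye E) (D.map ψ)
  | 0, _, _, _, _, _, ⟨m, h1, h2⟩ => ⟨D.map m, D.map_sq h2, D.map_sq h1⟩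
  | _ + 1, _, _, _, _, _, ⟨m, _, h1, h2, h3⟩ =>
    (ye_mor h3).snoc (D.map m) (D.map_sq h2) (D.map_sq h1)

theorem ye_snoc {Y Z : ModuleCat.{0} A} (T : SES Y Z) :
    ∀ {n : ℕ} {X : ModuleCat.{0} A} (E : YE Z n X),
      D.ye (YE.snoc T E) = ⟨D.obj Z, D.ses T, D.ye E⟩
  | 0, _, _ => rfl
  | n + 1, _, E => by
    change YE.snoc (D.ses E.2.1) (D.ye (YE.snoc T E.2.2)) = _
    rw [ye_snoc T E.2.2]; rfl

theorem mor_ye_ye (hQ : SubQuot Q) {Y : ModuleCat.{0} A} (hY : Q Y) :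
    ∀ {n : ℕ} {X : ModuleCat.{0} A} (hX : Q X) (E : YE Y n X), E.Ok Q →
      YE.Mor (D.η hY) E (D.ye (D.ye E)) (D.η hX)
  | 0, _, hX, E, h => ⟨D.η h.2, fun y => (D.η_nat hY h.2 (SES.i E) y).symm,
      fun x => D.η_nat h.2 hX (SES.p E) x⟩
  | n + 1, _, hX, E, h => by
    change YE.Mor _ E (D.ye (YE.snoc (D.ses E.2.1) (D.ye E.2.2))) _
    rw [ye_snoc]
    have hZ : Q E.1 := hQ.sub E.2.1.i h.1.inj h.2.1
    exact ⟨D.η h.2.1, D.η hZ, fun y => (D.η_nat hZ h.2.1 E.2.1.i y).symm,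
      fun x => D.η_nat h.2.1 hX E.2.1.p x, mor_ye_ye hQ hY hZ E.2.2 h.2.2⟩

theorem bijective_yextFamMap {P : ModuleCat.{0} A → Prop} (hPQ : ∀ M, P M → Q M)
    (hQ : SubQuot Q) (hext : ExtClosed P Q) (hP : ∀ M, P M → P (D.obj M))
    (hη : ∀ M (h : P M), Function.Bijective (D.η (hPQ M h))) {X Y : ModuleCat.{0} A}
    (hX : P X) (hY : P Y)
    (hc : ∀ n, Cov P Q n (D.obj Y)) (i : ℕ) :
    Function.Bijective (yextFamMap A hPQ (X := X) (Y := Y) i) := by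
  let a := (LinearEquiv.ofBijective (D.η (hPQ Y hY)) (hη Y hY)).symm
  let b := (LinearEquiv.ofBijective (D.η (hPQ X hX)) (hη X hX)).symm
  have ha : a.toLinearMap ∘ₗ D.η (hPQ Y hY) = LinearMap.id :=
    LinearMap.ext (LinearEquiv.ofBijective (D.η (hPQ Y hY)) (hη Y hY)).symm_apply_apply
  have hb : b.toLinearMap ∘ₗ D.η (hPQ X hX) = LinearMap.id :=
    LinearMap.ext (LinearEquiv.ofBijective (D.η (hPQ X hX)) (hη X hX)).symm_apply_apply
  have hu : ∀ {n : ℕ} (E : YE Y n X), E.Ok Q →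
      YE.Mor LinearMap.id E ((D.ye (D.ye E)).tr a b) LinearMap.id := fun E hE => by
    have := (D.mor_ye_ye hQ (hPQ Y hY) (hPQ X hX) E hE).comp (YE.mor_tr a b _)
    rwa [ha, hb] at this
  have hG : ∀ {R : ModuleCat.{0} A → Prop}, (∀ M, R M → Q M) → (∀ M, R M → R (D.obj M)) →
      ∀ {n : ℕ} {E F : YE (D.obj X) n (D.obj Y)}, YE.Eqv R E F →
        YE.Eqv R ((D.ye E).tr a b) ((D.ye F).tr a b) := fun hRQ hR n E F h => by
    refine (YE.Eqv.map (fun E => (D.ye E).tr a b) (fun E F hE hF hm => ?_) h)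
    have h1 := ((YE.mor_tr_symm a b (D.ye F)).comp (D.ye_mor hm)).comp (YE.mor_tr a b (D.ye E))
    rw [D.map_id, D.map_id, LinearMap.id_comp, LinearMap.id_comp, LinearEquiv.comp_symm,
      LinearEquiv.comp_symm] at h1
    exact (YE.Eqv.of_mor ((D.ye_ok hRQ hR hF).tr a b) ((D.ye_ok hRQ hR hE).tr a b) h1).symm
  have hD : ∀ {R : ModuleCat.{0} A → Prop}, (∀ M, R M → Q M) → (∀ M, R M → R (D.obj M)) →
      ∀ {n : ℕ} {E F : YE Y n X}, YE.Eqv R E F → YE.Eqv R (D.ye E) (D.ye F) :=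
    fun hRQ hR n E F h => by
    refine (YE.Eqv.map (fun E => D.ye E) (fun E F hE hF hm => ?_) h)
    have h1 := D.ye_mor hm
    rw [D.map_id, D.map_id] at h1
    exact (YE.Eqv.of_mor (D.ye_ok hRQ hR hF) (D.ye_ok hRQ hR hE) h1).symm
  have hR : ∀ {R : ModuleCat.{0} A → Prop}, (∀ M, R M → Q M) → (∀ M, R M → R (D.obj M)) →
      ∀ {n : ℕ} {E : YE Y n X}, E.Ok R → YE.Eqv R E ((D.ye (D.ye E)).tr a b) :=
    fun hRQ hR n E hE => YE.Eqv.of_mor hE ((D.ye_ok hRQ hR (D.ye_ok hRQ hR hE)).tr a b) (hu E (hE.mono hRQ))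
  have hQQ : ∀ M, Q M → Q (D.obj M) := fun M => D.prop
  refine _root_.bijective_yextFamMap hPQ hX hY (fun n E hE => ?_) (fun n E F hE hF h => ?_) i
  · obtain ⟨F, hF, h⟩ := YE.exists_eqv_of_cov hPQ hQ hext (hP X hX) (hc n) (D.ye E)
      (D.ye_ok (fun _ h => h) hQQ hE)
    exact ⟨(D.ye F).tr a b, (D.ye_ok hPQ hP hF).tr a b,
      (hR (fun _ h => h) hQQ hE).trans _ _ _ (hG (fun _ h => h) hQQ h)⟩
  · have h1 := YE.eqv_of_cov hPQ hQ hext (hP X hX) (hc n) _ _ (D.ye_ok hPQ hP hE)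
      (D.ye_ok hPQ hP hF) (hD (fun _ h => h) hQQ h)
    exact (hR hPQ hP hE).trans _ _ _ ((hG hPQ hP h1).trans _ _ _ (hR hPQ hP hF).symm)

end DualFun

end Duality

namespace RootReductive

section Dual

/-- The full dual of a module, with the action twisted by the anti-involution. -/
def TD (_ : RootReductive K g) (M : Type) [AddCommGroup M] [Module (UEA K g) M] : Type :=
  Module.Dual K (Res K g M)

variable (S : RootReductive K g) (M : Type) {N L : Type} [AddCommGroup M] [Module (UEA K g) M]
  [AddCommGroup N] [Module (UEA K g) N] [AddCommGroup L] [Module (UEA K g) L]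

instance : AddCommGroup (S.TD M) := inferInstanceAs (AddCommGroup (Module.Dual K (Res K g M)))
instance : Module K (S.TD M) := inferInstanceAs (Module K (Module.Dual K (Res K g M)))
instance : LieRingModule g (S.TD M) where
  bracket x f := (show Module.Dual K (Res K g M) from f) ∘ₗ
    (LieModule.toEnd K g (Res K g M) (S.τ x) : Module.End K (Res K g M))
  add_lie x y f := LinearMap.ext fun m => by
    change (show Module.Dual K (Res K g M) from f) ⁅S.τ (x + y), m⁆ =
      (show Module.Dual K (Res K g M) from f) ⁅S.τ x, m⁆ +
        (show Module.Dual K (Res K g M) from f) ⁅S.τ y, m⁆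
    rw [map_add, add_lie, map_add]
  lie_add _ _ _ := rfl
  leibniz_lie x y f := LinearMap.ext fun m => by
    change (show Module.Dual K (Res K g M) from f) ⁅S.τ y, ⁅S.τ x, m⁆⁆ =
      (show Module.Dual K (Res K g M) from f) ⁅S.τ ⁅x, y⁆, m⁆ +
        (show Module.Dual K (Res K g M) from f) ⁅S.τ x, ⁅S.τ y, m⁆⁆
    rw [← map_add, S.τ_anti, leibniz_lie (S.τ y)]
instance : LieModule K g (S.TD M) where
  smul_lie c x f := LinearMap.ext fun m => by
    change (show Module.Dual K (Res K g M) from f) ⁅S.τ (c • x), m⁆ =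
      c • (show Module.Dual K (Res K g M) from f) ⁅S.τ x, m⁆
    rw [map_smul, smul_lie, map_smul]
  lie_smul _ _ _ := rfl
instance : Module (UEA K g) (S.TD M) := lieUEA K g (S.TD M)

theorem mem_wtSum_adh (x : g) : x ∈ wtSum S.adh Set.univ := by
  rw [← S.pm_add_pb x]
  refine add_mem (wtSum_mono (D := -S.Φp) (Set.subset_univ _) ?_)
    (wtSum_mono (D := insert 0 S.Φp) (Set.subset_univ _) (S.b_le (S.pb x).2))
  rw [← S.nm_eq]
  exact (S.pm x).2

/-- The `h`-finite part of the full dual. -/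
def hfin : Submodule (UEA K g) (S.TD M) :=
  ueaSub (wtSum (S.rb (Res K g (S.TD M))) Set.univ).toAddSubgroup
    (fun c _ hm => Submodule.smul_mem _ c hm)
    (fun x _ hm => S.lie_mem_wtSum (fun _ _ _ _ => Set.mem_univ _) (S.mem_wtSum_adh x) hm)

theorem wtIn_hfin : S.WtIn (Res K g (S.hfin M)) Set.univ := fun f =>
  S.mem_wtSum_of_injective (S.resb (S.hfin M).subtype) Subtype.val_injective
    (show (show S.hfin M from f).1 ∈ S.hfin M from (show S.hfin M from f).2)

/-- Evaluation of functionals. -/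
def ev : Res K g (S.hfin M) →ₗ[K] Module.Dual K (Res K g M) where
  toFun f := (show S.hfin M from f).1
  map_add' _ _ := rfl
  map_smul' c f := lieUEA_algebraMap c (show S.hfin M from f).1

theorem ev_injective : Function.Injective (S.ev M) := Subtype.val_injective

variable {M}

theorem ev_lie (x : g) (f : Res K g (S.hfin M)) (m : Res K g M) :
    S.ev M ⁅x, f⁆ m = S.ev M f ⁅S.τ x, m⁆ :=
  congrArg (fun f' : Module.Dual K (Res K g M) => f' m) (lieUEA_ι x (show S.hfin M from f).1)

theorem mem_wt_hfin {χ : Module.Dual K S.h} {f : Res K g (S.hfin M)} :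
    f ∈ wt (S.rb (Res K g (S.hfin M))) χ ↔
      ∀ (H : S.h) (m : Res K g M), S.ev M f ⁅(H : g), m⁆ = χ H * S.ev M f m := by
  rw [mem_wt]
  refine forall_congr' fun H => ?_
  rw [← (S.ev_injective M).eq_iff, LinearMap.ext_iff]
  refine forall_congr' fun m => ?_
  rw [map_smul]
  change S.ev M ⁅(H : g), f⁆ m = _ ↔ _
  rw [ev_lie, S.τ_h H H.2]
  rfl

theorem exists_ev {χ : Module.Dual K S.h} (φ : Module.Dual K (Res K g M))
    (h : ∀ (H : S.h) (m : Res K g M), φ ⁅(H : g), m⁆ = χ H * φ m) :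
    ∃ f ∈ wt (S.rb (Res K g (S.hfin M))) χ, S.ev M f = φ := by
  have h1 : (show Res K g (S.TD M) from φ) ∈ wt (S.rb (Res K g (S.TD M))) χ := by
    refine mem_wt.2 fun H => ?_
    have e1 : ι K (H : g) • (show S.TD M from φ) = ⁅(H : g), (show S.TD M from φ)⁆ :=
      lieUEA_ι _ _
    have e2 : algebraMap K (UEA K g) (χ H) • (show S.TD M from φ) = χ H • (show S.TD M from φ) :=
      lieUEA_algebraMap _ _
    have e3 : ⁅(H : g), (show S.TD M from φ)⁆ = χ H • (show S.TD M from φ) :=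
      LinearMap.ext fun m => by
        change φ ⁅S.τ H, m⁆ = χ H * φ m
        rw [S.τ_h H H.2, h]
    exact e1.trans (e3.trans e2.symm)
  have h2 := wt_le_wtSum (D := Set.univ) (Set.mem_univ χ) h1
  exact ⟨(⟨φ, h2⟩ : S.hfin M), S.mem_wt_hfin.2 h, rfl⟩

theorem ev_eq_zero {χ χ' : Module.Dual K S.h} (h : χ ≠ χ') {f : Res K g (S.hfin M)}
    (hf : f ∈ wt (S.rb (Res K g (S.hfin M))) χ) {m : Res K g M}
    (hm : m ∈ wt (S.rb (Res K g M)) χ') : S.ev M f m = 0 := by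
  obtain ⟨H, hH⟩ : ∃ H, χ H ≠ χ' H := by
    by_contra! h'; exact h (LinearMap.ext h')
  have h1 := S.mem_wt_hfin.1 hf H m
  have h2 : ⁅(H : g), m⁆ = χ' H • m := mem_wt.1 hm H
  rw [h2, map_smul, smul_eq_mul] at h1
  have h3 : (χ' H - χ H) * S.ev M f m = 0 := by rw [sub_mul, h1, sub_self]
  exact (mul_eq_zero.1 h3).resolve_left (sub_ne_zero.2 hH.symm)

section

variable {F : Type} [AddCommGroup F] [Module K F] [LieRingModule S.b F] [LieModule K S.b F]

variable {S} in
theorem WtIn.hom_ext {W : Type} [AddCommGroup W] [Module K W] {D : Set (Module.Dual K S.h)}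
    (hF : S.WtIn F D) {φ φ' : F →ₗ[K] W} (h : ∀ χ, ∀ f ∈ wt (S.rb F) χ, φ f = φ' f) : φ = φ' := by
  have h1 : wtSum (S.rb F) D ≤ LinearMap.eqLocus φ φ' := wtSum_le.2 fun χ _ f hf => h χ f hf
  exact LinearMap.ext fun f => h1 (hF f)

variable {S} in
theorem WtIn.exists_proj (hF : S.WtIn F Set.univ) (χ : Module.Dual K S.h) :
    ∃ π : F →ₗ[K] F, (∀ f ∈ wt (S.rb F) χ, π f = f) ∧
      ∀ χ' ≠ χ, ∀ f ∈ wt (S.rb F) χ', π f = 0 := by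
  have h : IsCompl (wt (S.rb F) χ) (wtSum (S.rb F) {χ}ᶜ) := by
    have h0 : wtSum (S.rb F) {χ} = wt (S.rb F) χ := by simp [wtSum]
    refine ⟨h0 ▸ wtSum_disjoint disjoint_compl_right, codisjoint_iff.2 (eq_top_iff.2 fun f _ => ?_)⟩
    have := hF f
    rwa [← Set.union_compl_self {χ}, wtSum_union, h0] at this
  refine ⟨(wt (S.rb F) χ).subtype ∘ₗ Submodule.projectionOnto _ _ h, fun f hf => ?_,
    fun χ' h' f hf => ?_⟩
  · exact congrArg Subtype.val (Submodule.projectionOnto_apply_left h ⟨f, hf⟩)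
  · exact congrArg Subtype.val ((Submodule.projectionOnto_apply_eq_zero_iff h).2
      (wt_le_wtSum (D := {χ}ᶜ) h' hf))

end

variable {S} in
theorem WtIn.exists_ev {D : Set (Module.Dual K S.h)} (hM : S.WtIn (Res K g M) D)
    {χ : Module.Dual K S.h} (φ : Module.Dual K (Res K g M))
    (h : ∀ χ' ≠ χ, ∀ m ∈ wt (S.rb (Res K g M)) χ', φ m = 0) :
    ∃ f ∈ wt (S.rb (Res K g (S.hfin M))) χ, S.ev M f = φ := by
  refine S.exists_ev φ fun H => LinearMap.congr_fun
    (f := φ ∘ₗ (LieModule.toEnd K g (Res K g M) (H : g) : Module.End K (Res K g M)))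
    (g := χ H • φ) (hM.hom_ext fun χ' m hm => ?_)
  have h2 : ⁅(H : g), m⁆ = χ' H • m := mem_wt.1 hm H
  change φ ⁅(H : g), m⁆ = χ H * φ m
  rw [h2, map_smul, smul_eq_mul]
  by_cases hc : χ' = χ
  · rw [hc]
  · rw [h χ' hc m hm, mul_zero, mul_zero]

variable {S} in
/-- A functional on a weight space, extended by zero. -/
theorem WtIn.exists_ev_of {D : Set (Module.Dual K S.h)} (hM : S.WtIn (Res K g M) D)
    (χ : Module.Dual K S.h) (φ : Module.Dual K (Res K g M)) :
    ∃ f ∈ wt (S.rb (Res K g (S.hfin M))) χ, ∀ m ∈ wt (S.rb (Res K g M)) χ, S.ev M f m = φ m := by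
  obtain ⟨π, h1, h2⟩ := (hM.mono (Set.subset_univ D)).exists_proj χ
  obtain ⟨f, hf, h⟩ := hM.exists_ev (χ := χ) (φ ∘ₗ π) fun χ' h' m hm => by
    change φ (π m) = 0
    rw [h2 χ' h' m hm, map_zero]
  exact ⟨f, hf, fun m hm => by rw [h]; exact congrArg φ (h1 m hm)⟩

theorem eq_zero_of_ev {D : Set (Module.Dual K S.h)} (hM : S.WtIn (Res K g M) D) {m : Res K g M}
    (h : ∀ f : Res K g (S.hfin M), S.ev M f m = 0) : m = 0 := by
  obtain ⟨s, v, -, hv, rfl⟩ := exists_sum_of_mem_wtSum (hM m)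
  refine Finset.sum_eq_zero fun χ hχ => ?_
  by_contra h0
  obtain ⟨φ, hφ⟩ : ∃ φ : Module.Dual K (Res K g M), φ (v χ) ≠ 0 := by
    by_contra! h'
    exact h0 ((Module.forall_dual_apply_eq_zero_iff K _).1 h')
  obtain ⟨f, hf, h1⟩ := hM.exists_ev_of χ φ
  refine hφ ?_
  rw [← h1 _ (hv χ), ← h f, map_sum]
  exact (Finset.sum_eq_single χ (fun χ' _ hc => S.ev_eq_zero hc.symm hf (hv χ'))
    fun h' => absurd hχ h').symm

variable {S} in
theorem WtIn.hfin {D : Set (Module.Dual K S.h)} (hM : S.WtIn (Res K g M) D) :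
    S.WtIn (Res K g (S.hfin M)) D := fun f => by
  have h1 : wtSum (S.rb (Res K g (S.hfin M))) Set.univ ≤ wtSum (S.rb (Res K g (S.hfin M))) D := by
    refine wtSum_le.2 fun χ _ f hf => ?_
    by_cases hχ : χ ∈ D
    · exact wt_le_wtSum hχ hf
    · have : wtSum (S.rb (Res K g M)) D ≤ LinearMap.ker (S.ev M f) := wtSum_le.2
        fun χ' h' m hm => S.ev_eq_zero (by rintro rfl; exact hχ h') hf hm
      have e : S.ev M f = 0 := LinearMap.ext fun m => LinearMap.mem_ker.1 (this (hM m))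
      rw [S.ev_injective M (e.trans (map_zero _).symm)]
      exact zero_mem _
  exact h1 (S.wtIn_hfin M f)

/-- Restriction of functionals to a weight space. -/
def evWt (χ : Module.Dual K S.h) :
    wt (S.rb (Res K g (S.hfin M))) χ →ₗ[K] Module.Dual K (wt (S.rb (Res K g M)) χ) :=
  (Submodule.dualRestrict _) ∘ₗ S.ev M ∘ₗ Submodule.subtype _

variable {S} in
theorem WtIn.evWt_injective {D : Set (Module.Dual K S.h)} (hM : S.WtIn (Res K g M) D)
    (χ : Module.Dual K S.h) : Function.Injective (S.evWt (M := M) χ) := by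
  refine (injective_iff_map_eq_zero _).2 fun f hf => Subtype.ext (S.ev_injective M ?_)
  refine (hM.hom_ext fun χ' m hm => ?_).trans (map_zero _).symm
  by_cases hc : χ = χ'
  · subst hc
    exact LinearMap.congr_fun hf ⟨m, hm⟩
  · exact S.ev_eq_zero hc f.2 hm

variable {S} in
theorem FW.hfin (hF : S.FW (Res K g M)) {D : Set (Module.Dual K S.h)}
    (hM : S.WtIn (Res K g M) D) : S.FW (Res K g (S.hfin M)) := fun χ => by
  have : FiniteDimensional K (wt (S.rb (Res K g M)) χ) := Module.Finite.of_fg (hF χ)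
  have : FiniteDimensional K (wt (S.rb (Res K g (S.hfin M))) χ) :=
    FiniteDimensional.of_injective _ (hM.evWt_injective χ)
  exact Module.Finite.iff_fg.1 this

end Dual

end RootReductive

namespace RootReductive

section DualMap

variable {S : RootReductive K g} {M N L : Type} [AddCommGroup M] [Module (UEA K g) M]
  [AddCommGroup N] [Module (UEA K g) N] [AddCommGroup L] [Module (UEA K g) L]

/-- The homomorphism into the dual defined by a contravariant pairing. -/
def toTD (p : Res K g L →ₗ[K] Module.Dual K (Res K g M))
    (hp : ∀ (x : g) l m, p ⁅x, l⁆ m = p l ⁅S.τ x, m⁆) : L →ₗ[UEA K g] S.TD M :=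
  ueaHom (N := S.TD M) p.toAddMonoidHom
    (fun c m => by
      have e1 : (algebraMap K (UEA K g) c) • (show S.TD M from p m) = c • (show S.TD M from p m) :=
        lieUEA_algebraMap c (show S.TD M from p m)
      exact Eq.trans (p.map_smul c m) e1.symm)
    (fun x m => by
      have e1 : ι K x • (show S.TD M from p m) = ⁅x, (show S.TD M from p m)⁆ :=
        lieUEA_ι x (show S.TD M from p m)
      have e2 : (show S.TD M from p ⁅x, m⁆) = ⁅x, (show S.TD M from p m)⁆ :=
        LinearMap.ext (hp x m)
      exact e2.trans e1.symm)

/-- The homomorphism of a weight module into the `h`-finite dual defined by a contravariant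
pairing. -/
def toHfin (hL : S.WtIn (Res K g L) Set.univ) (p : Res K g L →ₗ[K] Module.Dual K (Res K g M))
    (hp : ∀ (x : g) l m, p ⁅x, l⁆ m = p l ⁅S.τ x, m⁆) : L →ₗ[UEA K g] S.hfin M :=
  LinearMap.codRestrict (S.hfin M) (toTD p hp) fun l =>
    S.hom_mem_wtSum (S.resb (toTD p hp)) (hL l)

theorem ev_toHfin (hL : S.WtIn (Res K g L) Set.univ)
    (p : Res K g L →ₗ[K] Module.Dual K (Res K g M))
    (hp : ∀ (x : g) l m, p ⁅x, l⁆ m = p l ⁅S.τ x, m⁆) (l : L) :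
    S.ev M (toHfin hL p hp l) = p l := rfl

variable (S) in
/-- The transpose of a homomorphism on the full duals. -/
def tdMap (f : M →ₗ[UEA K g] N) : S.TD N →ₗ[UEA K g] S.TD M :=
  toTD (L := S.TD N)
    { toFun := fun φ => (show Module.Dual K (Res K g N) from φ) ∘ₗ
        (resMap (K := K) f : Res K g M →ₗ[K] Res K g N)
      map_add' := fun _ _ => rfl
      map_smul' := fun c φ => by
        have e1 : (algebraMap K (UEA K g) c) • (show S.TD N from φ) = c • (show S.TD N from φ) :=
          lieUEA_algebraMap c (show S.TD N from φ)
        exact LinearMap.ext fun m => LinearMap.congr_fun e1 (resMap (K := K) f m) }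
    fun x φ m => by
      have e1 : ι K x • (show S.TD N from φ) = ⁅x, (show S.TD N from φ)⁆ :=
        lieUEA_ι x (show S.TD N from φ)
      exact (LinearMap.congr_fun e1 (resMap (K := K) f m)).trans
        (congrArg (show Module.Dual K (Res K g N) from φ)
          ((resMap (K := K) f).map_lie (S.τ x) m).symm)

variable (S) in
/-- The transpose of a homomorphism. -/
def hfinMap (f : M →ₗ[UEA K g] N) : S.hfin N →ₗ[UEA K g] S.hfin M :=
  toHfin (S.wtIn_hfin N)
    ((LinearMap.lcomp K K (resMap (K := K) f : Res K g M →ₗ[K] Res K g N)) ∘ₗ S.ev N)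
    fun x l m => by
      change S.ev N ⁅x, l⁆ (resMap f m) = S.ev N l (resMap f ⁅S.τ x, m⁆)
      rw [ev_lie, LieModuleHom.map_lie]

theorem ev_hfinMap (f : M →ₗ[UEA K g] N) (θ : S.hfin N) (m : M) :
    S.ev M (S.hfinMap f θ) m = S.ev N θ (f m) := rfl

/-- The evaluation of functionals at a vector. -/
def toDD (hM : S.WtIn (Res K g M) Set.univ) : M →ₗ[UEA K g] S.hfin (S.hfin M) :=
  toHfin hM (LinearMap.flip (S.ev M)) fun x m f => by
    change S.ev M f ⁅x, m⁆ = S.ev M ⁅S.τ x, f⁆ m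
    rw [ev_lie, S.τ_invol]

theorem ev_toDD (hM : S.WtIn (Res K g M) Set.univ) (m : M) (f : S.hfin M) :
    S.ev (S.hfin M) (toDD hM m) f = S.ev M f m := rfl

theorem hfin_ext {f f' : S.hfin M} (h : ∀ m : M, S.ev M f m = S.ev M f' m) : f = f' :=
  S.ev_injective M (LinearMap.ext h)

theorem hfinMap_injective (f : M →ₗ[UEA K g] N) (hf : Function.Surjective f) :
    Function.Injective (S.hfinMap f) := fun θ θ' h => hfin_ext fun n => by
  obtain ⟨m, rfl⟩ := hf n
  rw [← ev_hfinMap, ← ev_hfinMap, h]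

theorem hfinMap_surjective (f : M →ₗ[UEA K g] N) (hf : Function.Injective f)
    {D : Set (Module.Dual K S.h)} (hN : S.WtIn (Res K g N) D) :
    Function.Surjective (S.hfinMap f) := by
  have hM : S.WtIn (Res K g M) D := hN.of_injective (S.resb f) hf
  obtain ⟨r, hr⟩ := LinearMap.exists_leftInverse_of_injective
    (resMap (K := K) f : Res K g M →ₗ[K] Res K g N) (LinearMap.ker_eq_bot.2 hf)
  have h1 : wtSum (S.rb (Res K g (S.hfin M))) Set.univ ≤
      LinearMap.range (resMap (K := K) (S.hfinMap f) :
        Res K g (S.hfin N) →ₗ[K] Res K g (S.hfin M)) := by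
    refine wtSum_le.2 fun χ _ θ hθ => ?_
    obtain ⟨θ', h', h2⟩ := hN.exists_ev_of χ (S.ev M θ ∘ₗ r)
    refine ⟨θ', S.ev_injective M (hM.hom_ext fun χ' m hm => ?_)⟩
    have hm' : S.resb f m ∈ wt (S.rb (Res K g N)) χ' := hom_mem_wt (S.resb f) hm
    change S.ev N θ' (S.resb f m) = S.ev M θ m
    by_cases hc : χ = χ'
    · subst hc
      rw [h2 _ hm']
      exact congrArg (S.ev M θ) (LinearMap.congr_fun hr m)
    · rw [S.ev_eq_zero hc h' hm', S.ev_eq_zero hc hθ hm]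
  exact fun θ => h1 (S.wtIn_hfin M θ)

theorem exists_hfinMap_eq {f : L →ₗ[UEA K g] M} {p : M →ₗ[UEA K g] N}
    (hp : Function.Surjective p) (hex : ∀ m, p m = 0 → ∃ l, f l = m) {θ : S.hfin M}
    (h : S.hfinMap f θ = 0) : ∃ θ', S.hfinMap p θ' = θ := by
  obtain ⟨r, hr⟩ := LinearMap.exists_rightInverse_of_surjective
    (resMap (K := K) p : Res K g M →ₗ[K] Res K g N) (LinearMap.range_eq_top.2 hp)
  have h0 : ∀ m, p m = 0 → S.ev M θ m = 0 := fun m hm => by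
    obtain ⟨l, rfl⟩ := hex m hm
    rw [← ev_hfinMap, h]
    exact LinearMap.congr_fun (map_zero (S.ev L)) l
  have h1 : ∀ m : Res K g M, S.ev M θ (r (resMap p m)) = S.ev M θ m := fun m => by
    rw [← sub_eq_zero, ← map_sub]
    refine h0 _ ((map_sub p _ _).trans (sub_eq_zero.2 ?_))
    exact LinearMap.congr_fun hr (resMap p m)
  let θ₁ : Module.Dual K (Res K g N) := S.ev M θ ∘ₗ r
  have hP : Function.Injective (S.tdMap p) := fun φ φ' hφ => LinearMap.ext fun n => by
    obtain ⟨m, rfl⟩ := hp n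
    exact LinearMap.congr_fun hφ m
  have h2 : S.tdMap p θ₁ = θ.1 := LinearMap.ext h1
  have h4 := θ.2
  rw [← h2] at h4
  have h3 := S.mem_wtSum_of_injective (S.resb (S.tdMap p)) hP h4
  exact ⟨(⟨θ₁, h3⟩ : S.hfin N), Subtype.ext h2⟩

theorem toDD_injective (hM : S.WtIn (Res K g M) Set.univ) : Function.Injective (toDD hM) := by
  refine (injective_iff_map_eq_zero _).2 fun m hm => S.eq_zero_of_ev hM fun f => ?_
  have h := ev_toDD hM m f
  rw [hm] at h
  exact h.symm.trans (LinearMap.congr_fun (map_zero (S.ev (S.hfin M))) f)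

theorem toDD_bijective (hM : S.WtIn (Res K g M) Set.univ) (hF : S.FW (Res K g M)) :
    Function.Bijective (toDD hM) := by
  refine ⟨toDD_injective hM, fun θ => ?_⟩
  have h1 : wtSum (S.rb (Res K g (S.hfin (S.hfin M)))) Set.univ ≤
      LinearMap.range (resMap (K := K) (toDD hM) :
        Res K g M →ₗ[K] Res K g (S.hfin (S.hfin M))) := by
    refine wtSum_le.2 fun χ _ => ?_
    let E := (resMap (K := K) (toDD hM) : Res K g M →ₗ[K] Res K g (S.hfin (S.hfin M)))
    have f0 : FiniteDimensional K (wt (S.rb (Res K g M)) χ) := Module.Finite.of_fg (hF χ)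
    have f1 : FiniteDimensional K (wt (S.rb (Res K g (S.hfin M))) χ) :=
      Module.Finite.of_fg (hF.hfin hM χ)
    have f2 : FiniteDimensional K (wt (S.rb (Res K g (S.hfin (S.hfin M)))) χ) :=
      Module.Finite.of_fg ((hF.hfin hM).hfin hM.hfin χ)
    have d1 := LinearMap.finrank_le_finrank_of_injective (hM.evWt_injective χ)
    have d2 := LinearMap.finrank_le_finrank_of_injective (hM.hfin.evWt_injective χ)
    rw [Subspace.dual_finrank_eq] at d1 d2
    have hle : (wt (S.rb (Res K g M)) χ).map E ≤ wt (S.rb (Res K g (S.hfin (S.hfin M)))) χ := by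
      rintro _ ⟨m, hm, rfl⟩
      exact hom_mem_wt (S.resb (toDD hM)) hm
    have d3 : Module.finrank K ((wt (S.rb (Res K g M)) χ).map E) =
        Module.finrank K (wt (S.rb (Res K g M)) χ) :=
      (Submodule.equivMapOfInjective E (toDD_injective hM) _).finrank_eq.symm
    rw [← Submodule.eq_of_le_of_finrank_le hle (by rw [d3]; exact d2.trans d1)]
    exact LinearMap.map_le_range
  exact h1 (S.wtIn_hfin _ θ)

/-- The `h`-finite dual as a duality of categories of modules with weights in `D`. -/
def dualFun (S : RootReductive K g) (D : Set (Module.Dual K S.h)) :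
    DualFun fun M : ModuleCat.{0} (UEA K g) => S.WtIn (Res K g M) D where
  obj M := ModuleCat.of (UEA K g) (S.hfin M)
  map f := S.hfinMap f
  map_id := rfl
  map_comp _ _ := rfl
  map_zero := LinearMap.ext fun θ => hfin_ext fun _ => map_zero (S.ev _ θ)
  inj f hf := hfinMap_injective f hf
  surj f hQ hf := hfinMap_surjective f hf hQ
  ex _ hE _ h := exists_hfinMap_eq hE.surj hE.ex h
  η hM := toDD (hM.mono (Set.subset_univ D))
  η_nat _ _ _ _ := rfl
  prop h := WtIn.hfin h

end DualMap

end RootReductive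

namespace RootReductive

section VermaStructure

variable {S : RootReductive K g} {lam : Module.Dual K S.h}

theorem verma_eq_top {W : Submodule K (Res K g (S.Verma lam))} (h0 : S.vgen lam ∈ W)
    (hx : ∀ x ∈ S.nm, ∀ w ∈ W, ⁅x, w⁆ ∈ W) : W = ⊤ := by
  refine eq_top_iff.2 fun v _ => ?_
  obtain ⟨m, rfl⟩ := (S.vermaEquiv lam).surjective v
  refine S.ind_induction (p := fun m => (S.vermaEquiv lam m : Res K g (S.Verma lam)) ∈ W)
    (fun l => ?_) (fun x m hm => ?_) (fun a b ha hb => ?_) (fun c m hm => ?_) m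
  · obtain ⟨c, rfl⟩ := S.exists_smul_vgenL lam l
    have h1 : S.vermaEquiv lam (S.iunit (c • S.vgenL lam)) = c • S.vgen lam :=
      S.indLift_iunit (S.vline lam).incl (c • S.vgenL lam)
    exact h1 ▸ W.smul_mem c h0
  · rw [← ind_ι_nm, map_smul]
    exact hx x x.2 _ hm
  · rw [map_add]
    exact W.add_mem ha hb
  · rw [← ind_algebraMap, map_smul]
    exact W.smul_mem c hm

theorem mem_span_vgen_sup (hp : S.Pointed) (v : Res K g (S.Verma lam)) :
    v ∈ Submodule.span K {S.vgen lam} ⊔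
      wtSum (S.rb (Res K g (S.Verma lam))) {χ | S.wle χ lam ∧ χ ≠ lam} := by
  have h2 : S.vgen lam ∈ wtSum (S.rb (Res K g (S.Verma lam))) {lam} :=
    wt_le_wtSum (Set.mem_singleton lam) (S.vgen_mem_wt lam)
  rw [verma_eq_top (Submodule.mem_sup_left (Submodule.mem_span_singleton_self _))
    fun x hx w hw => ?_]
  · trivial
  obtain ⟨a, ha, s, hs, rfl⟩ := Submodule.mem_sup.1 hw
  obtain ⟨c, rfl⟩ := Submodule.mem_span_singleton.1 ha
  have hx' : x ∈ wtSum S.adh (-S.Φp) := by rw [← S.nm_eq]; exact hx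
  rw [lie_add, lie_smul]
  refine Submodule.mem_sup_right (add_mem (Submodule.smul_mem _ _ ?_) ?_)
  · refine S.lie_mem_wtSum (fun α hα χ hχ => ?_) hx' h2
    rw [Set.mem_singleton_iff.1 hχ]
    refine ⟨?_, fun h => ?_⟩
    · change lam - (lam + α) ∈ S.Γp
      rw [sub_add_cancel_left]
      exact AddSubmonoid.subset_closure hα
    · refine S.zero_notMem_Φp ?_
      rw [add_eq_left.1 h] at hα
      simpa using hα
  · refine S.lie_mem_wtSum (fun α hα χ hχ => ?_) hx' hs
    have h3 : -α ∈ S.Γp := AddSubmonoid.subset_closure hα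
    have h4 : lam - χ ∈ S.Γp := hχ.1
    refine ⟨?_, fun h => hχ.2 ?_⟩
    · change lam - (χ + α) ∈ S.Γp
      rw [← sub_sub, sub_eq_add_neg]
      exact add_mem h4 h3
    · have h5 : α = lam - χ := by rw [← h, add_sub_cancel_left]
      have h6 := hp _ h4 (h5 ▸ h3)
      exact (sub_eq_zero.1 h6).symm

theorem eq_smul_vgen (hp : S.Pointed) {v : Res K g (S.Verma lam)}
    (hv : v ∈ wt (S.rb (Res K g (S.Verma lam))) lam) : ∃ c : K, v = c • S.vgen lam := by
  obtain ⟨a, ha, s, hs, h⟩ := Submodule.mem_sup.1 (S.mem_span_vgen_sup hp v)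
  obtain ⟨c, rfl⟩ := Submodule.mem_span_singleton.1 ha
  refine ⟨c, sub_eq_zero.1 (eq_zero_of_mem_wt_of_mem_wtSum
    (D := {χ | S.wle χ lam ∧ χ ≠ lam}) (fun h' => h'.2 rfl) (sub_mem hv (Submodule.smul_mem _ c (S.vgen_mem_wt lam))) ?_)⟩
  rw [← h, add_sub_cancel_left]
  exact hs

theorem wtIn_verma : S.WtIn (Res K g (S.Verma lam)) Set.univ := fun v => by
  have h : wtSum (S.rb (Res K g (S.Verma lam))) Set.univ = ⊤ := verma_eq_top
    (wt_le_wtSum (Set.mem_univ lam) (S.vgen_mem_wt lam))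
    fun x _ w hw => S.lie_mem_wtSum (fun _ _ _ _ => Set.mem_univ _) (S.mem_wtSum_adh x) hw
  rw [h]; trivial

theorem lie_vgen_ne_zero {x : g} (hx : x ∈ S.nm) {z : g} (hz : ⁅x, z⁆ ≠ 0)
    (hv : S.vgen lam ≠ 0) : ⁅x, S.vgen lam⁆ ≠ 0 := by
  have h1 : ι K (⟨x, hx⟩ : S.nm) ≠ (0 : UEA K S.nm) := fun h => hz (by
    have h2 := congrArg (UniversalEnvelopingAlgebra.lift K (LieModule.toEnd K S.nm g)) h
    rw [UniversalEnvelopingAlgebra.lift_ι_apply, map_zero] at h2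
    exact LinearMap.congr_fun h2 z)
  have h2 : S.vgenL lam ≠ 0 := fun h => hv (congrArg Subtype.val h)
  have h3 : S.itmul (ι K (⟨x, hx⟩ : S.nm)) (S.vgenL lam) ≠ 0 := fun h => by
    obtain ⟨φ, hφ⟩ : ∃ φ : Module.Dual K (UEA K S.nm), φ (ι K (⟨x, hx⟩ : S.nm)) ≠ 0 := by
      by_contra! h'
      exact h1 ((Module.forall_dual_apply_eq_zero_iff K _).1 h')
    obtain ⟨ψ, hψ⟩ : ∃ ψ : Module.Dual K (S.vline lam), ψ (S.vgenL lam) ≠ 0 := by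
      by_contra! h'
      exact h2 ((Module.forall_dual_apply_eq_zero_iff K _).1 h')
    have h4 := congrArg (LinearMap.mul' K K ∘ₗ TensorProduct.map φ ψ) h
    exact mul_ne_zero hφ hψ (h4.trans (map_zero (LinearMap.mul' K K ∘ₗ TensorProduct.map φ ψ)))
  intro h
  refine h3 ((S.vermaEquiv lam).injective (Eq.trans ?_ (map_zero _).symm))
  have h4 : S.itmul (ι K (⟨x, hx⟩ : S.nm)) (S.vgenL lam) =
      (ι K x : UEA K g) • S.iunit (S.vgenL lam) := by
    have h5 := S.ind_ι_nm ⟨x, hx⟩ (S.iunit (S.vgenL lam))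
    refine Eq.trans ?_ h5.symm
    exact (congrArg (fun u => S.itmul u (S.vgenL lam)) (mul_one _)).symm.trans
      (S.iact_itmul _ _ _).symm
  rw [h4, map_smul]
  exact (congrArg (ι K x • ·) (S.indLift_iunit (S.vline lam).incl (S.vgenL lam))).trans h

end VermaStructure

end RootReductive

namespace DualVermaData

open RootReductive

variable {S : RootReductive K g} {lam : Module.Dual K S.h} (N : DualVermaData S lam)

/-- The elements of a dual Verma module as functionals. -/
def fn : Res K g N.M →+ Module.Dual K (Res K g (S.Verma lam)) where
  toFun f :=
    { toFun := N.pair f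
      map_add' := map_add (N.pair f)
      map_smul' := fun c v => (congrArg (N.pair f)
        (algebraMap_smul (UEA K g) c (show S.Verma lam from v))).trans (map_smul (N.pair f) c v) }
  map_zero' := LinearMap.ext fun v => LinearMap.congr_fun (map_zero N.pair) v
  map_add' f f' := LinearMap.ext fun v => LinearMap.congr_fun (map_add N.pair f f') v

theorem fn_injective : Function.Injective N.fn := fun _ _ h =>
  N.inj (LinearMap.ext fun v => LinearMap.congr_fun h v)

theorem fn_lie (x : g) (f : Res K g N.M) (v : Res K g (S.Verma lam)) :
    N.fn ⁅x, f⁆ v = N.fn f ⁅S.τ x, v⁆ := N.equivar x f v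

theorem exists_fn (φ : Module.Dual K (Res K g (S.Verma lam)))
    (h : {χ | ∃ v ∈ wt (S.rb (Res K g (S.Verma lam))) χ, φ v ≠ 0}.Finite) :
    ∃ f, N.fn f = φ := by
  obtain ⟨f, hf⟩ := N.surj
    { toFun := φ
      map_add' := map_add φ
      map_smul' := fun c v => (congrArg φ
        (algebraMap_smul (UEA K g) c (show S.Verma lam from v)).symm).trans
          (map_smul φ c v) } (h.subset fun χ ⟨v, hv, h0⟩ => ⟨v, mem_wt.2 hv, h0⟩)
  exact ⟨f, LinearMap.ext fun v => LinearMap.congr_fun hf v⟩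

theorem fn_smul_lie (c : K) (x : g) (f : Res K g N.M) (v : Res K g (S.Verma lam)) :
    N.fn (c • f) ⁅x, v⁆ = c * N.fn f ⁅x, v⁆ := by
  have h1 : ⁅S.τ x, c • f⁆ = ⁅c • S.τ x, f⁆ := by rw [lie_smul, smul_lie]
  rw [← S.τ_invol x, ← fn_lie, h1, fn_lie, map_smul, smul_lie, map_smul, smul_eq_mul]

theorem fn_smul_of_vgen {c : K} {f : Res K g N.M}
    (h : N.fn (c • f) (S.vgen lam) = c * N.fn f (S.vgen lam)) : N.fn (c • f) = c • N.fn f := by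
  have h1 : LinearMap.eqLocus (N.fn (c • f)) (c • N.fn f) = ⊤ :=
    verma_eq_top h fun x _ w _ => N.fn_smul_lie c x f w
  exact LinearMap.ext fun v => (h1 ▸ trivial : v ∈ LinearMap.eqLocus (N.fn (c • f)) (c • N.fn f))

theorem fn_smul_of_ne_zero (h : lam ≠ 0) (c : K) (f : Res K g N.M) :
    N.fn (c • f) = c • N.fn f := by
  obtain ⟨H, hH⟩ : ∃ H, lam H ≠ 0 := by
    by_contra! h'; exact h (LinearMap.ext h')
  have h1 : ⁅(H : g), S.vgen lam⁆ = lam H • S.vgen lam := mem_wt.1 (S.vgen_mem_wt lam) H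
  have h2 := N.fn_smul_lie c H f (S.vgen lam)
  rw [h1, LinearMap.map_smul, LinearMap.map_smul, smul_eq_mul, smul_eq_mul, mul_left_comm] at h2
  exact N.fn_smul_of_vgen (mul_left_cancel₀ hH h2)

/-- The vectors on which the action of the field is compatible with the pairing. -/
def linPart : Submodule K (Res K g N.M) where
  carrier := {f | ∀ c : K, N.fn (c • f) = c • N.fn f}
  add_mem' {f f'} h h' c := by rw [smul_add, map_add, map_add, h, h', smul_add]
  zero_mem' c := by rw [smul_zero, map_zero, smul_zero]
  smul_mem' d f h c := by rw [smul_smul, h, h, smul_smul]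

theorem lie_mem_linPart (x : g) (f : Res K g N.M) : ⁅x, f⁆ ∈ N.linPart := fun c =>
  LinearMap.ext fun v => by
    have h1 : c • ⁅x, f⁆ = ⁅c • x, f⁆ := (smul_lie _ _ _).symm
    rw [h1, fn_lie, map_smul, smul_lie, map_smul, LinearMap.smul_apply, fn_lie]

theorem fn_eq_zero {f : Res K g N.M} {χ : Module.Dual K S.h}
    (hf : f ∈ wt (S.rb (Res K g N.M)) 0) (hχ : χ ≠ 0) {v : Res K g (S.Verma lam)}
    (hv : v ∈ wt (S.rb (Res K g (S.Verma lam))) χ) : N.fn f v = 0 := by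
  obtain ⟨H, hH⟩ : ∃ H, χ H ≠ 0 := by
    by_contra! h'; exact hχ (LinearMap.ext h')
  have h1 : ⁅(H : g), f⁆ = 0 := (mem_wt.1 hf H).trans (zero_smul K f)
  have h2 : ⁅(H : g), v⁆ = χ H • v := mem_wt.1 hv H
  have h3 := N.fn_lie H f v
  rw [h1, map_zero, S.τ_h H H.2, h2, map_smul] at h3
  exact (mul_eq_zero.1 h3.symm).resolve_left hH

theorem fn_smul_of_nonempty {N : DualVermaData S 0} (hp : S.Pointed) (h : S.Φp.Nonempty)
    (hM : S.WtIn (Res K g N.M) Set.univ) (c : K) (f : Res K g N.M) :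
    N.fn (c • f) = c • N.fn f := by
  by_cases h0 : S.vgen 0 = 0
  · exact N.fn_smul_of_vgen (by rw [h0, map_zero, map_zero, mul_zero])
  suffices h1 : wtSum (S.rb (Res K g N.M)) Set.univ ≤ N.linPart from h1 (hM f) c
  refine wtSum_le.2 fun χ _ f hf => ?_
  by_cases hχ : χ = 0
  · subst hχ
    obtain ⟨α, hα⟩ := h
    have hα' : -α ∈ S.Φ := S.pos_union ▸ Or.inr (by simpa using hα)
    have hα0 : α ≠ 0 := fun h => S.zero_notMem_Φp (h ▸ hα)
    obtain ⟨H, hH⟩ : ∃ H, α H ≠ 0 := by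
      by_contra! h'; exact hα0 (LinearMap.ext h')
    obtain ⟨y, hy, hy0⟩ : ∃ y ∈ rootSp K g S.h (-α), y ≠ 0 :=
      Submodule.exists_mem_ne_zero_of_ne_bot ((S.root_iff (-α)).1 hα').2
    have hyz : ⁅y, (H : g)⁆ ≠ 0 := by
      have h1 : ⁅(H : g), y⁆ = (-α) H • y := hy H
      rw [← lie_skew, h1, LinearMap.neg_apply, neg_smul, neg_neg]
      exact smul_ne_zero hH hy0
    have hyn : y ∈ S.nm := by
      rw [← LieSubalgebra.mem_toSubmodule, S.nm_def]
      exact Submodule.mem_iSup_of_mem α (Submodule.mem_iSup_of_mem hα hy)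
    have hyv := lie_vgen_ne_zero hyn hyz h0
    obtain ⟨ψ, hψ⟩ : ∃ ψ : Module.Dual K (Res K g (S.Verma 0)), ψ ⁅y, S.vgen 0⁆ ≠ 0 := by
      by_contra! h'
      exact hyv ((Module.forall_dual_apply_eq_zero_iff K _).1 h')
    obtain ⟨π, hπ, hπ0⟩ := (wtIn_verma (S := S) (lam := 0)).exists_proj (-α)
    have hw : ∀ χ, ∀ v ∈ wt (S.rb (Res K g (S.Verma 0))) χ,
        ⁅y, v⁆ ∈ wt (S.rb (Res K g (S.Verma 0))) (χ - α) := fun χ v hv => by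
      have := S.lie_mem_wt hy hv
      rwa [← sub_eq_add_neg] at this
    obtain ⟨f', hf'⟩ := N.exists_fn ((N.fn f (S.vgen 0) * (ψ ⁅y, S.vgen 0⁆)⁻¹) • (ψ ∘ₗ π))
      ((Set.finite_singleton (-α)).subset fun χ ⟨v, hv, h0⟩ => by
        by_contra hc
        refine h0 ?_
        rw [LinearMap.smul_apply, LinearMap.comp_apply, hπ0 χ hc v hv, map_zero, smul_zero])
    have key : f = ⁅S.τ y, f'⁆ := by
      refine N.fn_injective (wtIn_verma.hom_ext fun χ v hv => ?_)
      rw [fn_lie, S.τ_invol, hf', LinearMap.smul_apply, LinearMap.comp_apply]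
      by_cases hχ : χ = 0
      · subst hχ
        obtain ⟨d, rfl⟩ := eq_smul_vgen hp hv
        have h2 := hw 0 _ (S.vgen_mem_wt 0)
        rw [zero_sub] at h2
        rw [lie_smul, map_smul, map_smul, map_smul, hπ _ h2, smul_eq_mul, smul_eq_mul, smul_eq_mul]
        field_simp
      · rw [N.fn_eq_zero hf hχ hv, hπ0 (χ - α) (fun h => hχ ?_) _ (hw χ v hv), map_zero, smul_zero]
        rwa [sub_eq_neg_self] at h
    rw [key]
    exact N.lie_mem_linPart _ _
  · obtain ⟨H, hH⟩ : ∃ H, χ H ≠ 0 := by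
      by_contra! h'; exact hχ (LinearMap.ext h')
    have h1 : ⁅(H : g), f⁆ = χ H • f := mem_wt.1 hf H
    have h2 : f = (χ H)⁻¹ • ⁅(H : g), f⁆ := by rw [h1, smul_smul, inv_mul_cancel₀ hH, one_smul]
    rw [h2]
    exact N.linPart.smul_mem _ (N.lie_mem_linPart _ _)

end DualVermaData

section

open RootReductive

variable {S : RootReductive K g} {lam : Module.Dual K S.h}

theorem RootReductive.nm_eq_bot (h : S.Φp = ∅) {x : g} (hx : x ∈ S.nm) : x = 0 := by
  rw [← LieSubalgebra.mem_toSubmodule, S.nm_def, h] at hx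
  simpa using hx

theorem RootReductive.indLift_id_bijective (h : S.Φp = ∅) (L : Type) [AddCommGroup L]
    [Module (UEA K g) L] :
    Function.Bijective (S.indLift (LieModuleHom.id : Res K g L →ₗ⁅K, S.b⁆ Res K g L)) := by
  have h1 (l : Res K g L) :
      S.indLift (LieModuleHom.id : Res K g L →ₗ⁅K, S.b⁆ Res K g L) (S.iunit l) = l :=
    S.indLift_iunit LieModuleHom.id l
  have h2 (m : S.Ind (Res K g L)) : ∃ l, S.iunit l = m := by
    refine S.ind_induction (p := fun m => ∃ l, S.iunit l = m) (fun f => ⟨f, rfl⟩)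
      (fun x m _ => ⟨0, ?_⟩) ?_ ?_ m
    · have h3 : x = 0 := Subtype.ext (nm_eq_bot h x.2)
      rw [h3, map_zero, map_zero, map_zero, LinearMap.zero_apply]
    · rintro _ _ ⟨l, rfl⟩ ⟨l', rfl⟩
      exact ⟨l + l', map_add _ _ _⟩
    · rintro c _ ⟨l, rfl⟩
      exact ⟨c • l, map_smul _ _ _⟩
  refine ⟨(injective_iff_map_eq_zero _).2 fun m hm => ?_, fun l => ⟨_, h1 l⟩⟩
  obtain ⟨l, rfl⟩ := h2 m
  have h3 : l = 0 := (h1 l).symm.trans hm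
  rw [h3, map_zero]

theorem RootReductive.wt_verma_zero_eq_top (h : S.Φp = ∅) :
    wt (S.rb (Res K g (S.Verma (0 : Module.Dual K S.h)))) 0 = ⊤ :=
  verma_eq_top (S.vgen_mem_wt 0) fun x hx w _ => by
    rw [nm_eq_bot h hx, zero_lie]
    exact zero_mem _

namespace DualVermaData

theorem wt_zero_eq_top (h : S.Φp = ∅) (N : DualVermaData S 0) :
    wt (S.rb (Res K g N.M)) 0 = ⊤ := by
  refine eq_top_iff.2 fun f _ => mem_wt.2 fun H => ?_
  have h1 : ⁅(H : g), f⁆ = 0 := N.fn_injective (LinearMap.ext fun v => by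
    have h2 : v ∈ wt (S.rb (Res K g (S.Verma (0 : Module.Dual K S.h)))) 0 :=
      wt_verma_zero_eq_top h ▸ trivial
    have h3 : ⁅(H : g), v⁆ = 0 := (mem_wt.1 h2 H).trans (zero_smul K v)
    rw [fn_lie, S.τ_h H H.2, h3, map_zero, map_zero]
    rfl)
  exact h1.trans (zero_smul K f).symm

/-- The elements of a dual Verma module as functionals, linearly. -/
def fnₗ (N : DualVermaData S lam) (h : ∀ (c : K) f, N.fn (c • f) = c • N.fn f) :
    Res K g N.M →ₗ[K] Module.Dual K (Res K g (S.Verma lam)) :=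
  { N.fn with map_smul' := h }

theorem toHfin_bijective (N : DualVermaData S lam) (hM : S.WtIn (Res K g N.M) Set.univ)
    (h : ∀ (c : K) f, N.fn (c • f) = c • N.fn f) :
    Function.Bijective (toHfin (M := S.Verma lam) hM (N.fnₗ h) N.fn_lie) := by
  refine ⟨fun f f' hf => N.fn_injective ?_, fun θ => ?_⟩
  · exact (ev_toHfin hM (N.fnₗ h) N.fn_lie f).symm.trans
      ((congrArg (S.ev (S.Verma lam)) hf).trans (ev_toHfin hM (N.fnₗ h) N.fn_lie f'))
  · obtain ⟨s, θ', -, h1, h2⟩ := exists_sum_of_mem_wtSum (S.wtIn_hfin (S.Verma lam) θ)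
    obtain ⟨f, hf⟩ := N.exists_fn (S.ev (S.Verma lam) θ) (s.finite_toSet.subset
      fun χ ⟨v, hv, h0⟩ => by
        by_contra hc
        refine h0 ?_
        rw [← h2, map_sum, LinearMap.sum_apply]
        exact Finset.sum_eq_zero fun χ' hχ' =>
          S.ev_eq_zero (by rintro rfl; exact hc hχ') (h1 χ') hv)
    exact ⟨f, S.ev_injective _ ((ev_toHfin hM (N.fnₗ h) N.fn_lie f).trans hf)⟩

variable {D : Set (Module.Dual K S.h)}

theorem cov_hfin_of_smul (N : DualVermaData S lam) (hp : S.Pointed) (hId : S.IsIdeal D)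
    (hD : S.UpperFinite D) (hM : S.WtIn (Res K g N.M) D) (hF : S.FW (Res K g N.M))
    (h : ∀ (c : K) f, N.fn (c • f) = c • N.fn f) (n : ℕ) :
    Cov (fun M : ModuleCat.{0} (UEA K g) => S.WtIn (Res K g M) D ∧ S.FW (Res K g M))
      (fun M : ModuleCat.{0} (UEA K g) => S.WtIn (Res K g M) D) n
      (ModuleCat.of (UEA K g) (S.hfin N.M)) := by
  have hM' : S.WtIn (Res K g N.M) Set.univ := hM.mono (Set.subset_univ D)
  let e : N.M ≃ₗ[UEA K g] S.hfin (S.Verma lam) :=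
    LinearEquiv.ofBijective _ (N.toHfin_bijective hM' h)
  have hV : S.WtIn (Res K g (S.Verma lam)) Set.univ := wtIn_verma
  have h1 : S.FW (Res K g (S.hfin (S.Verma lam))) :=
    hF.of_surjective hM' (S.resb e.toLinearMap) e.surjective
  have h2 : S.FW (Res K g (S.hfin (S.hfin (S.Verma lam)))) := FW.hfin h1 hV.hfin
  have h3 : S.FW (Res K g (S.Verma lam)) :=
    h2.of_injective (S.resb (toDD hV)) (toDD_injective hV)
  let e' : S.hfin N.M ≃ₗ[UEA K g] S.Verma lam :=
    ((S.dualFun Set.univ).mapEquiv (M := ModuleCat.of _ N.M)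
      (N := ModuleCat.of _ (S.hfin (S.Verma lam))) e).symm.trans
      (LinearEquiv.ofBijective _ (toDD_bijective hV h3)).symm
  exact Cov.of_equiv (V := ModuleCat.of (UEA K g) (S.Verma lam)) (S.subQuot_wtIn_fw D) e'.symm
    (cov_verma hp hId hD (hM.hfin.of_surjective (S.resb e'.toLinearMap) e'.surjective) n)

theorem cov_hfin_of_empty (N : DualVermaData S 0) (hp : S.Pointed) (hId : S.IsIdeal D)
    (hD : S.UpperFinite D) (hM : S.WtIn (Res K g N.M) D) (hF : S.FW (Res K g N.M))
    (h : S.Φp = ∅) (n : ℕ) :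
    Cov (fun M : ModuleCat.{0} (UEA K g) => S.WtIn (Res K g M) D ∧ S.FW (Res K g M))
      (fun M : ModuleCat.{0} (UEA K g) => S.WtIn (Res K g M) D) n
      (ModuleCat.of (UEA K g) (S.hfin N.M)) := by
  have h1 : S.WtIn (Res K g N.M) {0} := fun f =>
    wt_le_wtSum (Set.mem_singleton _) (wt_zero_eq_top h N ▸ trivial)
  have h2 : (⊤ : Submodule K (Res K g (S.hfin N.M))) ≤ wt (S.rb (Res K g (S.hfin N.M))) 0 :=
    fun f _ => (wtSum_le.2 fun χ hχ => by rw [Set.mem_singleton_iff.1 hχ] :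
      wtSum (S.rb (Res K g (S.hfin N.M))) {0} ≤ wt (S.rb (Res K g (S.hfin N.M))) 0) (h1.hfin f)
  have : FiniteDimensional K (Res K g (S.hfin N.M)) :=
    Module.finite_def.2 ((FW.hfin hF hM 0).of_le h2)
  exact Cov.of_equiv (V := ModuleCat.of (UEA K g) (S.Ind (Res K g (S.hfin N.M))))
    (S.subQuot_wtIn_fw D)
    (LinearEquiv.ofBijective _ (indLift_id_bijective h (S.hfin N.M)))
    (cov_ind hp hId hD n (Res K g (S.hfin N.M)) hM.hfin)

theorem cov_hfin (N : DualVermaData S lam) (hp : S.Pointed) (hId : S.IsIdeal D)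
    (hD : S.UpperFinite D) (hM : S.WtIn (Res K g N.M) D) (hF : S.FW (Res K g N.M)) (n : ℕ) :
    Cov (fun M : ModuleCat.{0} (UEA K g) => S.WtIn (Res K g M) D ∧ S.FW (Res K g M))
      (fun M : ModuleCat.{0} (UEA K g) => S.WtIn (Res K g M) D) n
      (ModuleCat.of (UEA K g) (S.hfin N.M)) := by
  by_cases hl : lam = 0
  · subst hl
    rcases S.Φp.eq_empty_or_nonempty with h | h
    · exact N.cov_hfin_of_empty hp hId hD hM hF h n
    · exact N.cov_hfin_of_smul hp hId hD hM hF
        (fn_smul_of_nonempty hp h (hM.mono (Set.subset_univ D))) n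
  · exact N.cov_hfin_of_smul hp hId hD hM hF (N.fn_smul_of_ne_zero hl) n

end DualVermaData

theorem HasDualVermaFlag.cov {D : Set (Module.Dual K S.h)} (hp : S.Pointed) (hId : S.IsIdeal D)
    (hD : S.UpperFinite D) {Nb : ∀ μ : Module.Dual K S.h, DualVermaData S μ}
    {Y : ModuleCat.{0} (UEA K g)} (hY : S.WtIn (Res K g Y) D ∧ S.FW (Res K g Y))
    (h : HasDualVermaFlag S Nb Y) (n : ℕ) :
    Cov (fun M : ModuleCat.{0} (UEA K g) => S.WtIn (Res K g M) D ∧ S.FW (Res K g M))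
      (fun M : ModuleCat.{0} (UEA K g) => S.WtIn (Res K g M) D) n
      (ModuleCat.of (UEA K g) (S.hfin Y)) := by
  obtain ⟨m, F, h0, hl, hi⟩ := h
  refine flag_induction (p := fun M => Cov _ _ n (ModuleCat.of (UEA K g) (S.hfin M)))
    (S.subQuot_wtIn_fw D) (fun Z hZ _ => cov_of_subsingleton hp hId hD n _ ?_)
    (fun E hE hQ hZ hX => ?_) (fun e => Cov.of_equiv (S.subQuot_wtIn_fw D)
      ((S.dualFun D).mapEquiv e).symm) hY F h0 hl fun i => ?_
  · exact ⟨fun f f' => hfin_ext fun m => by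
      have h1 : m = 0 := Subsingleton.elim (α := Z) _ _
      rw [h1]
      exact (map_zero (S.ev Z f)).trans (map_zero (S.ev Z f')).symm⟩
  · exact Cov.extension (fun _ h => h.1) (S.subQuot_wtIn_fw D) (subQuot_wtIn D)
      (S.extClosed_wtIn_fw D) ((S.dualFun D).ses E) ((S.dualFun D).ses_isEx hE hQ.1)
      hQ.1.hfin hX hZ
  · obtain ⟨lam, ⟨e⟩⟩ := hi i
    have h1 := (S.subQuot_wtIn_fw D).quot (M := ModuleCat.of _ (F i.succ))
      (N := ModuleCat.of _ (subquot (F i.castSucc) (F i.succ)))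
      (Submodule.mkQ _) (Submodule.mkQ_surjective _) ((S.subQuot_wtIn_fw D).sub_sub _ hY)
    have h2 := (S.subQuot_wtIn_fw D).quot (M := ModuleCat.of _ (subquot (F i.castSucc) (F i.succ)))
      (N := ModuleCat.of _ (Nb lam).M) e.toLinearMap e.surjective h1
    exact Cov.of_equiv (S.subQuot_wtIn_fw D)
      ((S.dualFun D).mapEquiv (M := ModuleCat.of _ (subquot (F i.castSucc) (F i.succ)))
        (N := ModuleCat.of _ (Nb lam).M) e) ((Nb lam).cov_hfin hp hId hD h2.1 h2.2 n)

end

theorem bijective_yextFamMap_of_flag {S : RootReductive K g}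
    {Nb : ∀ μ : Module.Dual K S.h, DualVermaData S μ} {D : Set (Module.Dual K S.h)}
    (hp : S.Pointed) (hId : S.IsIdeal D) (hUF : S.UpperFinite D) {X Y : ModuleCat.{0} (UEA K g)}
    (hX : S.WtIn (Res K g X) D ∧ S.FW (Res K g X)) (hY : S.WtIn (Res K g Y) D ∧ S.FW (Res K g Y))
    (h : S.HasVermaFlag X ∨ HasDualVermaFlag S Nb Y) (i : ℕ) :
    Function.Bijective (yextFamMap (UEA K g)
      (P := fun M => S.WtIn (Res K g M) D ∧ S.FW (Res K g M)) (Q := fun M => S.WtIn (Res K g M) D)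
      (fun _ h => h.1) (X := X) (Y := Y) i) := by
  rcases h with h | h
  · exact bijective_yextFamMap_of_cov _ (RootReductive.subQuot_wtIn D) (S.extClosed_wtIn_fw D) hY
      (fun n => RootReductive.HasVermaFlag.cov hp hId hUF hX.1 h n) i
  · exact DualFun.bijective_yextFamMap (S.dualFun D) _ (RootReductive.subQuot_wtIn D) (S.extClosed_wtIn_fw D)
      (fun M h => ⟨h.1.hfin, h.2.hfin h.1⟩)
      (fun M h => RootReductive.toDD_bijective (h.1.mono (Set.subset_univ D)) h.2) hX hY
      (fun n => HasDualVermaFlag.cov hp hId hUF hY h n) i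

/-- extension fullness of truncated categories, for an upper finite ideal
`K ⊆ h^*`: (i) `^K O` is extension full in `O`; (ii) `^K O` is extension full in the
category `C` of weight modules; (iii) for `M` with a Verma flag or `N` with a dual
Verma flag in `^K Ō`, the inclusion `^K Ō ⊆ ^K O` induces isomorphisms on all
extension groups `Ext^i(M, N)`. -/
theorem truncated_O_extension_full (S : RootReductive K g) (hD : S.IsDynkin)
    (Nb : ∀ μ : Module.Dual K S.h, DualVermaData S μ)
    (Kset : Set (Module.Dual K S.h)) (hId : S.IsIdeal Kset) (hUF : S.UpperFinite Kset) :
    -- (i)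
    ExtFullPair (UEA K g)
      (fun M => S.InO M ∧ S.suppSet M ⊆ Kset) (fun M => S.InO M)
      (fun _ h => h.1) ∧
    -- (ii)
    ExtFullPair (UEA K g)
      (fun M => S.InO M ∧ S.suppSet M ⊆ Kset) (fun M => S.IsWeightMod M)
      (fun _ h => h.1.1) ∧
    -- (iii)
    (∀ X Y : ModuleCat.{0} (UEA K g),
      (S.InO X ∧ S.suppSet X ⊆ Kset) → S.HasFinDimWt X →
      (S.InO Y ∧ S.suppSet Y ⊆ Kset) → S.HasFinDimWt Y →
      (S.HasVermaFlag X ∨ HasDualVermaFlag S Nb Y) →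
      ∀ i : ℕ, Function.Bijective
        (yextFamMap (UEA K g)
          (P := fun M => (S.InO M ∧ S.suppSet M ⊆ Kset) ∧ S.HasFinDimWt M)
          (Q := fun M => S.InO M ∧ S.suppSet M ⊆ Kset)
          (fun _ h => h.1) (X := X) (Y := Y) i)) := by
  rcases Kset.eq_empty_or_nonempty with rfl | hne
  · have hs {M : ModuleCat.{0} (UEA K g)} (h : S.InO M ∧ S.suppSet M ⊆ ∅) : Subsingleton M :=
      RootReductive.subsingleton_of_supp_empty h.1.1 h.2
    refine ⟨fun X Y hX hY i => ?_, fun X Y hX hY i => ?_, fun X Y hX hX' hY hY' _ i => ?_⟩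
    · have := hs hX
      have := hs hY
      exact bijective_yextFamMap_of_subsingleton (fun _ h => h.1) hX hY i
    · have := hs hX
      have := hs hY
      exact bijective_yextFamMap_of_subsingleton (fun _ h => h.1.1) hX hY i
    · have := hs hX
      have := hs hY
      exact bijective_yextFamMap_of_subsingleton (fun _ h => h.1) ⟨hX, hX'⟩ ⟨hY, hY'⟩ i
  · refine ⟨RootReductive.extFullPair_inO hne hId hUF,
      RootReductive.extFullPair_isWeightMod hne hId hUF, fun X Y hX hX' hY hY' h i => ?_⟩
    have hW := RootReductive.inO_supp_iff hne hId hUF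
    have hF (M : ModuleCat.{0} (UEA K g)) := RootReductive.hasFinDimWt_iff (S := S) (M := M)
    have key (P Q : ModuleCat.{0} (UEA K g) → Prop) (hPQ : ∀ M, P M → Q M)
        (hP : P = fun M : ModuleCat.{0} (UEA K g) => S.WtIn (Res K g M) Kset ∧
          S.FW (Res K g M))
        (hQ : Q = fun M : ModuleCat.{0} (UEA K g) => S.WtIn (Res K g M) Kset) :
        Function.Bijective (yextFamMap (UEA K g) hPQ (X := X) (Y := Y) i) := by
      subst hP hQ
      exact bijective_yextFamMap_of_flag (Nb := Nb) (RootReductive.pointed_of hne hId hUF) hId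
        hUF ⟨(hW X).1 hX, (hF X).1 hX'⟩ ⟨(hW Y).1 hY, (hF Y).1 hY'⟩ h i
    exact key _ _ _ (funext fun M => propext (and_congr (hW M) (hF M)))
      (funext fun M => propext (hW M))
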